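/- arXiv:1711.01614 — 2 statements merged into one kernel-verified Lean document; each statement's English description precedes it below -/
import Mathlib

section
/- For every integer k ≥ 0, setting n = 120k + 50, there exists a planar simple graph on n vertices that contains no subgraph isomorphic to the Theta graph on 5 vertices (a 5-cycle plus a chord) and has exactly 5(n−2)/2 edges. Consequently ex_P(n, Θ₅) = 5(n−2)/2 whenever n ≡ 50 (mod 120). -/
open SimpleGraph

/-- `G` has a planar embedding (drawing in the plane): vertices are mapped to distinct
points of `ℝ²`, each edge `uv` is drawn as a simple continuous arc from the point of `u`
to the point of `v`, arcs traversed in opposite directions coincide, the interior of an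
arc passes through no vertex point, and the interiors of arcs of distinct edges are
disjoint. -/
def SimpleGraph.HasPlanarEmbedding {V : Type*} (G : SimpleGraph V) : Prop :=
  ∃ (pos : V → ℝ × ℝ) (arc : V → V → ℝ → ℝ × ℝ),
    Function.Injective pos ∧
    (∀ u v : V, G.Adj u v →
      ContinuousOn (arc u v) (Set.Icc (0 : ℝ) 1) ∧
      Set.InjOn (arc u v) (Set.Icc (0 : ℝ) 1) ∧
      arc u v 0 = pos u ∧
      arc u v 1 = pos v ∧
      (∀ t : ℝ, arc u v t = arc v u (1 - t)) ∧
      (∀ w : V, ∀ t ∈ Set.Ioo (0 : ℝ) 1, arc u v t ≠ pos w)) ∧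
    (∀ u v x y : V, G.Adj u v → G.Adj x y → s(u, v) ≠ s(x, y) →
      ∀ t₁ ∈ Set.Ioo (0 : ℝ) 1, ∀ t₂ ∈ Set.Ioo (0 : ℝ) 1, arc u v t₁ ≠ arc x y t₂)

/-- `G` contains a subgraph isomorphic to `F`, i.e. there is an injective graph
homomorphism from `F` to `G`. -/
def ContainsCopy {α β : Type*} (F : SimpleGraph α) (G : SimpleGraph β) : Prop :=
  ∃ f : F →g G, Function.Injective f

/-- The Theta graph on 4 vertices: the 4-cycle 0-1-2-3-0 plus the chord 02,
i.e. `K₄` minus one edge. -/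
def theta4 : SimpleGraph (Fin 4) :=
  SimpleGraph.fromEdgeSet {s(0, 1), s(1, 2), s(2, 3), s(0, 3), s(0, 2)}

/-- The Theta graph on 5 vertices: the 5-cycle 0-1-2-3-4-0 plus the chord 02. -/
def theta5 : SimpleGraph (Fin 5) :=
  SimpleGraph.fromEdgeSet {s(0, 1), s(1, 2), s(2, 3), s(3, 4), s(0, 4), s(0, 2)}

/-- The cycle on 6 vertices: 0-1-2-3-4-5-0. -/
def cycle6 : SimpleGraph (Fin 6) :=
  SimpleGraph.fromEdgeSet {s(0, 1), s(1, 2), s(2, 3), s(3, 4), s(4, 5), s(0, 5)}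

/-- `G` contains no member of `Θ₆` as a subgraph: for each pair of distinct
non-consecutive vertices `a`, `b` of the 6-cycle, `G` contains no copy of the Theta
graph obtained from the 6-cycle by adding the chord `ab`. -/
def Theta6Free {β : Type*} (G : SimpleGraph β) : Prop :=
  ∀ a b : Fin 6, a ≠ b → ¬ cycle6.Adj a b →
    ¬ ContainsCopy (cycle6 ⊔ SimpleGraph.fromEdgeSet {s(a, b)}) G

/-- `K₅⁻`: the complete graph on 5 vertices minus one edge. -/
def K5minus : SimpleGraph (Fin 5) :=
  (⊤ : SimpleGraph (Fin 5)).deleteEdges {s(0, 1)}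

namespace PlanarTuran

lemma containsCopy_theta5_iff {V : Type*} (G : SimpleGraph V) :
    ContainsCopy theta5 G ↔ ∃ a b c d e : V, [a, b, c, d, e].Nodup ∧
      G.Adj a b ∧ G.Adj b c ∧ G.Adj c d ∧ G.Adj d e ∧ G.Adj a e ∧ G.Adj a c := by
  constructor
  · rintro ⟨f, hf⟩
    refine ⟨f 0, f 1, f 2, f 3, f 4, ?_, f.map_rel ?_, f.map_rel ?_, f.map_rel ?_,
      f.map_rel ?_, f.map_rel ?_, f.map_rel ?_⟩
    · simp [hf.eq_iff]
    all_goals simp [theta5]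
  · rintro ⟨a, b, c, d, e, hn, hab, hbc, hcd, hde, hae, hac⟩
    refine ⟨⟨![a, b, c, d, e], ?_⟩, ?_⟩
    · intro i j hij
      rw [theta5, SimpleGraph.fromEdgeSet_adj] at hij
      fin_cases i <;> fin_cases j <;>
        simp_all [SimpleGraph.adj_comm]
    · intro i j hij
      simp only [List.nodup_cons, List.mem_cons, not_or] at hn
      fin_cases i <;> fin_cases j <;> simp_all

/-- A finite set of edges meeting every vertex an even number of times. -/
def IsEvenEdgeSet {V : Type*} [DecidableEq V] (S : Finset (Sym2 V)) : Prop :=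
  ∀ v, Even (S.filter (v ∈ ·)).card

namespace IsEvenEdgeSet

variable {V : Type*} [DecidableEq V] {S : Finset (Sym2 V)}

lemma exists_next (hS : IsEvenEdgeSet S) {a b : V} (h : s(a, b) ∈ S) :
    ∃ c, c ≠ a ∧ s(b, c) ∈ S := by
  have hmem : s(a, b) ∈ S.filter (b ∈ ·) := by simp [h]
  obtain ⟨e, he, hne⟩ : ∃ e ∈ S.filter (b ∈ ·), e ≠ s(a, b) := by
    by_contra! hcon
    have : S.filter (b ∈ ·) = {s(a, b)} :=
      Finset.eq_singleton_iff_unique_mem.2 ⟨hmem, hcon⟩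
    have h2 := hS b
    rw [this] at h2
    simp at h2
  obtain ⟨heS, hbe⟩ := Finset.mem_filter.1 he
  obtain ⟨c, rfl⟩ := hbe
  refine ⟨c, ?_, heS⟩
  rintro rfl
  exact hne Sym2.eq_swap

lemma exists_path (hS : IsEvenEdgeSet S) (hd : ∀ e ∈ S, ¬ e.IsDiag) {a b : V}
    (h : s(a, b) ∈ S) :
    ∃ c d, c ≠ a ∧ c ≠ b ∧ a ≠ b ∧ d ≠ b ∧ d ≠ c ∧ s(b, c) ∈ S ∧ s(c, d) ∈ S ∧
      ({s(a, b), s(b, c), s(c, d)} : Finset (Sym2 V)).card = 3 := by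
  obtain ⟨c, hca, hbc⟩ := hS.exists_next h
  obtain ⟨d, hdb, hcd⟩ := hS.exists_next hbc
  have h1 := hd _ h
  have h2 := hd _ hbc
  have h3 := hd _ hcd
  simp only [Sym2.mk_isDiag_iff] at h1 h2 h3
  refine ⟨c, d, hca, Ne.symm h2, h1, hdb, Ne.symm h3, hbc, hcd, ?_⟩
  rw [Finset.card_eq_three]
  refine ⟨_, _, _, ?_, ?_, ?_, rfl⟩ <;> simp only [ne_eq, Sym2.eq_iff] <;> grind

lemma three_le_card (hS : IsEvenEdgeSet S) (hd : ∀ e ∈ S, ¬ e.IsDiag) {a b : V}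
    (h : s(a, b) ∈ S) : 3 ≤ S.card := by
  obtain ⟨c, d, -, -, -, -, -, hbc, hcd, h3⟩ := hS.exists_path hd h
  rw [← h3]
  apply Finset.card_le_card
  grind

lemma eq_triangle (hS : IsEvenEdgeSet S) (hd : ∀ e ∈ S, ¬ e.IsDiag) {a b : V}
    (h : s(a, b) ∈ S) (hcard : S.card = 3) :
    ∃ c, a ≠ b ∧ b ≠ c ∧ c ≠ a ∧ S = {s(a, b), s(b, c), s(c, a)} := by
  obtain ⟨c, d, hca, hcb, hab, hdb, hdc, hbc, hcd, h3⟩ := hS.exists_path hd h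
  have hSeq : S = {s(a, b), s(b, c), s(c, d)} := by
    symm
    apply Finset.eq_of_subset_of_card_le
    · grind
    · omega
  obtain ⟨e, hec, hde⟩ := hS.exists_next hcd
  have hda : d = a := by
    rw [hSeq] at hde
    simp only [Finset.mem_insert, Finset.mem_singleton, Sym2.eq_iff] at hde
    grind
  subst hda
  exact ⟨c, hab, hcb.symm, hca, hSeq⟩

lemma eq_quadrilateral (hS : IsEvenEdgeSet S) (hd : ∀ e ∈ S, ¬ e.IsDiag) {a b : V}
    (h : s(a, b) ∈ S) (hcard : S.card = 4) :
    ∃ c d, [a, b, c, d].Nodup ∧ S = {s(a, b), s(b, c), s(c, d), s(d, a)} := by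
  obtain ⟨c, d, hca, hcb, hab, hdb, hdc, hbc, hcd, h3⟩ := hS.exists_path hd h
  have hsub : ({s(a, b), s(b, c), s(c, d)} : Finset (Sym2 V)) ⊆ S := by grind
  obtain ⟨f, hf⟩ : ∃ f, S \ {s(a, b), s(b, c), s(c, d)} = {f} := by
    rw [← Finset.card_eq_one, Finset.card_sdiff_of_subset hsub]
    omega
  have hmem : ∀ e, e ∈ S ↔ e = s(a, b) ∨ e = s(b, c) ∨ e = s(c, d) ∨ e = f := by
    intro e
    have := congrArg (e ∈ ·) hf
    grind
  have hfS : f ∈ S := by simp [hmem]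
  have hfn : f ≠ s(a, b) ∧ f ≠ s(b, c) ∧ f ≠ s(c, d) := by
    have : f ∈ S \ {s(a, b), s(b, c), s(c, d)} := by simp [hf]
    grind
  by_cases hda : d = a
  · subst hda
    exfalso
    have key : ∀ x y, s(x, y) = f → y = d ∨ y = b ∨ y = c := by
      intro x y hxy
      obtain ⟨z, hzx, hyz⟩ := hS.exists_next (a := x) (b := y) (hxy ▸ hfS)
      rw [hmem, ← hxy] at hyz
      simp only [Sym2.eq_iff] at hyz
      grind
    induction f with
    | h x y =>
      have h1 := key x y rfl
      have h2 := key y x Sym2.eq_swap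
      have h4 := hd _ hfS
      simp only [Sym2.mk_isDiag_iff] at h4
      simp only [ne_eq, Sym2.eq_iff] at hfn
      grind
  · obtain ⟨e, hec, hde⟩ := hS.exists_next hcd
    obtain ⟨g, hgb, hag⟩ := hS.exists_next (a := b) (b := a) (Sym2.eq_swap ▸ h)
    rw [hmem] at hde hag
    have h1 : s(d, e) = f := by
      simp only [Sym2.eq_iff] at hde
      grind
    have h2 : s(a, g) = f := by
      simp only [Sym2.eq_iff] at hag
      grind
    have h4 : f = s(d, a) := by
      have := h1.trans h2.symm
      simp only [Sym2.eq_iff] at this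
      grind
    subst h4
    refine ⟨c, d, by simp; grind, ?_⟩
    ext e
    simp [hmem]

end IsEvenEdgeSet

section DualFaces

variable {V I : Type*} [DecidableEq I]

/-- The edges having the dual vertex `i` on exactly one side. -/
def dualFace (E : Finset (Sym2 V)) (d₁ d₂ : Sym2 V → I) (i : I) : Finset (Sym2 V) :=
  E.filter fun e => d₁ e ≠ d₂ e ∧ (d₁ e = i ∨ d₂ e = i)

/-- The dual vertex on the side of `e` opposite to `i`. -/
def oppositeFace (d₁ d₂ : Sym2 V → I) (i : I) (e : Sym2 V) : I :=
  if d₁ e = i then d₂ e else d₁ e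

/-- The dual vertices with a nonempty boundary. -/
def properFaces (E : Finset (Sym2 V)) (d₁ d₂ : Sym2 V → I) : Finset I :=
  (E.filter fun e => d₁ e ≠ d₂ e).biUnion fun e => {d₁ e, d₂ e}

variable {E : Finset (Sym2 V)} {d₁ d₂ : Sym2 V → I}

lemma mem_dualFace {i : I} {e : Sym2 V} :
    e ∈ dualFace E d₁ d₂ i ↔ e ∈ E ∧ d₁ e ≠ d₂ e ∧ (d₁ e = i ∨ d₂ e = i) := by
  simp [dualFace]

lemma mem_properFaces {i : I} :
    i ∈ properFaces E d₁ d₂ ↔ (dualFace E d₁ d₂ i).Nonempty := by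
  simp only [properFaces, Finset.mem_biUnion, Finset.mem_filter, Finset.mem_insert,
    Finset.mem_singleton, Finset.Nonempty, mem_dualFace]
  grind

lemma oppositeFace_eq_of_mem {i j : I} {e : Sym2 V} (hi : e ∈ dualFace E d₁ d₂ i)
    (hj : e ∈ dualFace E d₁ d₂ j) (hij : i ≠ j) : oppositeFace d₁ d₂ i e = j := by
  rw [mem_dualFace] at hi hj
  unfold oppositeFace
  grind

lemma mem_dualFace_oppositeFace {i : I} {e : Sym2 V} (hi : e ∈ dualFace E d₁ d₂ i) :
    e ∈ dualFace E d₁ d₂ (oppositeFace d₁ d₂ i e) ∧ oppositeFace d₁ d₂ i e ≠ i := by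
  rw [mem_dualFace] at *
  unfold oppositeFace
  grind

/-- A transfer between the two sides of every edge does not change the total charge. -/
lemma sum_charge (g : I → ℤ) :
    ∑ i ∈ properFaces E d₁ d₂, ∑ e ∈ dualFace E d₁ d₂ i,
      (6 + g (oppositeFace d₁ d₂ i e) - g i) =
    12 * ((E.filter fun e => d₁ e ≠ d₂ e).card : ℤ) := by
  have h1 : ∀ i ∈ properFaces E d₁ d₂, ∑ e ∈ dualFace E d₁ d₂ i,
      (6 + g (oppositeFace d₁ d₂ i e) - g i) =
      ∑ e ∈ E.filter (fun e => d₁ e ≠ d₂ e),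
        ((if i = d₁ e then 6 + g (d₂ e) - g (d₁ e) else 0) +
          (if i = d₂ e then 6 + g (d₁ e) - g (d₂ e) else 0)) := by
    intro i _
    rw [dualFace, ← Finset.filter_filter, Finset.sum_filter (p := fun e => d₁ e = i ∨ d₂ e = i)]
    refine Finset.sum_congr rfl fun e he => ?_
    have := (Finset.mem_filter.1 he).2
    unfold oppositeFace
    grind
  rw [Finset.sum_congr rfl h1, Finset.sum_comm]
  have h2 : ∀ e ∈ E.filter (fun e => d₁ e ≠ d₂ e), ∑ i ∈ properFaces E d₁ d₂,
      ((if i = d₁ e then 6 + g (d₂ e) - g (d₁ e) else 0) +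
          (if i = d₂ e then 6 + g (d₁ e) - g (d₂ e) else 0)) = 12 := by
    intro e he
    have m1 : d₁ e ∈ properFaces E d₁ d₂ := by
      simp only [properFaces, Finset.mem_biUnion]
      exact ⟨e, he, by simp⟩
    have m2 : d₂ e ∈ properFaces E d₁ d₂ := by
      simp only [properFaces, Finset.mem_biUnion]
      exact ⟨e, he, by simp⟩
    rw [Finset.sum_add_distrib, Finset.sum_ite_eq_of_mem' _ _ _ m1,
      Finset.sum_ite_eq_of_mem' _ _ _ m2]
    ring
  rw [Finset.sum_congr rfl h2]
  simp [mul_comm]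

/-- The amount of charge a face of length `n` sends through each of its edges. -/
def gift (n : ℕ) : ℤ := if n ≤ 3 then 0 else if n = 4 then 1 else 2

lemma gift_nonneg (n : ℕ) : 0 ≤ gift n := by
  unfold gift; split_ifs <;> norm_num

/-- The final charge of a dual vertex. -/
def charge (E : Finset (Sym2 V)) (d₁ d₂ : Sym2 V → I) (i : I) : ℤ :=
  ∑ e ∈ dualFace E d₁ d₂ i,
    (6 + gift (dualFace E d₁ d₂ (oppositeFace d₁ d₂ i e)).card - gift (dualFace E d₁ d₂ i).card)

lemma charge_eq (i : I) : charge E d₁ d₂ i =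
    (dualFace E d₁ d₂ i).card * (6 - gift (dualFace E d₁ d₂ i).card) +
    ∑ e ∈ dualFace E d₁ d₂ i, gift (dualFace E d₁ d₂ (oppositeFace d₁ d₂ i e)).card := by
  unfold charge
  rw [← nsmul_eq_mul, ← Finset.sum_const, ← Finset.sum_add_distrib]
  exact Finset.sum_congr rfl fun e _ => by ring

/-- A set of dual vertices closed under passing through edges. -/
def IsDualClosed (E : Finset (Sym2 V)) (d₁ d₂ : Sym2 V → I) (K : Finset I) : Prop :=
  ∀ j ∈ K, ∀ e ∈ dualFace E d₁ d₂ j, oppositeFace d₁ d₂ j e ∈ K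

lemma isDualClosed_of_exists {K : Finset I}
    (h : ∀ j ∈ K, ∀ e ∈ dualFace E d₁ d₂ j, ∃ l ∈ K, j ≠ l ∧ e ∈ dualFace E d₁ d₂ l) :
    IsDualClosed E d₁ d₂ K := by
  intro j hj e he
  obtain ⟨l, hl, hjl, hel⟩ := h j hj e he
  rwa [oppositeFace_eq_of_mem he hel hjl]

lemma not_theta5 {G : SimpleGraph V} (hfree : ¬ ContainsCopy theta5 G) {a b c d e : V}
    (hn : [a, b, c, d, e].Nodup) (hab : G.Adj a b) (hbc : G.Adj b c) (hcd : G.Adj c d)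
    (hde : G.Adj d e) (hae : G.Adj a e) (hac : G.Adj a c) : False :=
  hfree ((containsCopy_theta5_iff G).2 ⟨a, b, c, d, e, hn, hab, hbc, hcd, hde, hae, hac⟩)

variable [DecidableEq V]

lemma three_le_card_dualFace (hd : ∀ e ∈ E, ¬ e.IsDiag)
    (heven : ∀ i, IsEvenEdgeSet (dualFace E d₁ d₂ i)) {i : I} {e : Sym2 V}
    (he : e ∈ dualFace E d₁ d₂ i) : 3 ≤ (dualFace E d₁ d₂ i).card := by
  induction e with
  | h a b => exact (heven i).three_le_card (fun e he => hd e (mem_dualFace.1 he).1) he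

lemma charge_ge (hd : ∀ e ∈ E, ¬ e.IsDiag)
    (heven : ∀ i, IsEvenEdgeSet (dualFace E d₁ d₂ i)) {i : I}
    (hi : i ∈ properFaces E d₁ d₂) :
    18 ≤ charge E d₁ d₂ i ∧ (20 ≤ charge E d₁ d₂ i ∨ ((dualFace E d₁ d₂ i).card = 3 ∧
      ∑ e ∈ dualFace E d₁ d₂ i,
        gift (dualFace E d₁ d₂ (oppositeFace d₁ d₂ i e)).card < 2)) := by
  obtain ⟨e, he⟩ := mem_properFaces.1 hi
  have h3 := three_le_card_dualFace hd heven he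
  have hnn : 0 ≤ ∑ e ∈ dualFace E d₁ d₂ i,
      gift (dualFace E d₁ d₂ (oppositeFace d₁ d₂ i e)).card :=
    Finset.sum_nonneg fun e _ => gift_nonneg _
  rw [charge_eq]
  generalize (∑ e ∈ dualFace E d₁ d₂ i,
      gift (dualFace E d₁ d₂ (oppositeFace d₁ d₂ i e)).card) = S at *
  generalize (dualFace E d₁ d₂ i).card = n at *
  unfold gift
  have : (3 : ℤ) ≤ n := by exact_mod_cast h3
  split_ifs with h h'
  · have : n = 3 := by omega
    subst this
    refine ⟨by push_cast; omega, ?_⟩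
    rcases lt_or_ge S 2 with h2 | h2
    · exact Or.inr ⟨rfl, h2⟩
    · left; push_cast; omega
  · subst h'
    constructor
    · push_cast; omega
    · push_cast; omega
  · have : (5 : ℤ) ≤ n := by omega
    constructor
    · nlinarith
    · left; nlinarith

/-- The four faces of a tetrahedron are closed under passing through edges. -/
lemma isDualClosed_tetrahedron {a b c x : V} {i j₁ j₂ j₃ : I}
    (hab : s(x, a) ∉ ({s(b, c), s(c, x), s(x, b)} : Finset (Sym2 V)))
    (hbc : s(x, b) ∉ ({s(c, a), s(a, x), s(x, c)} : Finset (Sym2 V)))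
    (hca : s(x, c) ∉ ({s(a, b), s(b, x), s(x, a)} : Finset (Sym2 V)))
    (n₁ : j₁ ≠ i) (n₂ : j₂ ≠ i) (n₃ : j₃ ≠ i)
    (h₀ : dualFace E d₁ d₂ i = {s(a, b), s(b, c), s(c, a)})
    (h₁ : dualFace E d₁ d₂ j₁ = {s(a, b), s(b, x), s(x, a)})
    (h₂ : dualFace E d₁ d₂ j₂ = {s(b, c), s(c, x), s(x, b)})
    (h₃ : dualFace E d₁ d₂ j₃ = {s(c, a), s(a, x), s(x, c)}) :
    IsDualClosed E d₁ d₂ {i, j₁, j₂, j₃} := by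
  have h12 : j₁ ≠ j₂ := by
    rintro rfl
    exact hab (h₂ ▸ h₁ ▸ by simp)
  have h23 : j₂ ≠ j₃ := by
    rintro rfl
    exact hbc (h₃ ▸ h₂ ▸ by simp)
  have h13 : j₁ ≠ j₃ := by
    rintro rfl
    exact hca (h₁ ▸ h₃ ▸ by simp)
  have sxa : s(x, a) = s(a, x) := Sym2.eq_swap
  have sxb : s(x, b) = s(b, x) := Sym2.eq_swap
  have sxc : s(x, c) = s(c, x) := Sym2.eq_swap
  rw [sxa] at h₁
  rw [sxb] at h₂
  rw [sxc] at h₃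
  have n12 := h12.symm
  have n13 := h13.symm
  have n23 := h23.symm
  have m₁ := n₁.symm
  have m₂ := n₂.symm
  have m₃ := n₃.symm
  apply isDualClosed_of_exists
  intro j hj e he
  simp only [Finset.mem_insert, Finset.mem_singleton] at hj
  simp only [Finset.mem_insert, Finset.mem_singleton, exists_eq_or_imp, exists_eq_left, h₀, h₁,
    h₂, h₃]
  rcases hj with rfl | rfl | rfl | rfl
  · simp only [h₀, Finset.mem_insert, Finset.mem_singleton] at he
    rcases he with he | he | he <;> simp [he, m₁, m₂, m₃]
  · simp only [h₁, Finset.mem_insert, Finset.mem_singleton] at he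
    rcases he with he | he | he <;> simp [he, n₁, h12, h13]
  · simp only [h₂, Finset.mem_insert, Finset.mem_singleton] at he
    rcases he with he | he | he <;> simp [he, n₂, n12, h23]
  · simp only [h₃, Finset.mem_insert, Finset.mem_singleton] at he
    rcases he with he | he | he <;> simp [he, n₃, n13, n23]

/-- In a `Θ₅`-free graph, a triangular face receiving little charge is surrounded by
triangular faces. -/
lemma card_oppositeFace_eq_three (G : SimpleGraph V) (hE : ∀ e, e ∈ E ↔ e ∈ G.edgeSet)
    (heven : ∀ i, IsEvenEdgeSet (dualFace E d₁ d₂ i)) (hfree : ¬ ContainsCopy theta5 G)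
    {i : I} (hcard : (dualFace E d₁ d₂ i).card = 3)
    (hsum : ∑ e ∈ dualFace E d₁ d₂ i,
        gift (dualFace E d₁ d₂ (oppositeFace d₁ d₂ i e)).card < 2) :
    ∀ e ∈ dualFace E d₁ d₂ i, (dualFace E d₁ d₂ (oppositeFace d₁ d₂ i e)).card = 3 := by
  have hd : ∀ e ∈ E, ¬ e.IsDiag := fun e he => G.not_isDiag_of_mem_edgeSet ((hE e).1 he)
  have hdi : ∀ i, ∀ e ∈ dualFace E d₁ d₂ i, ¬ e.IsDiag :=
    fun i e he => hd e (mem_dualFace.1 he).1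
  have hadj : ∀ {i x y}, s(x, y) ∈ dualFace E d₁ d₂ i → G.Adj x y := fun h =>
    (hE _).1 (mem_dualFace.1 h).1
  intro e he
  obtain ⟨heo, hne⟩ := mem_dualFace_oppositeFace he
  set j := oppositeFace d₁ d₂ i e with hj
  have h3 := three_le_card_dualFace hd heven heo
  have hle : gift (dualFace E d₁ d₂ j).card < 2 := lt_of_le_of_lt
    (Finset.single_le_sum
      (f := fun e => gift (dualFace E d₁ d₂ (oppositeFace d₁ d₂ i e)).card)
      (fun e _ => gift_nonneg _) he) hsum
  by_contra hne3
  have h4 : (dualFace E d₁ d₂ j).card = 4 := by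
    unfold gift at hle
    split_ifs at hle <;> omega
  induction e with
  | h a b =>
    obtain ⟨c, hab, hbc, hca, hC⟩ := (heven i).eq_triangle (hdi i) he hcard
    obtain ⟨p, q, hnd, hQ⟩ := (heven j).eq_quadrilateral (hdi j) heo h4
    have hbcm : s(b, c) ∈ dualFace E d₁ d₂ i := by simp [hC]
    have hcam : s(c, a) ∈ dualFace E d₁ d₂ i := by simp [hC]
    have hbpm : s(b, p) ∈ dualFace E d₁ d₂ j := by simp [hQ]
    have hpqm : s(p, q) ∈ dualFace E d₁ d₂ j := by simp [hQ]
    have hqam : s(q, a) ∈ dualFace E d₁ d₂ j := by simp [hQ]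
    have hcpq : c = p ∨ c = q := by
      by_contra! hcon
      refine not_theta5 (a := a) (b := c) (c := b) (d := p) (e := q) hfree ?_ (hadj hcam).symm (hadj hbcm).symm (hadj hbpm) (hadj hpqm)
        (hadj hqam).symm (hadj he)
      simp at hnd ⊢
      grind
    obtain ⟨f, hf, hfi, hfj⟩ : ∃ f, f ≠ s(a, b) ∧ f ∈ dualFace E d₁ d₂ i ∧
        f ∈ dualFace E d₁ d₂ j := by
      rcases hcpq with rfl | rfl
      · refine ⟨s(b, c), ?_, hbcm, hbpm⟩
        simp only [ne_eq, Sym2.eq_iff]; grind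
      · refine ⟨s(c, a), ?_, hcam, hqam⟩
        simp only [ne_eq, Sym2.eq_iff]; grind
    have hfo : oppositeFace d₁ d₂ i f = j := oppositeFace_eq_of_mem hfi hfj hne.symm
    have hsub : ({f, s(a, b)} : Finset (Sym2 V)) ⊆ dualFace E d₁ d₂ i := by grind
    have h2 := Finset.sum_le_sum_of_subset_of_nonneg
      (f := fun e => gift (dualFace E d₁ d₂ (oppositeFace d₁ d₂ i e)).card) hsub
      (fun e _ _ => gift_nonneg _)
    rw [Finset.sum_pair hf, hfo, ← hj, h4] at h2
    simp only [gift] at h2 hsum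
    norm_num at h2
    omega

set_option maxHeartbeats 1000000 in
/-- If all faces around a triangular face are triangles in a `Θ₅`-free graph, then these
triangles form a full component of the dual, of size two (a triangle) or four (a `K₄`). -/
lemma exists_isDualClosed (G : SimpleGraph V) (hE : ∀ e, e ∈ E ↔ e ∈ G.edgeSet)
    (heven : ∀ i, IsEvenEdgeSet (dualFace E d₁ d₂ i)) (hfree : ¬ ContainsCopy theta5 G)
    {i : I} (hcard : (dualFace E d₁ d₂ i).card = 3)
    (hsum : ∑ e ∈ dualFace E d₁ d₂ i,
        gift (dualFace E d₁ d₂ (oppositeFace d₁ d₂ i e)).card < 2) :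
    ∃ K : Finset I, i ∈ K ∧ K.card ≤ 4 ∧ IsDualClosed E d₁ d₂ K := by
  have hd : ∀ e ∈ E, ¬ e.IsDiag := fun e he => G.not_isDiag_of_mem_edgeSet ((hE e).1 he)
  have hdi : ∀ i, ∀ e ∈ dualFace E d₁ d₂ i, ¬ e.IsDiag :=
    fun i e he => hd e (mem_dualFace.1 he).1
  have hadj : ∀ {i x y}, s(x, y) ∈ dualFace E d₁ d₂ i → G.Adj x y := fun h =>
    (hE _).1 (mem_dualFace.1 h).1
  have hopp := card_oppositeFace_eq_three G hE heven hfree hcard hsum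
  obtain ⟨e₀, he₀⟩ := Finset.card_pos.1 (show 0 < (dualFace E d₁ d₂ i).card by omega)
  induction e₀ with
  | h a b =>
    have pair : ∀ e ∈ dualFace E d₁ d₂ i,
        dualFace E d₁ d₂ (oppositeFace d₁ d₂ i e) = dualFace E d₁ d₂ i →
        ∃ K : Finset I, i ∈ K ∧ K.card ≤ 4 ∧ IsDualClosed E d₁ d₂ K := by
      intro e he hEq
      have hne := (mem_dualFace_oppositeFace he).2
      refine ⟨{i, oppositeFace d₁ d₂ i e}, by simp, Finset.card_le_two.trans (by norm_num), ?_⟩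
      intro k hk f hf
      simp only [Finset.mem_insert, Finset.mem_singleton] at hk ⊢
      rcases hk with rfl | rfl
      · exact Or.inr (oppositeFace_eq_of_mem hf (hEq ▸ hf) hne.symm)
      · exact Or.inl (oppositeFace_eq_of_mem hf (hEq ▸ hf) hne)
    obtain ⟨c, hab, hbc, hca, hC⟩ := (heven i).eq_triangle (hdi i) he₀ hcard
    have hbcm : s(b, c) ∈ dualFace E d₁ d₂ i := by simp [hC]
    have hcam : s(c, a) ∈ dualFace E d₁ d₂ i := by simp [hC]
    obtain ⟨m1, n1⟩ := mem_dualFace_oppositeFace he₀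
    obtain ⟨m2, n2⟩ := mem_dualFace_oppositeFace hbcm
    obtain ⟨m3, n3⟩ := mem_dualFace_oppositeFace hcam
    have c1 := hopp _ he₀
    have c2 := hopp _ hbcm
    have c3 := hopp _ hcam
    have p1 := pair _ he₀
    have p2 := pair _ hbcm
    have p3 := pair _ hcam
    set j₁ := oppositeFace d₁ d₂ i s(a, b)
    set j₂ := oppositeFace d₁ d₂ i s(b, c)
    set j₃ := oppositeFace d₁ d₂ i s(c, a)
    obtain ⟨x, -, hbx, hxa, hX⟩ := (heven j₁).eq_triangle (hdi _) m1 c1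
    obtain ⟨y, -, hcy, hyb, hY⟩ := (heven j₂).eq_triangle (hdi _) m2 c2
    obtain ⟨z, -, haz, hzc, hZ⟩ := (heven j₃).eq_triangle (hdi _) m3 c3
    have hbxm : s(b, x) ∈ dualFace E d₁ d₂ j₁ := by simp [hX]
    have hxam : s(x, a) ∈ dualFace E d₁ d₂ j₁ := by simp [hX]
    have hcym : s(c, y) ∈ dualFace E d₁ d₂ j₂ := by simp [hY]
    have hybm : s(y, b) ∈ dualFace E d₁ d₂ j₂ := by simp [hY]
    have hazm : s(a, z) ∈ dualFace E d₁ d₂ j₃ := by simp [hZ]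
    have hzcm : s(z, c) ∈ dualFace E d₁ d₂ j₃ := by simp [hZ]
    by_cases hxc : x = c
    · exact p1 (by rw [hX, hC, hxc])
    by_cases hya : y = a
    · refine p2 (by rw [hY, hC, hya]; ext e; simp; tauto)
    by_cases hzb : z = b
    · refine p3 (by rw [hZ, hC, hzb]; ext e; simp; tauto)
    have hxy : x = y := by
      by_contra hxy
      refine not_theta5 (a := a) (b := x) (c := b) (d := y) (e := c) hfree ?_ (hadj hxam).symm (hadj hbxm).symm (hadj hybm).symm
        (hadj hcym).symm (hadj hcam).symm (hadj he₀)
      simp; grind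
    have hyz : y = z := by
      by_contra hyz
      refine not_theta5 (a := b) (b := y) (c := c) (d := z) (e := a) hfree ?_ (hadj hybm).symm (hadj hcym).symm (hadj hzcm).symm
        (hadj hazm).symm (hadj he₀).symm (hadj hbcm)
      simp; grind
    subst hxy hyz
    exact ⟨{i, j₁, j₂, j₃}, by simp, Finset.card_le_four,
      isDualClosed_tetrahedron
        (by simp only [Finset.mem_insert, Finset.mem_singleton, Sym2.eq_iff]; grind)
        (by simp only [Finset.mem_insert, Finset.mem_singleton, Sym2.eq_iff]; grind)
        (by simp only [Finset.mem_insert, Finset.mem_singleton, Sym2.eq_iff]; grind) n1 n2 n3 hC hX hY hZ⟩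

end DualFaces

section Rank

variable {V I : Type*}

lemma exists_representatives (E : Finset (Sym2 V)) (d₁ d₂ : Sym2 V → I) :
    ∃ r : I → I, (∀ e ∈ E, r (d₁ e) = r (d₂ e)) ∧ (∀ i, r (r i) = r i) ∧
      ∀ P : I → Prop, (∀ e ∈ E, P (d₁ e) ↔ P (d₂ e)) → ∀ i, P (r i) ↔ P i := by
  let R : I → I → Prop := fun i j => ∃ e ∈ E, d₁ e = i ∧ d₂ e = j
  refine ⟨fun i => (Quot.mk R i).out, fun e he => ?_, fun i => ?_, fun P hP i => ?_⟩
  · simp only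
    rw [Quot.sound (⟨e, he, rfl, rfl⟩ : R (d₁ e) (d₂ e))]
  · simp only
    rw [Quot.out_eq]
  · let P' : Quot R → Prop := Quot.lift P (by
      rintro _ _ ⟨e, he, rfl, rfl⟩
      exact propext (hP e he))
    change P' (Quot.mk R (Quot.mk R i).out) ↔ P' (Quot.mk R i)
    rw [Quot.out_eq]

variable [DecidableEq I] {E : Finset (Sym2 V)} {d₁ d₂ : Sym2 V → I}

lemma mem_properFaces_iff_of_mem {e : Sym2 V} (he : e ∈ E) :
    d₁ e ∈ properFaces E d₁ d₂ ↔ d₂ e ∈ properFaces E d₁ d₂ := by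
  by_cases h : d₁ e = d₂ e
  · rw [h]
  · simp only [mem_properFaces, Finset.Nonempty, mem_dualFace]
    exact iff_of_true ⟨e, he, h, Or.inl rfl⟩ ⟨e, he, h, Or.inr rfl⟩

lemma IsDualClosed.mem_iff {K : Finset I} (hK : IsDualClosed E d₁ d₂ K) {e : Sym2 V}
    (he : e ∈ E) : d₁ e ∈ K ↔ d₂ e ∈ K := by
  by_cases h : d₁ e = d₂ e
  · rw [h]
  · constructor <;> intro h'
    · simpa [oppositeFace] using hK _ h' e (mem_dualFace.2 ⟨he, h, Or.inl rfl⟩)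
    · simpa [oppositeFace, h] using hK _ h' e (mem_dualFace.2 ⟨he, h, Or.inr rfl⟩)

variable [DecidableEq V]

/-- The maps `d₁` and `d₂` describe an abstract dual of the graph with edge set `E`: its cycles
modulo two are exactly the coboundaries of `0`-`1` labellings of the dual vertices. -/
def IsAbstractDual (E : Finset (Sym2 V)) (d₁ d₂ : Sym2 V → I) : Prop :=
  ∀ s : Sym2 V → ZMod 2, (∀ v, ∑ e ∈ E with v ∈ e, s e = 0) ↔
    ∃ a : I → ZMod 2, ∀ e ∈ E, s e = a (d₁ e) + a (d₂ e)

lemma IsAbstractDual.isEvenEdgeSet (h : IsAbstractDual E d₁ d₂) (i : I) :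
    IsEvenEdgeSet (dualFace E d₁ d₂ i) := by
  intro v
  have h1 := (h fun e => (if d₁ e = i then 1 else 0) + (if d₂ e = i then 1 else 0)).2
    ⟨fun j => if j = i then 1 else 0, fun e _ => rfl⟩ v
  rw [← ZMod.natCast_eq_zero_iff_even, ← h1, Finset.card_eq_sum_ones, Nat.cast_sum, dualFace,
    Finset.filter_filter, Finset.sum_filter, Finset.sum_filter]
  refine Finset.sum_congr rfl fun e _ => ?_
  have h2 : (1 : ZMod 2) + 1 = 0 := by decide
  by_cases hv : v ∈ e <;> by_cases hi : d₁ e = i <;> by_cases hj : d₂ e = i <;> grind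

/-- The boundary map from edge chains to vertex chains modulo two. -/
def edgeBoundary (E : Finset (Sym2 V)) : (E → ZMod 2) →ₗ[ZMod 2] (V → ZMod 2) where
  toFun s v := ∑ e : E, if v ∈ e.1 then s e else 0
  map_add' s t := by
    funext v
    simp only [Pi.add_apply, ← Finset.sum_add_distrib]
    exact Finset.sum_congr rfl fun e _ => by split_ifs <;> simp
  map_smul' c s := by
    funext v
    simp only [Pi.smul_apply, smul_eq_mul, RingHom.id_apply, Finset.mul_sum]
    exact Finset.sum_congr rfl fun e _ => by split_ifs <;> simp

/-- The coboundary map from labellings of a set of dual vertices to edge chains. -/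
def dualCoboundary (E : Finset (Sym2 V)) (d₁ d₂ : Sym2 V → I) (S : Finset I) :
    (S → ZMod 2) →ₗ[ZMod 2] (E → ZMod 2) where
  toFun a e := (if h : d₁ e.1 ∈ S then a ⟨_, h⟩ else 0) + (if h : d₂ e.1 ∈ S then a ⟨_, h⟩ else 0)
  map_add' s t := by
    funext e
    simp only [Pi.add_apply]
    split_ifs <;> ring
  map_smul' c s := by
    funext e
    simp only [Pi.smul_apply, smul_eq_mul, RingHom.id_apply]
    split_ifs <;> simp [mul_add]

lemma finrank_range_edgeBoundary [Fintype V] [Nonempty V] (hd : ∀ e ∈ E, ¬ e.IsDiag) :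
    Module.finrank (ZMod 2) (LinearMap.range (edgeBoundary E)) + 1 ≤ Fintype.card V := by
  let σ : (V → ZMod 2) →ₗ[ZMod 2] ZMod 2 := ∑ v, LinearMap.proj v
  have hσ : ∀ f, σ f = ∑ v, f v := fun f => by simp [σ]
  have h1 : LinearMap.range (edgeBoundary E) ≤ LinearMap.ker σ := by
    rintro _ ⟨s, rfl⟩
    rw [LinearMap.mem_ker, hσ]
    simp only [edgeBoundary, LinearMap.coe_mk, AddHom.coe_mk]
    rw [Finset.sum_comm]
    refine Finset.sum_eq_zero ?_
    rintro ⟨e, he⟩ _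
    have := hd e he
    induction e with
    | h a b =>
      have hab : a ≠ b := this
      have : ∀ v, (if v ∈ s(a, b) then s ⟨s(a, b), he⟩ else 0) =
          (if v = a then s ⟨s(a, b), he⟩ else 0) + (if v = b then s ⟨s(a, b), he⟩ else 0) := by
        intro v
        simp only [Sym2.mem_iff]
        by_cases h : v = a <;> by_cases h' : v = b <;> simp_all
      simp only [this, Finset.sum_add_distrib, Finset.sum_ite_eq', Finset.mem_univ, if_true]
      exact CharTwo.add_self_eq_zero _
  have h2 : LinearMap.ker σ < ⊤ := by
    rw [lt_top_iff_ne_top, Ne, LinearMap.ker_eq_top]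
    intro h
    obtain ⟨v⟩ := ‹Nonempty V›
    have := hσ (Pi.single v 1)
    rw [h] at this
    simp at this
  have h3 := Submodule.finrank_lt_finrank_of_lt (h1.trans_lt h2)
  rw [finrank_top, Module.finrank_fintype_fun_eq_card] at h3
  omega

/-- Half of Euler's formula, with the number of dual components as an improvement. -/
lemma IsAbstractDual.euler [Fintype V] [Nonempty V] (h : IsAbstractDual E d₁ d₂)
    (hd : ∀ e ∈ E, ¬ e.IsDiag) {r : I → I} (hr : ∀ e ∈ E, r (d₁ e) = r (d₂ e))
    (hrr : ∀ i, r (r i) = r i)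
    (hrP : ∀ P : I → Prop, (∀ e ∈ E, P (d₁ e) ↔ P (d₂ e)) → ∀ i, P (r i) ↔ P i) :
    E.card + 1 + ((properFaces E d₁ d₂).image r).card ≤
      Fintype.card V + (properFaces E d₁ d₂).card := by
  set J := properFaces E d₁ d₂ with hJ
  have hDJ : J.image r ⊆ J := by
    intro i hi
    obtain ⟨j, hj, rfl⟩ := Finset.mem_image.1 hi
    exact (hrP (· ∈ J) (fun e he => mem_properFaces_iff_of_mem he) j).2 hj
  have hker : LinearMap.ker (edgeBoundary E) ≤
      LinearMap.range (dualCoboundary E d₁ d₂ (J \ J.image r)) := by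
    intro s hs
    rw [LinearMap.mem_ker] at hs
    obtain ⟨a, ha⟩ := (h fun e => if he : e ∈ E then s ⟨e, he⟩ else 0).1 (by
      intro v
      have := congrFun hs v
      simp only [edgeBoundary, LinearMap.coe_mk, AddHom.coe_mk, Pi.zero_apply] at this
      rw [← this, Finset.sum_filter, ← Finset.sum_attach, Finset.univ_eq_attach]
      refine Finset.sum_congr rfl fun e _ => ?_
      simp)
    refine ⟨fun i => a i + a (r i), ?_⟩
    funext ⟨e, he⟩
    have hse : s ⟨e, he⟩ = a (d₁ e) + a (d₂ e) := by simpa [he] using ha e he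
    rw [hse]
    simp only [dualCoboundary, LinearMap.coe_mk, AddHom.coe_mk, dite_eq_ite]
    by_cases hne : d₁ e = d₂ e
    · rw [hne, CharTwo.add_self_eq_zero, CharTwo.add_self_eq_zero]
    · have hmem : ∀ i ∈ J, (if i ∈ J \ J.image r then a i + a (r i) else 0) = a i + a (r i) := by
        intro i hi
        split_ifs with h'
        · rfl
        · have hiD : i ∈ J.image r := by simpa [hi] using h'
          obtain ⟨j, -, rfl⟩ := Finset.mem_image.1 hiD
          rw [hrr, CharTwo.add_self_eq_zero]
      rw [hmem _ (mem_properFaces.2 ⟨e, mem_dualFace.2 ⟨he, hne, Or.inl rfl⟩⟩),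
        hmem _ (mem_properFaces.2 ⟨e, mem_dualFace.2 ⟨he, hne, Or.inr rfl⟩⟩), hr e he]
      rw [add_add_add_comm, CharTwo.add_self_eq_zero (a (r (d₂ e))), add_zero]
  have h1 := finrank_range_edgeBoundary (V := V) hd
  have h2 := LinearMap.finrank_range_add_finrank_ker (edgeBoundary E)
  have h3 := Submodule.finrank_mono hker
  have h4 := LinearMap.finrank_range_le (dualCoboundary E d₁ d₂ (J \ J.image r))
  rw [Module.finrank_fintype_fun_eq_card, Fintype.card_coe] at h2 h4
  rw [Finset.card_sdiff_of_subset hDJ] at h4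
  have h5 := Finset.card_le_card hDJ
  omega

/-- A `Θ₅`-free graph with an abstract dual has at most `5(n-2)/2` edges. -/
theorem IsAbstractDual.card_le [Fintype V] (h : IsAbstractDual E d₁ d₂) (G : SimpleGraph V)
    (hE : ∀ e, e ∈ E ↔ e ∈ G.edgeSet) (hfree : ¬ ContainsCopy theta5 G)
    (hV : 5 ≤ Fintype.card V) : 2 * E.card ≤ 5 * (Fintype.card V - 2) := by
  have : Nonempty V := Fintype.card_pos_iff.1 (by omega)
  have hd : ∀ e ∈ E, ¬ e.IsDiag := fun e he => G.not_isDiag_of_mem_edgeSet ((hE e).1 he)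
  have heven := h.isEvenEdgeSet
  obtain ⟨r, hr, hrr, hrP⟩ := exists_representatives E d₁ d₂
  have hrK : ∀ K : Finset I, IsDualClosed E d₁ d₂ K → ∀ i, r i ∈ K ↔ i ∈ K := fun K hK =>
    hrP (· ∈ K) fun e he => hK.mem_iff he
  have heuler := h.euler hd hr hrr hrP
  set J := properFaces E d₁ d₂ with hJ
  set B := J.filter fun i => charge E d₁ d₂ i < 20 with hB
  have hclosed : ∀ i ∈ B, ∃ K : Finset I, i ∈ K ∧ K.card ≤ 4 ∧ IsDualClosed E d₁ d₂ K := by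
    intro i hi
    obtain ⟨hiJ, hi20⟩ := Finset.mem_filter.1 hi
    obtain ⟨-, h' | ⟨h3, hs⟩⟩ := charge_ge hd heven hiJ
    · omega
    · exact exists_isDualClosed G hE heven hfree h3 hs
  have hb : B.card ≤ 4 * (J.image r).card := by
    refine (Finset.card_le_mul_card_image (f := r) B 4 ?_).trans
      (Nat.mul_le_mul_left 4 (Finset.card_le_card (Finset.image_subset_image
        (Finset.filter_subset _ _))))
    intro j hj
    obtain ⟨i, hi, rfl⟩ := Finset.mem_image.1 hj
    obtain ⟨K, hiK, hK4, hK⟩ := hclosed i hi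
    refine (Finset.card_le_card fun x hx => ?_).trans hK4
    rw [← hrK K hK, (Finset.mem_filter.1 hx).2, hrK K hK]
    exact hiK
  have hone : 0 < B.card → (J.image r).card = 1 → J.card ≤ 4 := by
    intro hB0 h1
    obtain ⟨i, hi⟩ := Finset.card_pos.1 hB0
    obtain ⟨K, hiK, hK4, hK⟩ := hclosed i hi
    refine (Finset.card_le_card fun x hx => ?_).trans hK4
    obtain ⟨c, hc⟩ := Finset.card_eq_one.1 h1
    have h2 : ∀ y ∈ J, r y = c := fun y hy => by
      simpa [hc] using Finset.mem_image_of_mem r hy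
    rw [← hrK K hK, h2 x hx, ← h2 i (Finset.mem_filter.1 hi).1, hrK K hK]
    exact hiK
  have hzero : (J.image r).card = 0 → J.card = 0 := by simp
  have hcharge : 20 * (J.card : ℤ) ≤ 12 * E.card + 2 * B.card := by
    have h1 : ∀ i ∈ J, (20 : ℤ) - (if charge E d₁ d₂ i < 20 then 2 else 0) ≤
        charge E d₁ d₂ i := by
      intro i hi
      have := (charge_ge hd heven hi).1
      split_ifs <;> omega
    have h2 := Finset.sum_le_sum h1
    have h3 := sum_charge (E := E) (d₁ := d₁) (d₂ := d₂) fun i =>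
      gift (dualFace E d₁ d₂ i).card
    have h4 : ((E.filter fun e => d₁ e ≠ d₂ e).card : ℤ) ≤ E.card := by
      exact_mod_cast Finset.card_filter_le _ _
    change ∑ i ∈ J, charge E d₁ d₂ i = _ at h3
    rw [h3, Finset.sum_sub_distrib, ← Finset.sum_filter, ← hB] at h2
    simp only [Finset.sum_const, nsmul_eq_mul] at h2
    omega
  have hcharge' : 20 * J.card ≤ 12 * E.card + 2 * B.card := by exact_mod_cast hcharge
  rcases Nat.lt_or_ge (J.image r).card 2 with h2 | h2
  · interval_cases (J.image r).card
    · have := hzero rfl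
      omega
    · rcases Nat.eq_zero_or_pos B.card with h0 | h0
      · omega
      · have := hone h0 rfl
        omega
  · omega

end Rank

section Grid

/-- Edges of the square grid: `(false, x, y)` joins `(x, y)` to `(x + 1, y)` and `(true, x, y)`
joins `(x, y)` to `(x, y + 1)`. -/
abbrev GridEdge := Bool × ℤ × ℤ

namespace GridEdge

/-- The first end of a grid edge. -/
def src (g : GridEdge) : ℤ × ℤ := g.2

/-- The second end of a grid edge. -/
def tgt (g : GridEdge) : ℤ × ℤ := bif g.1 then (g.2.1, g.2.2 + 1) else (g.2.1 + 1, g.2.2)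

/-- The grid cell to the right of a vertical edge or above a horizontal one. -/
def cell₁ (g : GridEdge) : ℤ × ℤ := g.2

/-- The grid cell to the left of a vertical edge or below a horizontal one. -/
def cell₂ (g : GridEdge) : ℤ × ℤ := bif g.1 then (g.2.1 - 1, g.2.2) else (g.2.1, g.2.2 - 1)

/-- The edge `g` joins `z` and `w`. -/
def Joins (g : GridEdge) (z w : ℤ × ℤ) : Prop :=
  (g.src = z ∧ g.tgt = w) ∨ (g.src = w ∧ g.tgt = z)

end GridEdge

/-- The boundary of a grid chain modulo two. -/
def gridBoundary (c : GridEdge → ZMod 2) (z : ℤ × ℤ) : ZMod 2 :=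
  c (false, z) + c (false, z.1 - 1, z.2) + c (true, z) + c (true, z.1, z.2 - 1)

lemma gridBoundary_add (c c' : GridEdge → ZMod 2) (z : ℤ × ℤ) :
    gridBoundary (c + c') z = gridBoundary c z + gridBoundary c' z := by
  simp only [gridBoundary, Pi.add_apply]; ring

lemma gridBoundary_smul (r : ZMod 2) (c : GridEdge → ZMod 2) (z : ℤ × ℤ) :
    gridBoundary (r • c) z = r * gridBoundary c z := by
  simp only [gridBoundary, Pi.smul_apply, smul_eq_mul]; ring

lemma gridBoundary_sum {ι : Type*} (s : Finset ι) (c : ι → GridEdge → ZMod 2) (z : ℤ × ℤ) :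
    gridBoundary (∑ i ∈ s, c i) z = ∑ i ∈ s, gridBoundary (c i) z := by
  simp only [gridBoundary, Finset.sum_apply, Finset.sum_add_distrib]

lemma gridBoundary_single (g : GridEdge) (z : ℤ × ℤ) :
    gridBoundary (Pi.single g 1) z =
      (if g.src = z then 1 else 0) + (if g.tgt = z then 1 else 0) := by
  obtain ⟨b, x, y⟩ := g
  obtain ⟨x', y'⟩ := z
  simp only [gridBoundary, GridEdge.src, GridEdge.tgt, Pi.single_apply]
  cases b <;> simp only [Prod.mk.injEq, cond_true, cond_false, reduceCtorEq, false_and, true_and,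
    if_false, add_zero, zero_add] <;> congr 2 <;> simp only [eq_iff_iff] <;> omega

lemma gridBoundary_eq_sum (c : GridEdge → ZMod 2) (F : Finset GridEdge)
    (hF : ∀ g, g ∉ F → c g = 0) (z : ℤ × ℤ) :
    gridBoundary c z =
      ∑ g ∈ F, c g * ((if g.src = z then 1 else 0) + (if g.tgt = z then 1 else 0)) := by
  have h : c = ∑ g ∈ F, c g • Pi.single g (1 : ZMod 2) := by
    funext g
    simp only [Finset.sum_apply, Pi.smul_apply, Pi.single_apply, smul_eq_mul, mul_ite, mul_one,
      mul_zero, Finset.sum_ite_eq]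
    split_ifs with h
    · rfl
    · exact hF g h
  conv_lhs => rw [h]
  simp only [gridBoundary_sum, gridBoundary_smul, gridBoundary_single]

/-- Every grid cycle that vanishes far to the left bounds a set of cells. -/
lemma exists_cell_labelling (c : GridEdge → ZMod 2) (hc : ∀ z, gridBoundary c z = 0) (M : ℤ)
    (hM : ∀ g : GridEdge, g.2.1 < M → c g = 0) :
    ∃ a : ℤ × ℤ → ZMod 2, ∀ g : GridEdge, c g = a g.cell₁ + a g.cell₂ := by
  refine ⟨fun z => ∑ x ∈ Finset.Icc M z.1, c (true, x, z.2), ?_⟩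
  have hIcc : ∀ x, M ≤ x → Finset.Icc M x = insert x (Finset.Icc M (x - 1)) := by
    intro x hx
    ext t
    simp only [Finset.mem_insert, Finset.mem_Icc]
    omega
  have hsum : ∀ (f : ℤ → ZMod 2) x, M ≤ x →
      ∑ t ∈ Finset.Icc M x, f t = f x + ∑ t ∈ Finset.Icc M (x - 1), f t := by
    intro f x hx
    rw [hIcc x hx, Finset.sum_insert (by simp)]
  rintro ⟨b, x, y⟩
  cases b
  · simp only [GridEdge.cell₁, GridEdge.cell₂, cond_false]
    rcases lt_or_ge x M with hx | hx
    · rw [hM _ hx, Finset.Icc_eq_empty (by omega)]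
      simp
    · induction x, hx using Int.leInduction with
      | base =>
        have h0 := hM (false, M - 1, y) (by simp)
        have h1 := hc (M, y)
        simp only [gridBoundary, h0, add_zero] at h1
        simp only [Finset.Icc_self, Finset.sum_singleton]
        grind
      | succ x hx ih =>
        have h1 := hc (x + 1, y)
        rw [hsum _ (x + 1) (by omega), hsum _ (x + 1) (by omega), add_sub_cancel_right]
        simp only [gridBoundary, add_sub_cancel_right] at h1
        grind
  · simp only [GridEdge.cell₁, GridEdge.cell₂, cond_true]
    rcases lt_or_ge x M with hx | hx
    · rw [hM _ hx, Finset.Icc_eq_empty (by omega), Finset.Icc_eq_empty (by omega)]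
      simp
    · rw [hsum _ x hx, add_assoc, CharTwo.add_self_eq_zero, add_zero]

lemma gridBoundary_cell_labelling (a : ℤ × ℤ → ZMod 2) (z : ℤ × ℤ) :
    gridBoundary (fun g => a g.cell₁ + a g.cell₂) z = 0 := by
  simp only [gridBoundary, GridEdge.cell₁, GridEdge.cell₂, cond_true, cond_false]
  grind

end Grid

section GridModel

variable {V : Type*}

/-- A model of a graph with edge set `E` as a minor of the square grid. -/
structure GridModel (E : Finset (Sym2 V)) where
  /-- The branch sets. -/
  branch : V → Finset (ℤ × ℤ)
  /-- The roots of the branch sets. -/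
  root : V → ℤ × ℤ
  /-- The grid edges representing the edges of the graph. -/
  edge : Sym2 V → GridEdge
  root_mem : ∀ v, root v ∈ branch v
  eq_of_mem : ∀ {u v z}, z ∈ branch u → z ∈ branch v → u = v
  reachable : ∀ {v z}, z ∈ branch v →
    Relation.ReflTransGen (fun a b => a ∈ branch v ∧ b ∈ branch v ∧ ∃ g : GridEdge, g.Joins a b)
      (root v) z
  edge_spec : ∀ e ∈ E, ∃ u v, e = s(u, v) ∧ (edge e).src ∈ branch u ∧ (edge e).tgt ∈ branch v

namespace GridModel

variable {E : Finset (Sym2 V)} (M : GridModel E)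

/-- A grid edge with both ends in one branch set. -/
def Inside (g : GridEdge) : Prop := ∃ v, g.src ∈ M.branch v ∧ g.tgt ∈ M.branch v

lemma exists_chain {v : V} {z : ℤ × ℤ} (hz : z ∈ M.branch v) :
    ∃ c : GridEdge → ZMod 2, (∀ g, ¬ M.Inside g → c g = 0) ∧
      ∀ w, gridBoundary c w = (if z = w then 1 else 0) + (if M.root v = w then 1 else 0) := by
  have h := M.reachable hz
  clear hz
  induction h with
  | refl => exact ⟨0, by simp, fun w => by simp [gridBoundary, CharTwo.add_self_eq_zero]⟩
  | tail _ h ih =>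
    obtain ⟨c, hc, hcb⟩ := ih
    obtain ⟨ha, hb, g, hg⟩ := h
    refine ⟨c + Pi.single g 1, fun g' hg' => ?_, fun w => ?_⟩
    · have : g' ≠ g := by
        rintro rfl
        rcases hg with ⟨h1, h2⟩ | ⟨h1, h2⟩
        · exact hg' ⟨v, h1 ▸ ha, h2 ▸ hb⟩
        · exact hg' ⟨v, h1 ▸ hb, h2 ▸ ha⟩
      simp [hc g' hg', this]
    · rw [gridBoundary_add, hcb, gridBoundary_single]
      rcases hg with ⟨h1, h2⟩ | ⟨h1, h2⟩ <;> rw [h1, h2] <;> grind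

lemma not_inside_edge (hd : ∀ e ∈ E, ¬ e.IsDiag) {e : Sym2 V} (he : e ∈ E) :
    ¬ M.Inside (M.edge e) := by
  rintro ⟨w, h1, h2⟩
  obtain ⟨u, v, rfl, hu, hv⟩ := M.edge_spec e he
  obtain rfl := M.eq_of_mem h1 hu
  obtain rfl := M.eq_of_mem h2 hv
  exact hd _ he rfl

lemma edge_injOn : Set.InjOn M.edge E := by
  intro e he f hf h
  obtain ⟨u, v, rfl, hu, hv⟩ := M.edge_spec e he
  obtain ⟨u', v', rfl, hu', hv'⟩ := M.edge_spec f hf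
  rw [h] at hu hv
  rw [M.eq_of_mem hu hu', M.eq_of_mem hv hv']

/-- Two cells are adjacent if they share an edge of the grid not used by the model. -/
def CellAdj (p q : ℤ × ℤ) : Prop :=
  ∃ g : GridEdge, ¬ M.Inside g ∧ (∀ e ∈ E, M.edge e ≠ g) ∧ g.cell₁ = p ∧ g.cell₂ = q

variable [Fintype V] [DecidableEq V]

/-- A minor of the square grid has an abstract dual. -/
lemma isAbstractDual (hd : ∀ e ∈ E, ¬ e.IsDiag) :
    IsAbstractDual E (fun e => Quot.mk M.CellAdj (M.edge e).cell₁)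
      (fun e => Quot.mk M.CellAdj (M.edge e).cell₂) := by
  classical
  intro s
  constructor
  · intro hs
    choose u v huv hu hv using fun e : E => M.edge_spec e e.2
    choose R hR hRb using fun e : E => M.exists_chain (hu e)
    choose R' hR' hRb' using fun e : E => M.exists_chain (hv e)
    set c : GridEdge → ZMod 2 := ∑ e : E, s e • (Pi.single (M.edge e) 1 + R e + R' e) with hc
    have hc_apply : ∀ g, ¬ M.Inside g → c g = ∑ e : E, if g = M.edge e then s e else 0 := by
      intro g hg
      simp only [hc, Finset.sum_apply, Pi.smul_apply, Pi.add_apply, hR _ g hg, hR' _ g hg,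
        Pi.single_apply, smul_eq_mul]
      exact Finset.sum_congr rfl fun e _ => by split_ifs <;> simp
    have hcb : ∀ z, gridBoundary c z = 0 := by
      intro z
      have h1 : ∀ e : E, gridBoundary (s e • (Pi.single (M.edge e) 1 + R e + R' e)) z =
          ∑ w : V, (if M.root w = z then if w ∈ e.1 then s e else 0 else 0) := by
        intro e
        have huv' : u e ≠ v e := fun h => hd e e.2 (by rw [huv e, h]; rfl)
        have h2 : ∀ w, (if M.root w = z then if w ∈ e.1 then s e else 0 else 0) =
            (if w = u e then if M.root w = z then s e else 0 else 0) +
            (if w = v e then if M.root w = z then s e else 0 else 0) := by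
          intro w
          have : w ∈ e.1 ↔ w = u e ∨ w = v e := by rw [huv e, Sym2.mem_iff]
          grind
        simp only [h2, Finset.sum_add_distrib, Finset.sum_ite_eq', Finset.mem_univ, if_true]
        rw [gridBoundary_smul, gridBoundary_add, gridBoundary_add, gridBoundary_single, hRb, hRb']
        grind
      rw [hc, gridBoundary_sum, Finset.sum_congr rfl fun e _ => h1 e, Finset.sum_comm]
      refine Finset.sum_eq_zero fun w _ => ?_
      split_ifs with hw
      · have h2 := hs w
        rw [Finset.sum_filter, ← Finset.sum_coe_sort E] at h2
        exact h2
      · simp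
    obtain ⟨L, hL⟩ : ∃ L : ℤ, ∀ g : GridEdge, g.2.1 < L → c g = 0 := by
      let S : Finset ℤ := (Finset.univ.biUnion M.branch).image Prod.fst
      obtain ⟨L, hL⟩ := S.bddBelow
      refine ⟨L, fun g hg => ?_⟩
      have hgS : ∀ v, g.src ∉ M.branch v := by
        intro v hgv
        have : L ≤ g.2.1 := hL (Finset.mem_coe.2 (Finset.mem_image.2
          ⟨g.2, Finset.mem_biUnion.2 ⟨v, Finset.mem_univ v, hgv⟩, rfl⟩))
        omega
      rw [hc_apply g fun ⟨v, h, _⟩ => hgS v h]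
      refine Finset.sum_eq_zero fun e _ => ?_
      rw [if_neg]
      rintro rfl
      exact hgS _ (hu e)
    obtain ⟨a, ha⟩ := exists_cell_labelling c hcb L hL
    refine ⟨Quot.lift a ?_, fun e he => ?_⟩
    · rintro _ _ ⟨g, hg, hgE, rfl, rfl⟩
      have := ha g
      rw [hc_apply g hg, Finset.sum_eq_zero fun (e : E) _ => if_neg fun h => hgE e e.2 h.symm]
        at this
      exact (CharTwo.add_eq_zero.1 this.symm)
    · change _ = a _ + a _
      rw [← ha, hc_apply _ (M.not_inside_edge hd he), Finset.sum_eq_single ⟨e, he⟩]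
      · simp
      · intro f _ hf
        rw [if_neg]
        intro h
        exact hf (Subtype.ext (M.edge_injOn f.2 he h.symm))
      · simp
  · rintro ⟨a, ha⟩ v
    set c : GridEdge → ZMod 2 := fun g =>
      a (Quot.mk M.CellAdj g.cell₁) + a (Quot.mk M.CellAdj g.cell₂) with hc
    have hc0 : ∀ g, ¬ M.Inside g → (∀ e ∈ E, M.edge e ≠ g) → c g = 0 := by
      intro g h1 h2
      have : Quot.mk M.CellAdj g.cell₁ = Quot.mk M.CellAdj g.cell₂ :=
        Quot.sound ⟨g, h1, h2, rfl, rfl⟩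
      simp only [hc, this, CharTwo.add_self_eq_zero]
    let F : Finset GridEdge := Finset.univ ×ˢ Finset.univ.biUnion M.branch
    have hF : ∀ g : GridEdge, ∀ w, g.src ∈ M.branch w → g ∈ F := by
      intro g w hw
      simp only [F, Finset.mem_product, Finset.mem_univ, Finset.mem_biUnion, true_and]
      exact ⟨w, hw⟩
    have hEF : E.image M.edge ⊆ F := by
      intro g hg
      obtain ⟨e, he, rfl⟩ := Finset.mem_image.1 hg
      obtain ⟨u, w, -, hu, -⟩ := M.edge_spec e he
      exact hF _ u hu
    have hcF : ∀ g, g ∉ F → c g = 0 := by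
      intro g hg
      refine hc0 g (fun ⟨w, hw, _⟩ => hg (hF g w hw)) fun e he h => ?_
      exact hg (hEF (Finset.mem_image.2 ⟨e, he, h⟩))
    have h0 : ∑ z ∈ M.branch v, gridBoundary c z = 0 :=
      Finset.sum_eq_zero fun z _ =>
        gridBoundary_cell_labelling (fun p => a (Quot.mk M.CellAdj p)) z
    rw [Finset.sum_congr rfl fun z _ => gridBoundary_eq_sum c F hcF z, Finset.sum_comm] at h0
    simp only [← Finset.mul_sum, Finset.sum_add_distrib, Finset.sum_ite_eq] at h0
    rw [← Finset.sum_subset hEF, Finset.sum_image M.edge_injOn] at h0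
    · rw [Finset.sum_filter, ← h0]
      refine Finset.sum_congr rfl fun e he => ?_
      have h1 : c (M.edge e) = s e := (ha e he).symm
      rw [h1]
      obtain ⟨x, y, rfl, hx, hy⟩ := M.edge_spec e he
      have hxy : x ≠ y := fun h => hd _ he h
      have hvx : (M.edge s(x, y)).src ∈ M.branch v ↔ v = x :=
        ⟨fun h => M.eq_of_mem h hx, fun h => h ▸ hx⟩
      have hvy : (M.edge s(x, y)).tgt ∈ M.branch v ↔ v = y :=
        ⟨fun h => M.eq_of_mem h hy, fun h => h ▸ hy⟩
      simp only [hvx, hvy, Sym2.mem_iff]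
      grind
    · intro g _ hg
      by_cases hin : M.Inside g
      · obtain ⟨w, h1, h2⟩ := hin
        by_cases hvw : v = w
        · subst hvw
          simp [h1, h2, CharTwo.add_self_eq_zero]
        · have h3 : g.src ∉ M.branch v := fun h => hvw (M.eq_of_mem h h1)
          have h4 : g.tgt ∉ M.branch v := fun h => hvw (M.eq_of_mem h h2)
          simp [h3, h4]
      · rw [hc0 g hin fun e he h => hg (Finset.mem_image.2 ⟨e, he, h⟩), zero_mul]

end GridModel

end GridModel

section GridReach

/-- Reachability in the subgraph of the square grid induced by `S`. -/
def GridReach (S : Set (ℤ × ℤ)) : ℤ × ℤ → ℤ × ℤ → Prop :=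
  Relation.ReflTransGen fun a b => a ∈ S ∧ b ∈ S ∧ ∃ g : GridEdge, g.Joins a b

lemma GridReach.mono {S T : Set (ℤ × ℤ)} (h : S ⊆ T) {a b : ℤ × ℤ} (hab : GridReach S a b) :
    GridReach T a b :=
  Relation.ReflTransGen.mono (fun _ _ ⟨h1, h2, h3⟩ => ⟨h h1, h h2, h3⟩) _ _ hab

lemma GridReach.symm {S : Set (ℤ × ℤ)} {a b : ℤ × ℤ} (hab : GridReach S a b) :
    GridReach S b a := by
  induction hab with
  | refl => exact .refl
  | tail _ h ih =>
    obtain ⟨h1, h2, g, hg⟩ := h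
    exact Relation.ReflTransGen.head ⟨h2, h1, g, hg.symm⟩ ih

lemma GridReach.trans {S : Set (ℤ × ℤ)} {a b c : ℤ × ℤ} (hab : GridReach S a b)
    (hbc : GridReach S b c) : GridReach S a c :=
  Relation.ReflTransGen.trans hab hbc

lemma GridReach.mem {S : Set (ℤ × ℤ)} {a b : ℤ × ℤ} (ha : a ∈ S) (hab : GridReach S a b) :
    b ∈ S := by
  induction hab with
  | refl => exact ha
  | tail _ h _ => exact h.2.1

lemma GridReach.within_reachable {S : Set (ℤ × ℤ)} {a b : ℤ × ℤ} (hab : GridReach S a b) :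
    GridReach {c | GridReach S a c} a b := by
  induction hab with
  | refl => exact .refl
  | tail h h' ih => exact ih.tail ⟨h, h.tail h', h'.2.2⟩

lemma GridReach.exists_exit {S T : Set (ℤ × ℤ)} {a b : ℤ × ℤ} (hab : GridReach S a b)
    (hb : b ∈ T) (ha : a ∉ T) :
    ∃ c d, GridReach (S \ T) a c ∧ c ∉ T ∧ d ∈ T ∧ ∃ g : GridEdge, g.Joins c d := by
  have h : (GridReach (S \ T) a b ∧ b ∉ T) ∨
      ∃ c d, GridReach (S \ T) a c ∧ c ∉ T ∧ d ∈ T ∧ ∃ g : GridEdge, g.Joins c d := by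
    clear hb
    induction hab with
    | refl => exact Or.inl ⟨.refl, ha⟩
    | @tail b c _ h ih =>
      rcases ih with ⟨ih, hb⟩ | ih
      · by_cases hc : c ∈ T
        · exact Or.inr ⟨b, c, ih, hb, hc, h.2.2⟩
        · exact Or.inl ⟨ih.tail ⟨⟨h.1, hb⟩, ⟨h.2.1, hc⟩, h.2.2⟩, hc⟩
      · exact Or.inr ih
  rcases h with ⟨-, h⟩ | h
  · exact absurd hb h
  · exact h

lemma gridReach_horizontal {S : Set (ℤ × ℤ)} {x x' y : ℤ} (hx : x ≤ x')
    (h : ∀ t, x ≤ t → t ≤ x' → (t, y) ∈ S) : GridReach S (x, y) (x', y) := by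
  induction x', hx using Int.leInduction with
  | base => exact .refl
  | succ t ht ih =>
    exact (ih fun s h1 h2 => h s h1 (by omega)).tail
      ⟨h t ht (by omega), h (t + 1) (by omega) le_rfl, (false, t, y), Or.inl ⟨rfl, rfl⟩⟩

lemma gridReach_vertical {S : Set (ℤ × ℤ)} {x y y' : ℤ} (hy : y ≤ y')
    (h : ∀ t, y ≤ t → t ≤ y' → (x, t) ∈ S) : GridReach S (x, y) (x, y') := by
  induction y', hy using Int.leInduction with
  | base => exact .refl
  | succ t ht ih =>
    exact (ih fun s h1 h2 => h s h1 (by omega)).tail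
      ⟨h t ht (by omega), h (t + 1) (by omega) le_rfl, (true, x, t), Or.inl ⟨rfl, rfl⟩⟩

/-- The grid points within distance two of `S`. -/
def gridNhd (S : Set (ℝ × ℝ)) : Set (ℤ × ℤ) :=
  {z | ∃ p ∈ S, |p.1 - z.1| ≤ 2 ∧ |p.2 - z.2| ≤ 2}

lemma gridNhd_mono {S T : Set (ℝ × ℝ)} (h : S ⊆ T) : gridNhd S ⊆ gridNhd T :=
  fun _ ⟨p, hp, hz⟩ => ⟨p, h hp, hz⟩

lemma mem_gridNhd_singleton {p : ℝ × ℝ} {z : ℤ × ℤ} :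
    z ∈ gridNhd {p} ↔ |p.1 - z.1| ≤ 2 ∧ |p.2 - z.2| ≤ 2 := by
  simp [gridNhd]

lemma gridReach_gridNhd_singleton {p : ℝ × ℝ} {z w : ℤ × ℤ} (hz : z ∈ gridNhd {p})
    (hw : w ∈ gridNhd {p}) : GridReach (gridNhd {p}) z w := by
  rw [mem_gridNhd_singleton] at hz hw
  obtain ⟨hz1, hz2⟩ := hz
  obtain ⟨hw1, hw2⟩ := hw
  obtain ⟨x, y⟩ := z
  obtain ⟨x', y'⟩ := w
  rw [abs_le] at *
  simp only at *
  have key : ∀ {a b t : ℤ} {r : ℝ}, a ≤ t → t ≤ b → (-2 ≤ r - a ∧ r - a ≤ 2) →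
      (-2 ≤ r - b ∧ r - b ≤ 2) → |r - t| ≤ 2 := by
    intro a b t r h1 h2 h3 h4
    have h1' : (a : ℝ) ≤ t := by exact_mod_cast h1
    have h2' : (t : ℝ) ≤ b := by exact_mod_cast h2
    rw [abs_le]
    constructor <;> linarith
  have h1 : GridReach (gridNhd {p}) (x, y) (x', y) := by
    rcases le_total x x' with h | h
    · exact gridReach_horizontal h fun t h1 h2 => ⟨p, rfl, key h1 h2 hz1 hw1, abs_le.2 hz2⟩
    · exact (gridReach_horizontal (S := gridNhd {p}) h fun t h1 h2 =>
        ⟨p, rfl, key h1 h2 hw1 hz1, abs_le.2 hz2⟩).symm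
  have h2 : GridReach (gridNhd {p}) (x', y) (x', y') := by
    rcases le_total y y' with h | h
    · exact gridReach_vertical h fun t h1 h2 => ⟨p, rfl, abs_le.2 hw1, key h1 h2 hz2 hw2⟩
    · exact (gridReach_vertical (S := gridNhd {p}) h fun t h1 h2 =>
        ⟨p, rfl, abs_le.2 hw1, key h1 h2 hw2 hz2⟩).symm
  exact h1.trans h2

lemma floor_mem_gridNhd {p q : ℝ × ℝ} (h : dist p q < 1) :
    (⌊p.1⌋, ⌊p.2⌋) ∈ gridNhd {q} := by
  rw [Prod.dist_eq, max_lt_iff, Real.dist_eq, Real.dist_eq, abs_lt, abs_lt] at h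
  have h1 := Int.floor_le p.1
  have h2 := Int.lt_floor_add_one p.1
  have h3 := Int.floor_le p.2
  have h4 := Int.lt_floor_add_one p.2
  refine ⟨q, rfl, abs_le.2 ⟨?_, ?_⟩, abs_le.2 ⟨?_, ?_⟩⟩ <;> simp only <;> linarith

/-- The grid points near a connected set are connected in the grid. -/
lemma gridReach_gridNhd {S : Set (ℝ × ℝ)} (hS : IsPreconnected S) {z w : ℤ × ℤ}
    (hz : z ∈ gridNhd S) (hw : w ∈ gridNhd S) : GridReach (gridNhd S) z w := by
  obtain ⟨p, hp, hz⟩ := hz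
  obtain ⟨q, hq, hw⟩ := hw
  have key := hS.induction₂ (fun p q => p ∈ S → q ∈ S → ∀ z ∈ gridNhd {p}, ∀ w ∈ gridNhd {q},
      GridReach (gridNhd S) z w) ?_ ?_ ?_ hp hq
  · exact key hp hq z ⟨p, rfl, hz⟩ w ⟨q, rfl, hw⟩
  · intro x _
    filter_upwards [mem_nhdsWithin_of_mem_nhds (Metric.ball_mem_nhds x one_pos)] with y hy hxS hyS
      z hz w hw
    have h1 : (⌊x.1⌋, ⌊x.2⌋) ∈ gridNhd {x} := floor_mem_gridNhd (by rw [_root_.dist_self]; exact one_pos)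
    have h2 : (⌊x.1⌋, ⌊x.2⌋) ∈ gridNhd {y} := floor_mem_gridNhd (by
      rw [_root_.dist_comm]; exact Metric.mem_ball.1 hy)
    exact ((gridReach_gridNhd_singleton hz h1).mono
      (gridNhd_mono (Set.singleton_subset_iff.2 hxS))).trans
      ((gridReach_gridNhd_singleton h2 hw).mono (gridNhd_mono (Set.singleton_subset_iff.2 hyS)))
  · intro x y t _ hy _ h1 h2 hxS htS z hz w hw
    exact (h1 hxS hy z hz _ (floor_mem_gridNhd (by rw [_root_.dist_self]; exact one_pos))).trans
      (h2 hy htS _ (floor_mem_gridNhd (by rw [_root_.dist_self]; exact one_pos)) w hw)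
  · intro x y _ _ h hyS hxS z hz w hw
    exact (h hxS hyS w hw z hz).symm

lemma finite_gridNhd {S : Set (ℝ × ℝ)} (hS : Bornology.IsBounded S) : (gridNhd S).Finite := by
  obtain ⟨R, hR⟩ := hS.subset_closedBall 0
  refine ((Set.finite_Icc (⌊-R - 2⌋) (⌈R + 2⌉)).prod
    (Set.finite_Icc (⌊-R - 2⌋) (⌈R + 2⌉))).subset ?_
  rintro ⟨x, y⟩ ⟨p, hp, h1, h2⟩
  have h := hR hp
  rw [mem_closedBall_zero_iff, Prod.norm_def, max_le_iff, Real.norm_eq_abs, Real.norm_eq_abs,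
    abs_le, abs_le] at h
  rw [abs_le] at h1 h2
  simp only at h1 h2
  have h3 := Int.floor_le (-R - 2)
  have h4 := Int.le_ceil (R + 2)
  simp only [Set.mem_prod, Set.mem_Icc]
  refine ⟨⟨?_, ?_⟩, ?_, ?_⟩ <;> rify <;> linarith

lemma disjoint_gridNhd {S T : Set (ℝ × ℝ)} (h : ∀ p ∈ S, ∀ q ∈ T, 4 < dist p q) :
    Disjoint (gridNhd S) (gridNhd T) := by
  rw [Set.disjoint_left]
  rintro ⟨x, y⟩ ⟨p, hp, h1, h2⟩ ⟨q, hq, h3, h4⟩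
  have := h p hp q hq
  rw [Prod.dist_eq, lt_max_iff, Real.dist_eq, Real.dist_eq, lt_abs, lt_abs] at this
  rw [abs_le] at *
  simp only at *
  rcases this with (h | h) | (h | h) <;> linarith

lemma gridNhd_nonempty {S : Set (ℝ × ℝ)} (h : S.Nonempty) : (gridNhd S).Nonempty := by
  obtain ⟨p, hp⟩ := h
  exact ⟨_, gridNhd_mono (Set.singleton_subset_iff.2 hp) (floor_mem_gridNhd (q := p) (by rw [_root_.dist_self]; exact one_pos))⟩

end GridReach

section Model

variable {V : Type*} [Finite V]

/-- Connected grid regions for the vertices and edges of a graph give a model of the graph as a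
minor of the grid. -/
lemma exists_gridModel (E : Finset (Sym2 V)) (X : V → Set (ℤ × ℤ)) (Y : Sym2 V → Set (ℤ × ℤ))
    (hXf : ∀ v, (X v).Finite) (hYf : ∀ e, (Y e).Finite) (hXn : ∀ v, (X v).Nonempty)
    (hXc : ∀ v, ∀ z ∈ X v, ∀ w ∈ X v, GridReach (X v) z w)
    (hYc : ∀ e ∈ E, ∀ z ∈ Y e, ∀ w ∈ Y e, GridReach (Y e) z w)
    (hXX : ∀ u v, u ≠ v → Disjoint (X u) (X v))
    (hYY : ∀ e ∈ E, ∀ f ∈ E, e ≠ f → Disjoint (Y e) (Y f))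
    (hXY : ∀ e ∈ E, ∀ v, v ∉ e → Disjoint (Y e) (X v))
    (hYX : ∀ e ∈ E, ∀ v ∈ e, (Y e ∩ X v).Nonempty) (hd : ∀ e ∈ E, ¬ e.IsDiag) :
    Nonempty (GridModel E) := by
  choose root hroot using hXn
  let p : Sym2 V → V := fun e => (Quot.out e).1
  let q : Sym2 V → V := fun e => (Quot.out e).2
  have hpq : ∀ e, e = s(p e, q e) := fun e => (Quot.out_eq e).symm
  have hp : ∀ e, p e ∈ e := fun e => by
    have h := Sym2.mem_mk_left (p e) (q e)
    rwa [← hpq e] at h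
  have hq : ∀ e, q e ∈ e := fun e => by
    have h := Sym2.mem_mk_right (p e) (q e)
    rwa [← hpq e] at h
  have hne : ∀ e ∈ E, p e ≠ q e := fun e he h => hd e he (by rw [hpq e, h]; rfl)
  let K : Sym2 V → Set (ℤ × ℤ) := fun e =>
    {z | ∃ y ∈ Y e ∩ X (p e), GridReach (Y e \ X (q e)) y z}
  have hKsub : ∀ e ∈ E, K e ⊆ Y e \ X (q e) := by
    rintro e he z ⟨y, hy, hz⟩
    exact hz.mem ⟨hy.1, (hXX _ _ (hne e he)).notMem_of_mem_left hy.2⟩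
  let B : V → Set (ℤ × ℤ) := fun v => X v ∪ ⋃ e ∈ {e | e ∈ E ∧ p e = v}, K e
  have hBf : ∀ v, (B v).Finite := by
    intro v
    refine (hXf v).union (Set.Finite.biUnion (Set.toFinite _) fun e he => ?_)
    exact (hYf e).subset fun z hz => (hKsub e he.1 hz).1
  have hKB : ∀ e ∈ E, K e ⊆ B (p e) := fun e he z hz =>
    Or.inr (Set.mem_biUnion (x := e) ⟨he, rfl⟩ hz)
  have hXK : ∀ u v z, z ∈ X u → z ∈ ⋃ e ∈ {e | e ∈ E ∧ p e = v}, K e → u = v := by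
    intro u v z hu hv
    obtain ⟨e, ⟨he, rfl⟩, hz⟩ := Set.mem_iUnion₂.1 hv
    obtain ⟨hzY, hzX⟩ := hKsub e he hz
    have hue : u ∈ e := by
      by_contra hue
      exact Set.disjoint_left.1 (hXY e he u hue) hzY hu
    rw [hpq e, Sym2.mem_iff] at hue
    rcases hue with h | h
    · exact h
    · exact absurd (h ▸ hu) hzX
  have hcross : ∀ e : Sym2 V, ∃ g : GridEdge, e ∈ E → ∃ u v, e = s(u, v) ∧
      g.src ∈ (hBf u).toFinset ∧ g.tgt ∈ (hBf v).toFinset := by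
    intro e
    by_cases he : e ∈ E
    swap
    · exact ⟨(true, 0, 0), fun h => absurd h he⟩
    obtain ⟨y, hy⟩ := hYX e he _ (hp e)
    obtain ⟨y', hy'⟩ := hYX e he _ (hq e)
    obtain ⟨c, d, hc, -, hdX, g, hg⟩ := (hYc e he y hy.1 y' hy'.1).exists_exit hy'.2
      ((hXX _ _ (hne e he)).notMem_of_mem_left hy.2)
    have hcB : c ∈ B (p e) := hKB e he ⟨y, hy, hc⟩
    have hdB : d ∈ B (q e) := Or.inl hdX
    refine ⟨g, fun _ => ?_⟩
    rcases hg with ⟨h1, h2⟩ | ⟨h1, h2⟩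
    · exact ⟨p e, q e, hpq e, by simpa [h1] using hcB, by simpa [h2] using hdB⟩
    · exact ⟨q e, p e, (hpq e).trans Sym2.eq_swap, by simpa [h1] using hdB,
        by simpa [h2] using hcB⟩
  choose edge hedge using hcross
  refine ⟨⟨fun v => (hBf v).toFinset, root, edge, ?_, ?_, ?_, hedge⟩⟩
  · intro v
    exact (hBf v).mem_toFinset.2 (Or.inl (hroot v))
  · intro u v z hu hv
    rw [Set.Finite.mem_toFinset] at hu hv
    rcases hu with hu | hu <;> rcases hv with hv | hv
    · by_contra huv
      exact Set.disjoint_left.1 (hXX u v huv) hu hv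
    · exact hXK u v z hu hv
    · exact (hXK v u z hv hu).symm
    · obtain ⟨e, ⟨he, rfl⟩, hz⟩ := Set.mem_iUnion₂.1 hu
      obtain ⟨f, ⟨hf, rfl⟩, hz'⟩ := Set.mem_iUnion₂.1 hv
      have hef : e = f := by
        by_contra hef
        exact Set.disjoint_left.1 (hYY e he f hf hef) (hKsub e he hz).1 (hKsub f hf hz').1
      rw [hef]
  · intro v z hz
    rw [Set.Finite.mem_toFinset] at hz
    suffices h : GridReach (B v) (root v) z by
      simpa [GridReach] using h
    rcases hz with hz | hz
    · exact (hXc v _ (hroot v) z hz).mono Set.subset_union_left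
    · obtain ⟨e, ⟨he, rfl⟩, y, hy, hz⟩ := Set.mem_iUnion₂.1 hz
      refine ((hXc _ _ (hroot _) y hy.2).mono Set.subset_union_left).trans
        (hz.within_reachable.mono fun c hc => hKB e he ⟨y, hy, hc⟩)

end Model

section Topology

lemma exists_lt_dist {ι : Type*} [Finite ι] (K : ι → Set (ℝ × ℝ)) (hK : ∀ i, IsCompact (K i)) :
    ∃ δ > 0, ∀ i j, Disjoint (K i) (K j) → ∀ p ∈ K i, ∀ q ∈ K j, δ < Dist.dist p q := by
  have h : ∀ i j, ∀ᶠ δ in nhdsWithin (0 : ℝ) (Set.Ioi 0),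
      Disjoint (K i) (K j) → ∀ p ∈ K i, ∀ q ∈ K j, δ < Dist.dist p q := by
    intro i j
    by_cases hij : Disjoint (K i) (K j)
    · obtain ⟨δ, hδ, h⟩ := hij.exists_cthickenings (hK i) (hK j).isClosed
      filter_upwards [Ioo_mem_nhdsGT hδ] with η hη _ p hp q hq
      by_contra! hle
      refine Set.disjoint_left.1 h (Metric.mem_cthickening_of_dist_le q p δ _ hp ?_)
        (Metric.self_subset_cthickening _ hq)
      rw [_root_.dist_comm]
      exact hle.trans hη.2.le
    · exact Filter.Eventually.of_forall fun _ h => absurd h hij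
  have h' := Filter.eventually_all.2 fun i => Filter.eventually_all.2 (h i)
  obtain ⟨δ, h1, h2⟩ := (h'.and self_mem_nhdsWithin).exists
  exact ⟨δ, h2, h1⟩

lemma exists_near_start {f : ℝ → ℝ × ℝ} (hf : ContinuousOn f (Set.Icc 0 1)) {r : ℝ}
    (hr : 0 < r) : ∃ a, 0 < a ∧ a < 1 / 2 ∧ Dist.dist (f a) (f 0) ≤ r := by
  obtain ⟨η, hη, h⟩ := Metric.continuousOn_iff.1 hf 0 (by simp) r hr
  refine ⟨min (η / 2) (1 / 4), by positivity, ?_, (h _ ⟨by positivity, ?_⟩ ?_).le⟩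
  · exact (min_le_right _ _).trans_lt (by norm_num)
  · exact (min_le_right _ _).trans (by norm_num)
  · rw [Real.dist_eq, sub_zero, abs_of_pos (by positivity)]
    exact (min_le_left _ _).trans_lt (by linarith)

lemma exists_near_ends {f : ℝ → ℝ × ℝ} (hf : ContinuousOn f (Set.Icc 0 1)) {r : ℝ}
    (hr : 0 < r) : ∃ a b, 0 < a ∧ a < b ∧ b < 1 ∧ Dist.dist (f a) (f 0) ≤ r ∧
      Dist.dist (f b) (f 1) ≤ r := by
  obtain ⟨a, ha, ha2, har⟩ := exists_near_start hf hr
  obtain ⟨b, hb, hb2, hbr⟩ := exists_near_start (f := fun t => f (1 - t))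
    (hf.comp (by fun_prop) fun t ht => ⟨by linarith [ht.2], by linarith [ht.1]⟩) hr
  exact ⟨a, 1 - b, ha, by linarith, by linarith, har, by simpa using hbr⟩

/-- A planar graph is a minor of the square grid. -/
lemma nonempty_gridModel {V : Type*} [Finite V] {G : SimpleGraph V} (hG : G.HasPlanarEmbedding)
    (E : Finset (Sym2 V)) (hE : ∀ e, e ∈ E ↔ e ∈ G.edgeSet) : Nonempty (GridModel E) := by
  classical
  obtain ⟨pos, arc, hpos, harc, hdisj⟩ := hG
  have hends : ∀ e : E, ∃ u v, e.1 = s(u, v) ∧ G.Adj u v := by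
    rintro ⟨e, he⟩
    induction e with
    | h a b => exact ⟨a, b, rfl, (hE _).1 he⟩
  choose u v huv hadj using hends
  let f : E → ℝ → ℝ × ℝ := fun e => arc (u e) (v e)
  have hf : ∀ e, ContinuousOn (f e) (Set.Icc 0 1) := fun e => (harc _ _ (hadj e)).1
  have hf0 : ∀ e, f e 0 = pos (u e) := fun e => (harc _ _ (hadj e)).2.2.1
  have hf1 : ∀ e, f e 1 = pos (v e) := fun e => (harc _ _ (hadj e)).2.2.2.1
  obtain ⟨δ, hδ, hδd⟩ := exists_lt_dist
    (Sum.elim (fun w => {pos w}) fun e => f e '' Set.Icc 0 1) (by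
      rintro (w | e)
      · exact isCompact_singleton
      · exact isCompact_Icc.image_of_continuousOn (hf e))
  have hVV : ∀ w x, w ≠ x → δ < Dist.dist (pos w) (pos x) := fun w x hwx =>
    hδd (Sum.inl w) (Sum.inl x) (Set.disjoint_singleton.2 (hpos.ne hwx)) _ rfl _ rfl
  have hEV : ∀ (e : E) w, w ∉ e.1 → ∀ t ∈ Set.Icc (0 : ℝ) 1, δ < Dist.dist (f e t) (pos w) := by
    intro e w hw t ht
    refine hδd (Sum.inr e) (Sum.inl w) ?_ _ (Set.mem_image_of_mem _ ht) _ rfl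
    rw [huv e, Sym2.mem_iff, not_or] at hw
    simp only [Sum.elim_inr, Sum.elim_inl, Set.disjoint_singleton_right]
    rintro ⟨t, ht, htw⟩
    rcases eq_or_lt_of_le ht.1 with h0 | h0
    · rw [← h0, hf0] at htw
      exact hw.1 (hpos htw).symm
    rcases eq_or_lt_of_le ht.2 with h1 | h1
    · rw [h1, hf1] at htw
      exact hw.2 (hpos htw).symm
    exact (harc _ _ (hadj e)).2.2.2.2.2 w t ⟨h0, h1⟩ htw
  have hr : 0 < δ / 3 := by positivity
  choose a b ha hab hb har hbr using fun e => exists_near_ends (hf e) hr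
  have hsub : ∀ e, Set.Icc (a e) (b e) ⊆ Set.Icc 0 1 := fun e =>
    Set.Icc_subset_Icc (ha e).le (hb e).le
  let N : V → Set (ℝ × ℝ) := fun w => Metric.closedBall (pos w) (δ / 3)
  let M : E → Set (ℝ × ℝ) := fun e => f e '' Set.Icc (a e) (b e)
  have hM : ∀ e, IsCompact (M e) := fun e =>
    isCompact_Icc.image_of_continuousOn ((hf e).mono (hsub e))
  have hNN : ∀ w x, w ≠ x → Disjoint (N w) (N x) := fun w x hwx =>
    Metric.closedBall_disjoint_closedBall (by linarith [hVV w x hwx])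
  have hMN : ∀ (e : E) w, w ∉ e.1 → Disjoint (M e) (N w) := by
    intro e w hw
    rw [Set.disjoint_left]
    rintro _ ⟨t, ht, rfl⟩ h
    have := hEV e w hw t (hsub e ht)
    rw [Metric.mem_closedBall] at h
    linarith
  have hMM : ∀ e e', e ≠ e' → Disjoint (M e) (M e') := by
    intro e e' hne
    rw [Set.disjoint_left]
    rintro _ ⟨t, ht, rfl⟩ ⟨t', ht', h⟩
    refine hdisj _ _ _ _ (hadj e) (hadj e') ?_ t ⟨by linarith [ha e, ht.1], by linarith [hb e, ht.2]⟩
      t' ⟨by linarith [ha e', ht'.1], by linarith [hb e', ht'.2]⟩ h.symm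
    rw [← huv, ← huv]
    exact fun h => hne (Subtype.ext h)
  obtain ⟨η, hη, hηd⟩ := exists_lt_dist (Sum.elim N M) (by
    rintro (w | e)
    · exact isCompact_closedBall _ _
    · exact hM e)
  let c : ℝ × ℝ → ℝ × ℝ := fun p => (4 / η) • p
  have hc : Continuous c := continuous_const_smul _
  have hcd : ∀ {S T : Set (ℝ × ℝ)}, (∀ p ∈ S, ∀ q ∈ T, η < Dist.dist p q) →
      Disjoint (gridNhd (c '' S)) (gridNhd (c '' T)) := by
    intro S T h
    apply disjoint_gridNhd
    rintro _ ⟨p, hp, rfl⟩ _ ⟨q, hq, rfl⟩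
    have h1 := h p hp q hq
    simp only [c]
    rw [dist_smul₀, Real.norm_eq_abs, abs_of_pos (by positivity), div_mul_eq_mul_div,
      lt_div_iff₀ hη]
    linarith
  have hNc : ∀ w, IsPreconnected (N w) := fun w => (convex_closedBall _ _).isPreconnected
  have hMc : ∀ e, IsPreconnected (M e) := fun e =>
    isPreconnected_Icc.image _ ((hf e).mono (hsub e))
  refine exists_gridModel E (fun w => gridNhd (c '' N w))
    (fun e => if h : e ∈ E then gridNhd (c '' M ⟨e, h⟩) else ∅) ?_ ?_ ?_ ?_ ?_ ?_ ?_ ?_ ?_ ?_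
  · exact fun w => finite_gridNhd ((isCompact_closedBall _ _).image hc).isBounded
  · intro e
    split_ifs with h
    · exact finite_gridNhd ((hM _).image hc).isBounded
    · exact Set.finite_empty
  · exact fun w => gridNhd_nonempty ((Metric.nonempty_closedBall.2 hr.le).image c)
  · exact fun w z hz z' hz' => gridReach_gridNhd ((hNc w).image c hc.continuousOn) hz hz'
  · intro e he
    simp only [he, dite_true]
    exact fun z hz z' hz' => gridReach_gridNhd ((hMc _).image c hc.continuousOn) hz hz'
  · exact fun w x hwx => hcd (hηd (Sum.inl w) (Sum.inl x) (hNN w x hwx))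
  · intro e he e' he' hne
    simp only [he, he', dite_true]
    exact hcd (hηd (Sum.inr _) (Sum.inr _) (hMM _ _ fun h => hne (congrArg Subtype.val h)))
  · intro e he w hw
    simp only [he, dite_true]
    exact hcd (hηd (Sum.inr _) (Sum.inl w) (hMN ⟨e, he⟩ w hw))
  · intro e he w hw
    simp only [he, dite_true]
    have h : ∃ p, p ∈ M ⟨e, he⟩ ∧ p ∈ N w := by
      have hw' : w ∈ (⟨e, he⟩ : E).1 := hw
      rw [huv, Sym2.mem_iff] at hw'
      rcases hw' with rfl | rfl
      · refine ⟨_, ⟨_, Set.left_mem_Icc.2 (hab _).le, rfl⟩, ?_⟩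
        rw [Metric.mem_closedBall, ← hf0]
        exact har _
      · refine ⟨_, ⟨_, Set.right_mem_Icc.2 (hab _).le, rfl⟩, ?_⟩
        rw [Metric.mem_closedBall, ← hf1]
        exact hbr _
    obtain ⟨p, hp, hp'⟩ := h
    obtain ⟨z, hz⟩ := gridNhd_nonempty (Set.singleton_nonempty (c p))
    exact ⟨z, gridNhd_mono (Set.singleton_subset_iff.2 (Set.mem_image_of_mem c hp)) hz,
      gridNhd_mono (Set.singleton_subset_iff.2 (Set.mem_image_of_mem c hp')) hz⟩
  · exact fun e he => G.not_isDiag_of_mem_edgeSet ((hE e).1 he)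

end Topology

/-- A planar `Θ₅`-free graph on `n ≥ 5` vertices has at most `5(n-2)/2` edges. -/
theorem ncard_edgeSet_le_of_theta5_free {V : Type*} [Fintype V] (G : SimpleGraph V)
    (hV : 5 ≤ Fintype.card V) (hG : G.HasPlanarEmbedding) (hfree : ¬ ContainsCopy theta5 G) :
    2 * G.edgeSet.ncard ≤ 5 * (Fintype.card V - 2) := by
  classical
  have hE : ∀ e, e ∈ G.edgeFinset ↔ e ∈ G.edgeSet := fun e => SimpleGraph.mem_edgeFinset
  obtain ⟨M⟩ := nonempty_gridModel hG G.edgeFinset hE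
  have h := (M.isAbstractDual fun e he => G.not_isDiag_of_mem_edgeSet ((hE e).1 he)).card_le G hE
    hfree hV
  rwa [← SimpleGraph.coe_edgeFinset, Set.ncard_coe_finset]

/-- A vertex of the periodic pattern: its type, layer and sector. -/
abbrev Node := ℕ × ℕ × ℕ

/-- Positions of the 28 vertex types in the universal cover of the annulus. -/
def typePos : List (ℕ × ℕ) := [
  (4, 2), (2, 4), (6, 4), (8, 6), (4, 3), (8, 5), (12, 7), (10, 8), (6, 8), (5, 10), (7, 10),
  (9, 10), (11, 10), (8, 12), (12, 12), (14, 13), (10, 7), (14, 7), (6, 9), (10, 9), (8, 11),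
  (12, 11), (12, 13), (16, 13), (0, 0), (4, 1), (4, 8), (8, 7)]

/-- One representative of each of the 72 classes of edges. -/
def edgeTable : List (Node × Node) := [
  ((4, 0, 0), (0, 0, 0)), ((4, 0, 0), (1, 0, 0)), ((4, 0, 0), (2, 0, 0)),
  ((0, 0, 0), (1, 0, 0)), ((0, 0, 0), (2, 0, 0)), ((1, 0, 0), (2, 0, 0)),
  ((5, 0, 0), (3, 0, 0)), ((5, 0, 0), (2, 0, 0)), ((5, 0, 0), (1, 0, 1)),
  ((3, 0, 0), (2, 0, 0)), ((3, 0, 0), (1, 0, 1)), ((2, 0, 0), (1, 0, 1)),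
  ((16, 0, 0), (3, 0, 0)), ((16, 0, 0), (6, 0, 0)), ((16, 0, 0), (7, 0, 0)),
  ((3, 0, 0), (6, 0, 0)), ((3, 0, 0), (7, 0, 0)), ((6, 0, 0), (7, 0, 0)),
  ((17, 0, 0), (3, 0, 1)), ((17, 0, 0), (6, 0, 0)), ((17, 0, 0), (8, 0, 1)),
  ((3, 0, 1), (6, 0, 0)), ((3, 0, 1), (8, 0, 1)), ((6, 0, 0), (8, 0, 1)),
  ((18, 0, 0), (8, 0, 0)), ((18, 0, 0), (9, 0, 0)), ((18, 0, 0), (10, 0, 0)),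
  ((8, 0, 0), (9, 0, 0)), ((8, 0, 0), (10, 0, 0)), ((9, 0, 0), (10, 0, 0)),
  ((20, 0, 0), (10, 0, 0)), ((20, 0, 0), (11, 0, 0)), ((20, 0, 0), (13, 0, 0)),
  ((10, 0, 0), (11, 0, 0)), ((10, 0, 0), (13, 0, 0)), ((11, 0, 0), (13, 0, 0)),
  ((19, 0, 0), (7, 0, 0)), ((19, 0, 0), (11, 0, 0)), ((19, 0, 0), (12, 0, 0)),
  ((7, 0, 0), (11, 0, 0)), ((7, 0, 0), (12, 0, 0)), ((11, 0, 0), (12, 0, 0)),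
  ((21, 0, 0), (12, 0, 0)), ((21, 0, 0), (9, 0, 1)), ((21, 0, 0), (14, 0, 0)),
  ((12, 0, 0), (9, 0, 1)), ((12, 0, 0), (14, 0, 0)), ((9, 0, 1), (14, 0, 0)),
  ((23, 0, 0), (0, 1, 1)), ((23, 0, 0), (15, 0, 0)), ((23, 0, 0), (13, 0, 1)),
  ((0, 1, 1), (15, 0, 0)), ((0, 1, 1), (13, 0, 1)), ((15, 0, 0), (13, 0, 1)),
  ((22, 0, 0), (0, 1, 0)), ((22, 0, 0), (15, 0, 0)), ((22, 0, 0), (14, 0, 0)),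
  ((0, 1, 0), (15, 0, 0)), ((0, 1, 0), (14, 0, 0)), ((15, 0, 0), (14, 0, 0)),
  ((25, 0, 0), (0, 0, 0)), ((25, 0, 0), (24, 0, 0)), ((25, 0, 0), (24, 0, 1)),
  ((0, 0, 0), (24, 0, 0)), ((0, 0, 0), (24, 0, 1)), ((24, 0, 0), (24, 0, 1)),
  ((27, 0, 0), (3, 0, 0)), ((27, 0, 0), (26, 0, 0)), ((27, 0, 0), (26, 0, 1)),
  ((3, 0, 0), (26, 0, 0)), ((3, 0, 0), (26, 0, 1)), ((26, 0, 0), (26, 0, 1))]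

/-- Edge representatives together with the vertices regarded as degenerate segments. -/
def segTable : List (Node × Node) :=
  edgeTable ++ (List.range 28).map fun τ => ((τ, 0, 0), (τ, 0, 0))

def nodeX (v : Node) : ℕ := (typePos.getD v.1 0).1 + 6 * v.2.1 + 8 * v.2.2

def nodeY (v : Node) : ℕ := (typePos.getD v.1 0).2 + 12 * v.2.1

/-- The linear form with coefficients `n` separates the open segments `pq` and `rs`. -/
def sepBy (n p q r s : ℤ × ℤ) : Bool :=
  let a := n.1 * p.1 + n.2 * p.2
  let b := n.1 * q.1 + n.2 * q.2
  let c := n.1 * r.1 + n.2 * r.2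
  let d := n.1 * s.1 + n.2 * s.2
  (decide (a ≤ c ∧ a ≤ d ∧ b ≤ c ∧ b ≤ d) || decide (c ≤ a ∧ c ≤ b ∧ d ≤ a ∧ d ≤ b)) &&
    !decide (a = b ∧ a = c ∧ a = d)

/-- A sufficient condition for the open segments `pq` and `rs` to be disjoint. -/
def separated (p q r s : ℤ × ℤ) : Bool :=
  sepBy (1, 0) p q r s || sepBy (0, 1) p q r s || sepBy (p.2 - q.2, q.1 - p.1) p q r s ||
    sepBy (r.2 - s.2, s.1 - r.1) p q r s || sepBy (q.1 - p.1, q.2 - p.2) p q r s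

/-- A vertex of type `τ` can lie `δ` layers below one of type `τ'`. -/
def LayerCompat (τ τ' : ℕ) (δ : ℤ) : Prop :=
  ((τ = 24 ∨ τ = 25) → 0 ≤ δ) ∧ ((τ' = 24 ∨ τ' = 25) → δ ≤ 0) ∧
  (26 ≤ τ → δ ≤ 0 ∧ (6 ≤ τ' ∧ τ' < 24 → δ < 0)) ∧ (26 ≤ τ' → 0 ≤ δ ∧ (6 ≤ τ ∧ τ < 24 → 0 < δ))

instance (τ τ' : ℕ) (δ : ℤ) : Decidable (LayerCompat τ τ' δ) := by
  unfold LayerCompat; infer_instance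

/-- The copies of `e` and `e'` whose base layers differ by `δ` can both be present. -/
def segCompat (e e' : Node × Node) (δ : ℤ) : Bool :=
  LayerCompat e.1.1 e'.1.1 (e'.1.2.1 - e.1.2.1 + δ) &&
  LayerCompat e.1.1 e'.2.1 (e'.2.2.1 - e.1.2.1 + δ) &&
  LayerCompat e.2.1 e'.1.1 (e'.1.2.1 - e.2.2.1 + δ) &&
  LayerCompat e.2.1 e'.2.1 (e'.2.2.1 - e.2.2.1 + δ)

/-- The intervals `[p, q]` and `[r, s]` are disjoint. -/
def apart (p q r s : ℕ) : Bool :=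
  (Nat.blt p r && Nat.blt p s && Nat.blt q r && Nat.blt q s) ||
    (Nat.blt r p && Nat.blt r q && Nat.blt s p && Nat.blt s q)

/-- No conflict between `e` and the copy of `e'` translated by `δ - 1` layers and `σ - 3`
sectors. -/
def segCheck (e e' : Node × Node) (δ σ : ℕ) : Bool :=
  separated (nodeX e.1 + 30, nodeY e.1 + 12) (nodeX e.2 + 30, nodeY e.2 + 12)
    (nodeX e'.1 + (6 * δ + 8 * σ), nodeY e'.1 + 12 * δ)
    (nodeX e'.2 + (6 * δ + 8 * σ), nodeY e'.2 + 12 * δ) ||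
  !segCompat e e' (δ - 1) || decide (e = e' ∧ δ = 1 ∧ σ = 3)

theorem segTable_check : (segTable.all fun e => segTable.all fun e' =>
    (List.range 3).all fun δ =>
      apart (nodeY e.1 + 12) (nodeY e.2 + 12) (nodeY e'.1 + 12 * δ) (nodeY e'.2 + 12 * δ) ||
      (List.range 7).all fun σ =>
        apart (nodeX e.1 + 30) (nodeX e.2 + 30) (nodeX e'.1 + (6 * δ + 8 * σ))
          (nodeX e'.2 + (6 * δ + 8 * σ)) || segCheck e e' δ σ) = true := by
  decide +kernel

section Segments

/-- The point of parameter `t` on the segment from `p` to `q`. -/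
def lerp (p q : ℤ × ℤ) (t : ℝ) : ℝ × ℝ :=
  (p.1 + t * (q.1 - p.1), p.2 + t * (q.2 - p.2))

theorem lerp_ne_of_sepBy {n p q r s : ℤ × ℤ} (h : sepBy n p q r s = true) {t t' : ℝ}
    (ht : t ∈ Set.Ioo (0 : ℝ) 1) (ht' : t' ∈ Set.Ioo (0 : ℝ) 1) : lerp p q t ≠ lerp r s t' := by
  intro heq
  obtain ⟨h0, h1⟩ := ht
  obtain ⟨h0', h1'⟩ := ht'
  simp only [lerp, Prod.mk.injEq] at heq
  simp only [sepBy, Bool.and_eq_true, Bool.or_eq_true, decide_eq_true_eq, Bool.not_eq_true',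
    decide_eq_false_iff_not] at h
  obtain ⟨h, hne⟩ := h
  set a := n.1 * p.1 + n.2 * p.2 with ha
  set b := n.1 * q.1 + n.2 * q.2 with hb
  set c := n.1 * r.1 + n.2 * r.2 with hc
  set d := n.1 * s.1 + n.2 * s.2 with hd
  have key : (1 - t) * (a : ℝ) + t * b = (1 - t') * c + t' * d := by
    rw [ha, hb, hc, hd]
    push_cast
    linear_combination (n.1 : ℝ) * heq.1 + (n.2 : ℝ) * heq.2
  have u : ∀ a b c d : ℤ, ∀ t t' : ℝ, 0 < t → t < 1 → 0 < t' → t' < 1 →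
      (a ≤ c ∧ a ≤ d ∧ b ≤ c ∧ b ≤ d) → (1 - t) * (a : ℝ) + t * b = (1 - t') * c + t' * d →
      a = b ∧ a = c ∧ a = d := by
    intro a b c d t t' h0 h1 h0' h1' ⟨hac, had, hbc, hbd⟩ key
    have e (x y : ℤ) (h : x ≤ y) : (x : ℝ) ≤ y := by exact_mod_cast h
    have hac := e _ _ hac
    have had := e _ _ had
    have hbc := e _ _ hbc
    have hbd := e _ _ hbd
    have k1 : (1 - t) * (1 - t') * ((c : ℝ) - a) + (1 - t) * t' * (d - a) +
        t * (1 - t') * (c - b) + t * t' * (d - b) = 0 := by linear_combination -key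
    have p1 : 0 < (1 - t) * (1 - t') := mul_pos (by linarith) (by linarith)
    have p2 : 0 < (1 - t) * t' := mul_pos (by linarith) (by linarith)
    have p3 : 0 < t * (1 - t') := mul_pos (by linarith) (by linarith)
    have p4 : 0 < t * t' := mul_pos (by linarith) (by linarith)
    have q1 := mul_nonneg p1.le (sub_nonneg.2 hac)
    have q2 := mul_nonneg p2.le (sub_nonneg.2 had)
    have q3 := mul_nonneg p3.le (sub_nonneg.2 hbc)
    have q4 := mul_nonneg p4.le (sub_nonneg.2 hbd)
    have r1 : (c : ℝ) - a = 0 := by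
      rcases mul_eq_zero.1 (show (1 - t) * (1 - t') * ((c : ℝ) - a) = 0 by linarith) with h | h
      · exact absurd h p1.ne'
      · exact h
    have r2 : (d : ℝ) - a = 0 := by
      rcases mul_eq_zero.1 (show (1 - t) * t' * ((d : ℝ) - a) = 0 by linarith) with h | h
      · exact absurd h p2.ne'
      · exact h
    have r3 : (c : ℝ) - b = 0 := by
      rcases mul_eq_zero.1 (show t * (1 - t') * ((c : ℝ) - b) = 0 by linarith) with h | h
      · exact absurd h p3.ne'
      · exact h
    refine ⟨?_, ?_, ?_⟩
    · have : (a : ℝ) = b := by linarith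
      exact_mod_cast this
    · have : (a : ℝ) = c := by linarith
      exact_mod_cast this
    · have : (a : ℝ) = d := by linarith
      exact_mod_cast this
  rcases h with h | h
  · exact hne (u a b c d t t' h0 h1 h0' h1' h key)
  · obtain ⟨e1, e2, e3⟩ := u c d a b t' t h0' h1' h0 h1 h key.symm
    exact hne (by omega)

theorem lerp_ne_of_separated {p q r s : ℤ × ℤ} (h : separated p q r s = true) {t t' : ℝ}
    (ht : t ∈ Set.Ioo (0 : ℝ) 1) (ht' : t' ∈ Set.Ioo (0 : ℝ) 1) : lerp p q t ≠ lerp r s t' := by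
  simp only [separated, Bool.or_eq_true] at h
  rcases h with (((h | h) | h) | h) | h <;> exact lerp_ne_of_sepBy h ht ht'

theorem ne_of_apart {p q r s : ℕ} (h : apart p q r s = true) {t t' : ℝ}
    (ht : t ∈ Set.Ioo (0 : ℝ) 1) (ht' : t' ∈ Set.Ioo (0 : ℝ) 1) :
    (p : ℝ) + t * (q - p) ≠ r + t' * (s - r) := by
  obtain ⟨h0, h1⟩ := ht
  obtain ⟨h0', h1'⟩ := ht'
  have u : ∀ a b c d : ℕ, ∀ t t' : ℝ, 0 < t → t < 1 → 0 < t' → t' < 1 →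
      ((a < c ∧ a < d) ∧ b < c) ∧ b < d → (a : ℝ) + t * (b - a) < c + t' * (d - c) := by
    intro a b c d t t' h0 h1 h0' h1' ⟨⟨⟨hac, had⟩, hbc⟩, hbd⟩
    have e (x y : ℕ) (h : x < y) : (x : ℝ) < y := by exact_mod_cast h
    have hac := e _ _ hac
    have had := e _ _ had
    have hbc := e _ _ hbc
    have hbd := e _ _ hbd
    have q1 := mul_pos (mul_pos (sub_pos.2 h1) (sub_pos.2 h1')) (sub_pos.2 hac)
    have q2 := mul_pos (mul_pos (sub_pos.2 h1) h0') (sub_pos.2 had)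
    have q3 := mul_pos (mul_pos h0 (sub_pos.2 h1')) (sub_pos.2 hbc)
    have q4 := mul_pos (mul_pos h0 h0') (sub_pos.2 hbd)
    nlinarith
  have hb (a b : ℕ) : Nat.blt a b = true ↔ a < b := Iff.of_eq Nat.ble_eq
  simp only [apart, Bool.or_eq_true, Bool.and_eq_true, hb] at h
  rcases h with h | h
  · exact (u p q r s t t' h0 h1 h0' h1' h).ne
  · exact (u r s p q t' t h0' h1' h0 h1 ⟨⟨⟨h.1.1.1, h.1.1.2⟩, h.1.2⟩, h.2⟩).ne'

/-- The point of parameter `t` on the copy of the segment `e` in layer `i` and sector `s`. -/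
def segPoint (e : Node × Node) (i s : ℤ) (t : ℝ) : ℝ × ℝ :=
  (nodeX e.1 + t * (nodeX e.2 - nodeX e.1) + (6 * i + 8 * s),
    nodeY e.1 + t * (nodeY e.2 - nodeY e.1) + 12 * i)

theorem segTable_bound : ∀ e ∈ segTable, (nodeX e.1 ≤ 24 ∧ nodeX e.2 ≤ 24) ∧
    nodeY e.1 ≤ 20 ∧ nodeY e.2 ≤ 20 := by
  decide +kernel

theorem segPoint_inj {e e' : Node × Node} (he : e ∈ segTable) (he' : e' ∈ segTable)
    {i i' s s' : ℤ} (hc : segCompat e e' (i' - i) = true) {t t' : ℝ}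
    (ht : t ∈ Set.Ioo (0 : ℝ) 1) (ht' : t' ∈ Set.Ioo (0 : ℝ) 1)
    (h : segPoint e i s t = segPoint e' i' s' t') : e = e' ∧ i = i' ∧ s = s' := by
  have hbound (a b n : ℕ) (ha : a ≤ n) (hb : b ≤ n) (t : ℝ) (ht : t ∈ Set.Ioo (0 : ℝ) 1) :
      0 ≤ (a : ℝ) + t * (b - a) ∧ (a : ℝ) + t * (b - a) ≤ n := by
    obtain ⟨h0, h1⟩ := ht
    have ha : (a : ℝ) ≤ n := by exact_mod_cast ha
    have hb : (b : ℝ) ≤ n := by exact_mod_cast hb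
    have := (Nat.cast_nonneg a : (0 : ℝ) ≤ a)
    have := (Nat.cast_nonneg b : (0 : ℝ) ≤ b)
    constructor <;> nlinarith
  obtain ⟨⟨hx1, hx2⟩, hy1, hy2⟩ := segTable_bound e he
  obtain ⟨⟨hx1', hx2'⟩, hy1', hy2'⟩ := segTable_bound e' he'
  have bx := hbound _ _ _ hx1 hx2 t ht
  have bx' := hbound _ _ _ hx1' hx2' t' ht'
  have yb := hbound _ _ _ hy1 hy2 t ht
  have yb' := hbound _ _ _ hy1' hy2' t' ht'
  simp only [segPoint, Prod.mk.injEq] at h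
  obtain ⟨hx, hy⟩ := h
  push_cast at bx bx' yb yb'
  have d1 : i' - i < 2 := by
    have : ((i' - i : ℤ) : ℝ) < 2 := by push_cast; linarith
    exact_mod_cast this
  have d2 : -2 < i' - i := by
    have : (-2 : ℝ) < ((i' - i : ℤ) : ℝ) := by push_cast; linarith
    exact_mod_cast this
  have d1' : ((i' : ℝ) - i) ≤ 1 := by
    have : i' - i ≤ 1 := by omega
    exact_mod_cast this
  have d2' : (-1 : ℝ) ≤ ((i' : ℝ) - i) := by
    have : -1 ≤ i' - i := by omega
    exact_mod_cast this
  have s1 : s' - s < 4 := by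
    have : ((s' - s : ℤ) : ℝ) < 4 := by push_cast; linarith
    exact_mod_cast this
  have s2 : -4 < s' - s := by
    have : (-4 : ℝ) < ((s' - s : ℤ) : ℝ) := by push_cast; linarith
    exact_mod_cast this
  obtain ⟨δ, hδ⟩ : ∃ δ : ℕ, (δ : ℤ) = i' - i + 1 := ⟨(i' - i + 1).toNat, by omega⟩
  obtain ⟨σ, hσ⟩ : ∃ σ : ℕ, (σ : ℤ) = s' - s + 3 := ⟨(s' - s + 3).toNat, by omega⟩
  have hδ' : (δ : ℝ) = i' - i + 1 := by exact_mod_cast hδ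
  have hσ' : (σ : ℝ) = s' - s + 3 := by exact_mod_cast hσ
  have tab := segTable_check
  rw [List.all_eq_true] at tab
  have tab := tab e he
  rw [List.all_eq_true] at tab
  have tab := tab e' he'
  rw [List.all_eq_true] at tab
  have tab := tab δ (List.mem_range.2 (by omega))
  rw [Bool.or_eq_true] at tab
  rcases tab with tab | tab
  · refine absurd ?_ (ne_of_apart tab ht ht')
    push_cast
    rw [hδ']
    linear_combination hy
  rw [List.all_eq_true] at tab
  have tab := tab σ (List.mem_range.2 (by omega))
  rw [Bool.or_eq_true] at tab
  rcases tab with tab | tab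
  · refine absurd ?_ (ne_of_apart tab ht ht')
    push_cast
    rw [hδ', hσ']
    linear_combination hx
  have hδ1 : (δ : ℤ) - 1 = i' - i := by omega
  rw [segCheck, hδ1, hc] at tab
  simp only [Bool.not_true, Bool.or_false, Bool.or_eq_true, decide_eq_true_eq] at tab
  rcases tab with tab | ⟨rfl, h1, h3⟩
  · refine absurd ?_ (lerp_ne_of_separated tab ht ht')
    simp only [lerp, Prod.mk.injEq]
    push_cast
    rw [hδ', hσ']
    constructor
    · linear_combination hx
    · linear_combination hy
  · refine ⟨rfl, by omega, by omega⟩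

end Segments

section Annulus

/-- The universal cover of the punctured plane, with period `40` in the first coordinate. -/
noncomputable def annulus (p : ℝ × ℝ) : ℝ × ℝ :=
  Complex.equivRealProd (Complex.exp ((2 * Real.pi / 40 : ℝ) * (p.2 + p.1 * Complex.I)))

theorem continuous_annulus : Continuous annulus :=
  Complex.equivRealProdCLM.continuous.comp (by fun_prop)

theorem annulus_eq_iff {p q : ℝ × ℝ} :
    annulus p = annulus q ↔ p.2 = q.2 ∧ ∃ m : ℤ, p.1 = q.1 + 40 * m := by
  rw [annulus, annulus, Complex.equivRealProd.injective.eq_iff, Complex.exp_eq_exp_iff_exists_int]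
  have hpi := Real.pi_pos
  constructor
  · rintro ⟨m, hm⟩
    have hre := congrArg Complex.re hm
    have him := congrArg Complex.im hm
    simp at hre him
    refine ⟨hre, m, ?_⟩
    have : 2 * Real.pi * p.1 = 2 * Real.pi * (q.1 + 40 * m) := by linear_combination 40 * him
    exact mul_left_cancel₀ (by positivity) this
  · rintro ⟨h1, m, h2⟩
    refine ⟨m, ?_⟩
    rw [h1, h2]
    push_cast
    ring

end Annulus

section Curves

variable {V ι : Type*}

/-- A graph drawn with an arc for each index of a family covering its edges is planar. -/
theorem hasPlanarEmbedding_of_curves (G : SimpleGraph V) (a b : ι → V) (pos : V → ℝ × ℝ)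
    (γ : ι → ℝ → ℝ × ℝ) (hG : ∀ u v, G.Adj u v → ∃ j, s(a j, b j) = s(u, v))
    (hpos : Function.Injective pos) (hcont : ∀ j, Continuous (γ j))
    (hinj : ∀ j, Set.InjOn (γ j) (Set.Icc 0 1)) (h0 : ∀ j, γ j 0 = pos (a j))
    (h1 : ∀ j, γ j 1 = pos (b j)) (hv : ∀ j w, ∀ t ∈ Set.Ioo (0 : ℝ) 1, γ j t ≠ pos w)
    (hdisj : ∀ j j', j ≠ j' → ∀ t ∈ Set.Ioo (0 : ℝ) 1, ∀ t' ∈ Set.Ioo (0 : ℝ) 1,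
      γ j t ≠ γ j' t') : G.HasPlanarEmbedding := by
  classical
  cases isEmpty_or_nonempty ι with
  | inl hι =>
    have hG' : ∀ u v, ¬ G.Adj u v := fun u v h => hι.elim (hG u v h).choose
    exact ⟨pos, fun u _ _ => pos u, hpos, fun u v h => (hG' u v h).elim,
      fun u v _ _ h => (hG' u v h).elim⟩
  | inr hι =>
    have hJ : ∀ z : Sym2 V, ∃ j, z ∈ G.edgeSet → s(a j, b j) = z := by
      intro z
      by_cases hz : z ∈ G.edgeSet
      · induction z with
        | _ u v =>
          obtain ⟨j, hj⟩ := hG u v hz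
          exact ⟨j, fun _ => hj⟩
      · exact ⟨Classical.arbitrary ι, fun h => absurd h hz⟩
    choose J hJ using hJ
    have hflip : ∀ t : ℝ, t ∈ Set.Ioo (0 : ℝ) 1 → 1 - t ∈ Set.Ioo (0 : ℝ) 1 :=
      fun t ht => ⟨by linarith [ht.2], by linarith [ht.1]⟩
    refine ⟨pos, fun u v t => if a (J s(u, v)) = u then γ (J s(u, v)) t
      else γ (J s(u, v)) (1 - t), hpos, ?_, ?_⟩
    · intro u v huv
      have hj := hJ s(u, v) huv
      have hne := huv.ne
      dsimp only
      rw [Sym2.eq_swap (a := v) (b := u)]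
      generalize J s(u, v) = j at hj
      rw [Sym2.eq_iff] at hj
      rcases hj with ⟨rfl, rfl⟩ | ⟨rfl, rfl⟩
      · simp only [if_true, hne, if_false, sub_sub_cancel]
        exact ⟨(hcont j).continuousOn, hinj j, h0 j, h1 j, fun _ => trivial, fun w t ht => hv j w t ht⟩
      · simp only [if_true, hne.symm, if_false]
        refine ⟨((hcont j).comp (by fun_prop)).continuousOn, ?_, by simp [h1], by simp [h0],
          fun _ => trivial, fun w t ht => hv j w _ (hflip t ht)⟩
        intro x hx y hy hxy
        have hxy' : 1 - x = 1 - y := hinj j ⟨by linarith [hx.2], by linarith [hx.1]⟩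
          ⟨by linarith [hy.2], by linarith [hy.1]⟩ hxy
        linarith
    · intro u v x y huv hxy hne t ht t' ht'
      have hJne : J s(u, v) ≠ J s(x, y) := fun h => hne (by
        rw [← hJ s(u, v) huv, ← hJ s(x, y) hxy, h])
      dsimp only
      split_ifs
      · exact hdisj _ _ hJne _ ht _ ht'
      · exact hdisj _ _ hJne _ ht _ (hflip _ ht')
      · exact hdisj _ _ hJne _ (hflip _ ht) _ ht'
      · exact hdisj _ _ hJne _ (hflip _ ht) _ (hflip _ ht')

end Curves

section Pattern

/-- The nodes of the pattern with `k + 1` layers of belts: types `0`-`5` form the belts, types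
`6`-`23` the zones between consecutive belts, and the remaining types the two caps. -/
def nodeFinset (k : ℕ) : Finset Node :=
  (Finset.range 6 ×ˢ Finset.range (k + 1) ×ˢ Finset.range 5 ∪
    Finset.Ico 6 24 ×ˢ Finset.range k ×ˢ Finset.range 5) ∪
  (Finset.Ico 24 26 ×ˢ {0} ×ˢ Finset.range 5 ∪ Finset.Ico 26 28 ×ˢ {k} ×ˢ Finset.range 5)

theorem mem_nodeFinset {k τ i s : ℕ} : (τ, i, s) ∈ nodeFinset k ↔ s < 5 ∧
    (τ < 6 ∧ i ≤ k ∨ 6 ≤ τ ∧ τ < 24 ∧ i < k ∨ 24 ≤ τ ∧ τ < 26 ∧ i = 0 ∨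
      26 ≤ τ ∧ τ < 28 ∧ i = k) := by
  simp only [nodeFinset, Finset.mem_union, Finset.mem_product, Finset.mem_range, Finset.mem_Ico,
    Finset.mem_singleton]
  omega

theorem card_nodeFinset (k : ℕ) : (nodeFinset k).card = 120 * k + 50 := by
  rw [nodeFinset, Finset.card_union_of_disjoint, Finset.card_union_of_disjoint,
    Finset.card_union_of_disjoint]
  · simp only [Finset.card_product, Finset.card_range, Nat.card_Ico, Finset.card_singleton]
    ring
  all_goals
    rw [Finset.disjoint_left]
    rintro ⟨τ, i, s⟩
    simp only [Finset.mem_union, Finset.mem_product, Finset.mem_range, Finset.mem_Ico,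
      Finset.mem_singleton]
    omega

/-- The copy of a node `i` layers up and `s` sectors on. -/
def Node.shift (v : Node) (i s : ℕ) : Node := (v.1, i + v.2.1, (s + v.2.2) % 5)

theorem layerCompat_of_mem {k i i' s s' : ℕ} {v v' : Node} (h : v.shift i s ∈ nodeFinset k)
    (h' : v'.shift i' s' ∈ nodeFinset k) :
    LayerCompat v.1 v'.1 (v'.2.1 - v.2.1 + (i' - i)) := by
  rw [Node.shift, mem_nodeFinset] at h h'
  refine ⟨?_, ?_, ?_, ?_⟩ <;> omega

/-- The copy of the segment `e` in layer `i` and sector `s` belongs to the pattern. -/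
structure SegMem (k : ℕ) (e : Node × Node) (i s : ℕ) : Prop where
  fst_mem : e.1.shift i s ∈ nodeFinset k
  snd_mem : e.2.shift i s ∈ nodeFinset k
  lt : s < 5

theorem SegMem.segCompat {k i i' s s' : ℕ} {e e' : Node × Node} (h : SegMem k e i s)
    (h' : SegMem k e' i' s') : segCompat e e' (i' - i) = true := by
  simp only [PlanarTuran.segCompat, Bool.and_eq_true, decide_eq_true_eq]
  exact ⟨⟨⟨layerCompat_of_mem h.1 h'.1, layerCompat_of_mem h.1 h'.2⟩,
    layerCompat_of_mem h.2 h'.1⟩, layerCompat_of_mem h.2 h'.2⟩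

theorem SegMem.eq_of_annulus_eq {k i i' s s' : ℕ} {e e' : Node × Node} (h : SegMem k e i s)
    (h' : SegMem k e' i' s') (he : e ∈ segTable) (he' : e' ∈ segTable) {t t' : ℝ}
    (ht : t ∈ Set.Ioo (0 : ℝ) 1) (ht' : t' ∈ Set.Ioo (0 : ℝ) 1)
    (heq : annulus (segPoint e i s t) = annulus (segPoint e' i' s' t')) :
    e = e' ∧ i = i' ∧ s = s' := by
  rw [annulus_eq_iff] at heq
  obtain ⟨hy, m, hx⟩ := heq
  have := segPoint_inj (i := i) (i' := i') (s := s) (s' := s' + 5 * m) he he'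
    (h.segCompat h') ht ht' (by
      simp only [segPoint] at hx hy ⊢
      rw [hx, hy]
      refine Prod.ext ?_ rfl
      push_cast
      ring)
  have := h.lt
  have := h'.lt
  refine ⟨by tauto, by omega, by omega⟩

/-- A vertex type as a degenerate segment. -/
def vertexSeg (τ : ℕ) : Node × Node := ((τ, 0, 0), (τ, 0, 0))

theorem vertexSeg_mem {τ : ℕ} (h : τ < 28) : vertexSeg τ ∈ segTable :=
  List.mem_append_right _ (List.mem_map.2 ⟨τ, List.mem_range.2 h, rfl⟩)

theorem vertexSeg_notMem (τ : ℕ) : vertexSeg τ ∉ edgeTable := by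
  have : ∀ e ∈ edgeTable, e.1 ≠ e.2 := by decide +kernel
  exact fun h => this _ h rfl

theorem segMem_vertexSeg {k : ℕ} {v : Node} (h : v ∈ nodeFinset k) :
    SegMem k (vertexSeg v.1) v.2.1 v.2.2 := by
  have hs : v.2.2 < 5 := (mem_nodeFinset.1 h).1
  have : Node.shift (v.1, 0, 0) v.2.1 v.2.2 = v := by
    simp [Node.shift, Nat.mod_eq_of_lt hs]
  exact ⟨by rwa [vertexSeg, this], by rwa [vertexSeg, this], hs⟩

theorem fst_lt_of_mem {k : ℕ} {v : Node} (h : v ∈ nodeFinset k) : v.1 < 28 := by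
  obtain ⟨τ, i, s⟩ := v
  have := mem_nodeFinset.1 h
  dsimp only
  omega

theorem segPoint_vertexSeg (v : Node) (t : ℝ) :
    segPoint (vertexSeg v.1) v.2.1 v.2.2 t = ((nodeX v : ℝ), (nodeY v : ℝ)) := by
  simp only [segPoint, vertexSeg, nodeX, nodeY]
  push_cast
  refine Prod.ext ?_ ?_ <;> simp only <;> ring

theorem annulus_shift (v : Node) (i s : ℕ) :
    annulus (nodeX (v.shift i s), nodeY (v.shift i s)) =
      annulus (nodeX v + (6 * i + 8 * s), nodeY v + 12 * i) := by
  rw [annulus_eq_iff]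
  obtain ⟨m, hm⟩ : ∃ m, (s + v.2.2) % 5 + 5 * m = s + v.2.2 := ⟨_, Nat.mod_add_div _ 5⟩
  have hm : (((s + v.2.2) % 5 : ℕ) : ℝ) + 5 * m = s + v.2.2 := by exact_mod_cast hm
  refine ⟨?_, -m, ?_⟩
  · simp only [nodeY, Node.shift]
    push_cast
    ring
  · simp only [nodeX, Node.shift]
    push_cast
    linear_combination 8 * hm

/-- An index of an edge of the pattern. -/
abbrev EdgeIndex (k : ℕ) : Type :=
  {j : (Node × Node) × ℕ × ℕ // j.1 ∈ edgeTable ∧ SegMem k j.1 j.2.1 j.2.2}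

def EdgeIndex.src {k : ℕ} (j : EdgeIndex k) : nodeFinset k := ⟨_, j.2.2.fst_mem⟩

def EdgeIndex.tgt {k : ℕ} (j : EdgeIndex k) : nodeFinset k := ⟨_, j.2.2.snd_mem⟩

/-- The extremal graph on `120 k + 50` vertices. -/
def patternGraph (k : ℕ) : SimpleGraph (nodeFinset k) :=
  SimpleGraph.fromEdgeSet (Set.range fun j : EdgeIndex k => s(j.src, j.tgt))

theorem edgeTable_subset {e : Node × Node} (h : e ∈ edgeTable) : e ∈ segTable :=
  List.mem_append_left _ h

theorem edgeTable_nondegenerate :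
    ∀ e ∈ edgeTable, nodeX e.1 ≠ nodeX e.2 ∨ nodeY e.1 ≠ nodeY e.2 := by
  decide +kernel

theorem injOn_annulus_segPoint {e : Node × Node} (he : e ∈ edgeTable) (i s : ℤ) :
    Set.InjOn (fun t => annulus (segPoint e i s t)) (Set.Icc 0 1) := by
  rintro t ⟨h0, h1⟩ t' ⟨h0', h1'⟩ h
  obtain ⟨hy, m, hx⟩ := annulus_eq_iff.1 h
  simp only [segPoint] at hx hy
  obtain ⟨⟨hx1, hx2⟩, -⟩ := segTable_bound e (edgeTable_subset he)
  have b1 : (nodeX e.1 : ℝ) ≤ 24 := by exact_mod_cast hx1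
  have b2 : (nodeX e.2 : ℝ) ≤ 24 := by exact_mod_cast hx2
  have b3 : (0 : ℝ) ≤ nodeX e.1 := Nat.cast_nonneg _
  have b4 : (0 : ℝ) ≤ nodeX e.2 := Nat.cast_nonneg _
  have hm : m = 0 := by
    have u : |(t - t') * ((nodeX e.2 : ℝ) - nodeX e.1)| ≤ 1 * 24 := by
      rw [abs_mul]
      apply mul_le_mul _ _ (abs_nonneg _) zero_le_one <;> rw [abs_le] <;> constructor <;> linarith
    rw [abs_le] at u
    have m1 : (m : ℝ) < 1 := by linarith [u.2]
    have m2 : (-1 : ℝ) < m := by linarith [u.1]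
    have m1 : m < 1 := by exact_mod_cast m1
    have m2 : -1 < m := by exact_mod_cast m2
    omega
  subst hm
  rcases edgeTable_nondegenerate e he with h | h
  · have hne : (nodeX e.2 : ℝ) - nodeX e.1 ≠ 0 := sub_ne_zero.2 (by exact_mod_cast h.symm)
    apply mul_right_cancel₀ hne
    push_cast at hx
    linear_combination hx
  · have hne : (nodeY e.2 : ℝ) - nodeY e.1 ≠ 0 := sub_ne_zero.2 (by exact_mod_cast h.symm)
    apply mul_right_cancel₀ hne
    linear_combination hy

theorem patternGraph_hasPlanarEmbedding (k : ℕ) : (patternGraph k).HasPlanarEmbedding := by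
  have hmid : (1 / 2 : ℝ) ∈ Set.Ioo (0 : ℝ) 1 := by norm_num
  refine hasPlanarEmbedding_of_curves (ι := EdgeIndex k) (patternGraph k) EdgeIndex.src
    EdgeIndex.tgt (fun v => annulus (nodeX v.1, nodeY v.1))
    (fun j t => annulus (segPoint j.1.1 j.1.2.1 j.1.2.2 t)) ?_ ?_ ?_ ?_ ?_ ?_ ?_ ?_
  · intro u v h
    exact ((SimpleGraph.fromEdgeSet_adj _).1 h).1
  · intro v w h
    dsimp only at h
    rw [← segPoint_vertexSeg v.1 (1 / 2), ← segPoint_vertexSeg w.1 (1 / 2)] at h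
    obtain ⟨h1, h2, h3⟩ := (segMem_vertexSeg v.2).eq_of_annulus_eq (segMem_vertexSeg w.2)
      (vertexSeg_mem (fst_lt_of_mem v.2)) (vertexSeg_mem (fst_lt_of_mem w.2)) hmid hmid h
    exact Subtype.ext (Prod.ext (congrArg (fun e => e.1.1) h1) (Prod.ext h2 h3))
  · intro j
    exact continuous_annulus.comp (by unfold segPoint; fun_prop)
  · exact fun j => injOn_annulus_segPoint j.2.1 _ _
  · intro j
    refine Eq.trans ?_ (annulus_shift j.1.1.1 j.1.2.1 j.1.2.2).symm
    simp [segPoint]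
  · intro j
    refine Eq.trans ?_ (annulus_shift j.1.1.2 j.1.2.1 j.1.2.2).symm
    simp [segPoint]
  · intro j w t ht h
    rw [← segPoint_vertexSeg w.1 (1 / 2)] at h
    obtain ⟨h1, -⟩ := j.2.2.eq_of_annulus_eq (segMem_vertexSeg w.2)
      (edgeTable_subset j.2.1) (vertexSeg_mem (fst_lt_of_mem w.2)) ht hmid h
    exact vertexSeg_notMem w.1.1 (h1 ▸ j.2.1)
  · intro j j' hne t ht t' ht' h
    obtain ⟨h1, h2, h3⟩ := j.2.2.eq_of_annulus_eq j'.2.2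
      (edgeTable_subset j.2.1) (edgeTable_subset j'.2.1) ht ht' h
    exact hne (Subtype.ext (Prod.ext h1 (Prod.ext h2 h3)))

end Pattern

section Count

/-- The indices of the edges in the layers `L` for which the larger type of the ends lies
in `A`. -/
def edgeBlock (A L : Finset ℕ) : Finset ((Node × Node) × ℕ × ℕ) :=
  (edgeTable.filter fun e => max e.1.1 e.2.1 ∈ A).toFinset ×ˢ L ×ˢ Finset.range 5

theorem mem_edgeBlock {A L : Finset ℕ} {j : (Node × Node) × ℕ × ℕ} : j ∈ edgeBlock A L ↔
    (j.1 ∈ edgeTable ∧ max j.1.1.1 j.1.2.1 ∈ A) ∧ j.2.1 ∈ L ∧ j.2.2 < 5 := by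
  simp [edgeBlock, and_assoc]

theorem card_edgeBlock {A L : Finset ℕ} {c : ℕ}
    (h : (edgeTable.filter fun e => max e.1.1 e.2.1 ∈ A).toFinset.card = c) :
    (edgeBlock A L).card = c * (L.card * 5) := by
  rw [edgeBlock, Finset.card_product, Finset.card_product, Finset.card_range, h]

/-- The indices of the edges of the pattern. -/
def edgeIndexFinset (k : ℕ) : Finset ((Node × Node) × ℕ × ℕ) :=
  (edgeBlock (Finset.Ico 0 6) (Finset.range (k + 1)) ∪
    edgeBlock (Finset.Ico 6 24) (Finset.range k)) ∪
  (edgeBlock (Finset.Ico 24 26) {0} ∪ edgeBlock (Finset.Ico 26 28) {k})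

theorem card_edgeIndexFinset (k : ℕ) : (edgeIndexFinset k).card = 300 * k + 120 := by
  rw [edgeIndexFinset, Finset.card_union_of_disjoint, Finset.card_union_of_disjoint,
    Finset.card_union_of_disjoint, card_edgeBlock (c := 12) (by decide +kernel),
    card_edgeBlock (c := 48) (by decide +kernel), card_edgeBlock (c := 6) (by decide +kernel),
    card_edgeBlock (c := 6) (by decide +kernel)]
  · simp only [Finset.card_range, Finset.card_singleton]
    ring
  all_goals
    rw [Finset.disjoint_left]
    intro j
    simp only [Finset.mem_union, mem_edgeBlock, Finset.mem_Ico]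
    omega

theorem edgeTable_layers : ∀ e ∈ edgeTable, ∀ v ∈ [e.1, e.2],
    v.1 < 28 ∧ v.2.1 ≤ 1 ∧ (6 ≤ v.1 → v.2.1 = 0) ∧
    (max e.1.1 e.2.1 < 6 ∨ 24 ≤ max e.1.1 e.2.1 → v.2.1 = 0) ∧
    (24 ≤ max e.1.1 e.2.1 ∧ max e.1.1 e.2.1 < 26 → v.1 < 6 ∨ 24 ≤ v.1 ∧ v.1 < 26) ∧
    (26 ≤ max e.1.1 e.2.1 → v.1 < 6 ∨ 26 ≤ v.1) ∧ v.1 ≤ max e.1.1 e.2.1 := by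
  decide +kernel

theorem segMem_of_mem_edgeIndexFinset {k : ℕ} {j : (Node × Node) × ℕ × ℕ}
    (h : j ∈ edgeIndexFinset k) : j.1 ∈ edgeTable ∧ SegMem k j.1 j.2.1 j.2.2 := by
  simp only [edgeIndexFinset, Finset.mem_union, mem_edgeBlock, Finset.mem_Ico, Finset.mem_range,
    Finset.mem_singleton] at h
  have he : j.1 ∈ edgeTable := by tauto
  have key : ∀ v ∈ [j.1.1, j.1.2], v.shift j.2.1 j.2.2 ∈ nodeFinset k := by
    intro v hv
    have := edgeTable_layers _ he v hv
    rw [Node.shift, mem_nodeFinset]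
    refine ⟨Nat.mod_lt _ (by norm_num), ?_⟩
    omega
  exact ⟨he, key _ (by simp), key _ (by simp), by omega⟩

theorem edgeTable_injective : ∀ e ∈ edgeTable, ∀ e' ∈ edgeTable,
    (e.1.1 = e'.1.1 ∧ e.2.1 = e'.2.1 ∧ e.1.2.1 + e'.2.2.1 = e'.1.2.1 + e.2.2.1 ∧
      (e.1.2.2 + e'.2.2.2) % 5 = (e'.1.2.2 + e.2.2.2) % 5 → e = e') ∧
    ¬ (e.1.1 = e'.2.1 ∧ e.2.1 = e'.1.1 ∧ e.1.2.1 + e'.1.2.1 = e.2.2.1 + e'.2.2.1 ∧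
      (e.1.2.2 + e'.1.2.2) % 5 = (e.2.2.2 + e'.2.2.2) % 5) := by
  decide +kernel

theorem Node.shift_eq_iff {v w : Node} {i i' s s' : ℕ} : v.shift i s = w.shift i' s' ↔
    v.1 = w.1 ∧ i + v.2.1 = i' + w.2.1 ∧ (s + v.2.2) % 5 = (s' + w.2.2) % 5 := by
  simp [Node.shift]

theorem EdgeIndex.src_ne_tgt {k : ℕ} (j : EdgeIndex k) : j.src ≠ j.tgt := by
  intro h
  have h := Node.shift_eq_iff.1 (congrArg Subtype.val h)
  have := (edgeTable_injective _ j.2.1 _ j.2.1).2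
  omega

theorem EdgeIndex.injective (k : ℕ) :
    Function.Injective fun j : EdgeIndex k => s(j.src, j.tgt) := by
  intro j j' h
  have hs := j.2.2.lt
  have hs' := j'.2.2.lt
  have tab := edgeTable_injective _ j.2.1 _ j'.2.1
  rcases Sym2.eq_iff.1 h with ⟨h1, h2⟩ | ⟨h1, h2⟩
  · have h1 := Node.shift_eq_iff.1 (congrArg Subtype.val h1)
    have h2 := Node.shift_eq_iff.1 (congrArg Subtype.val h2)
    have he : j.1.1 = j'.1.1 := tab.1 (by omega)
    rw [he] at h1
    exact Subtype.ext (Prod.ext he (Prod.ext (by omega) (by omega)))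
  · have h1 := Node.shift_eq_iff.1 (congrArg Subtype.val h1)
    have h2 := Node.shift_eq_iff.1 (congrArg Subtype.val h2)
    exact absurd (by omega) tab.2

theorem le_ncard_edgeSet_patternGraph (k : ℕ) :
    300 * k + 120 ≤ (patternGraph k).edgeSet.ncard := by
  classical
  let S : Finset (EdgeIndex k) := (edgeIndexFinset k).subtype _
  have hS : S.card = 300 * k + 120 := by
    rw [← card_edgeIndexFinset k, Finset.card_subtype, Finset.filter_true_of_mem]
    exact fun j hj => segMem_of_mem_edgeIndexFinset hj
  rw [← hS, ← Finset.card_image_of_injective S (EdgeIndex.injective k), ← Set.ncard_coe_finset]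
  refine Set.ncard_le_ncard ?_ (Set.toFinite _)
  intro z hz
  simp only [Finset.coe_image, Set.mem_image] at hz
  obtain ⟨j, -, rfl⟩ := hz
  rw [patternGraph, SimpleGraph.mem_edgeSet, SimpleGraph.fromEdgeSet_adj]
  exact ⟨⟨j, rfl⟩, j.src_ne_tgt⟩

end Count

section Theta

/-- A node seen from another one: its type, and the differences of layers and of sectors. -/
abbrev RelNode := ℕ × ℤ × ℕ

/-- The position of `w` relative to `v`. -/
def relOf (v w : Node) : RelNode := (w.1, w.2.1 - v.2.1, (w.2.2 + 5 - v.2.2) % 5)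

/-- The neighbours of the nodes of each type, as seen from these nodes. -/
def nbrTable : List (List RelNode) := [
  [(1, 0, 0), (2, 0, 0), (4, 0, 0), (13, -1, 0), (14, -1, 0), (15, -1, 0), (15, -1, 4),
    (22, -1, 0), (23, -1, 4), (24, 0, 0), (24, 0, 1), (25, 0, 0)],
  [(0, 0, 0), (2, 0, 0), (2, 0, 4), (3, 0, 4), (4, 0, 0), (5, 0, 4)],
  [(0, 0, 0), (1, 0, 0), (1, 0, 1), (3, 0, 0), (4, 0, 0), (5, 0, 0)],
  [(1, 0, 1), (2, 0, 0), (5, 0, 0), (6, 0, 0), (6, 0, 4), (7, 0, 0), (8, 0, 0), (16, 0, 0),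
    (17, 0, 4), (26, 0, 0), (26, 0, 1), (27, 0, 0)],
  [(0, 0, 0), (1, 0, 0), (2, 0, 0)],
  [(1, 0, 1), (2, 0, 0), (3, 0, 0)],
  [(3, 0, 0), (3, 0, 1), (7, 0, 0), (8, 0, 1), (16, 0, 0), (17, 0, 0)],
  [(3, 0, 0), (6, 0, 0), (11, 0, 0), (12, 0, 0), (16, 0, 0), (19, 0, 0)],
  [(3, 0, 0), (6, 0, 4), (9, 0, 0), (10, 0, 0), (17, 0, 4), (18, 0, 0)],
  [(8, 0, 0), (10, 0, 0), (12, 0, 4), (14, 0, 4), (18, 0, 0), (21, 0, 4)],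
  [(8, 0, 0), (9, 0, 0), (11, 0, 0), (13, 0, 0), (18, 0, 0), (20, 0, 0)],
  [(7, 0, 0), (10, 0, 0), (12, 0, 0), (13, 0, 0), (19, 0, 0), (20, 0, 0)],
  [(7, 0, 0), (9, 0, 1), (11, 0, 0), (14, 0, 0), (19, 0, 0), (21, 0, 0)],
  [(0, 1, 0), (10, 0, 0), (11, 0, 0), (15, 0, 4), (20, 0, 0), (23, 0, 4)],
  [(0, 1, 0), (9, 0, 1), (12, 0, 0), (15, 0, 0), (21, 0, 0), (22, 0, 0)],
  [(0, 1, 0), (0, 1, 1), (13, 0, 1), (14, 0, 0), (22, 0, 0), (23, 0, 0)],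
  [(3, 0, 0), (6, 0, 0), (7, 0, 0)],
  [(3, 0, 1), (6, 0, 0), (8, 0, 1)],
  [(8, 0, 0), (9, 0, 0), (10, 0, 0)],
  [(7, 0, 0), (11, 0, 0), (12, 0, 0)],
  [(10, 0, 0), (11, 0, 0), (13, 0, 0)],
  [(9, 0, 1), (12, 0, 0), (14, 0, 0)],
  [(0, 1, 0), (14, 0, 0), (15, 0, 0)],
  [(0, 1, 1), (13, 0, 1), (15, 0, 0)],
  [(0, 0, 0), (0, 0, 4), (24, 0, 1), (24, 0, 4), (25, 0, 0), (25, 0, 4)],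
  [(0, 0, 0), (24, 0, 0), (24, 0, 1)],
  [(3, 0, 0), (3, 0, 4), (26, 0, 1), (26, 0, 4), (27, 0, 0), (27, 0, 4)],
  [(3, 0, 0), (26, 0, 0), (26, 0, 1)]]

def nbrs (τ : ℕ) : List RelNode := nbrTable.getD τ []

theorem relOf_mem_nbrs : ∀ e ∈ edgeTable,
    relOf e.1 e.2 ∈ nbrs e.1.1 ∧ relOf e.2 e.1 ∈ nbrs e.2.1 := by
  decide +kernel

/-- The node seen as `x` from the node seen as `c`. -/
def RelNode.add (c x : RelNode) : RelNode := (x.1, c.2.1 + x.2.1, (c.2.2 + x.2.2) % 5)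

def RelNode.adj (c d : RelNode) : Bool := (nbrs c.1).any fun x => decide (c.add x = d)

set_option synthInstance.maxSize 1000 in
set_option synthInstance.maxHeartbeats 100000 in
theorem nbrs_check : ∀ τ < 28, ∀ b ∈ nbrs τ, ∀ c ∈ nbrs τ, b.adj c = true →
    ∀ d' ∈ nbrs c.1, c.add d' ≠ (τ, 0, 0) → c.add d' ≠ b →
    ∀ e ∈ nbrs τ, e ≠ b → e ≠ c → (c.add d').adj e = true →
      ¬ (LayerCompat τ d'.1 (c.add d').2.1 ∧ LayerCompat c.1 e.1 (e.2.1 - c.2.1)) := by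
  decide +kernel

theorem relOf_shift {v w : Node} (hv : v.2.2 ≤ 5) (i s : ℕ) :
    relOf (v.shift i s) (w.shift i s) = relOf v w := by
  simp only [relOf, Node.shift, Prod.mk.injEq, true_and]
  constructor
  · push_cast
    ring
  · omega

theorem edgeTable_sector_le : ∀ e ∈ edgeTable, e.1.2.2 ≤ 5 ∧ e.2.2.2 ≤ 5 := by
  decide +kernel

theorem relOf_mem_nbrs_of_adj {k : ℕ} {u v : nodeFinset k} (h : (patternGraph k).Adj u v) :
    relOf u.1 v.1 ∈ nbrs u.1.1 := by
  obtain ⟨⟨j, hj⟩, -⟩ := (SimpleGraph.fromEdgeSet_adj _).1 h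
  have he := j.2.1
  obtain ⟨h1, h2⟩ := edgeTable_sector_le _ he
  obtain ⟨h3, h4⟩ := relOf_mem_nbrs _ he
  rcases Sym2.eq_iff.1 hj with ⟨rfl, rfl⟩ | ⟨rfl, rfl⟩
  · exact (relOf_shift h1 j.1.2.1 j.1.2.2).symm ▸ h3
  · exact (relOf_shift h2 j.1.2.1 j.1.2.2).symm ▸ h4

theorem relOf_add (u : Node) {v w : Node} (hv : v.2.2 < 5) (hu : u.2.2 < 5) :
    (relOf u v).add (relOf v w) = relOf u w := by
  simp only [relOf, RelNode.add, Prod.mk.injEq, true_and]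
  constructor
  · ring
  · omega

theorem relOf_injective {u v w : Node} (hu : u.2.2 < 5) (hv : v.2.2 < 5) (hw : w.2.2 < 5)
    (h : relOf u v = relOf u w) : v = w := by
  simp only [relOf, Prod.mk.injEq] at h
  exact Prod.ext h.1 (Prod.ext (by omega) (by omega))

theorem not_containsCopy_theta5_patternGraph (k : ℕ) :
    ¬ ContainsCopy theta5 (patternGraph k) := by
  rw [containsCopy_theta5_iff]
  rintro ⟨a, b, c, d, e, hnd, hab, hbc, hcd, hde, hae, hac⟩
  have hlt : ∀ v : nodeFinset k, v.1.2.2 < 5 := fun v => (mem_nodeFinset.1 v.2).1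
  have hne : ∀ {v w : nodeFinset k}, v ≠ w → relOf a.1 v.1 ≠ relOf a.1 w.1 := fun h h' =>
    h (Subtype.ext (relOf_injective (hlt a) (hlt _) (hlt _) h'))
  have hadd : ∀ v w : nodeFinset k, (relOf a.1 v.1).add (relOf v.1 w.1) = relOf a.1 w.1 :=
    fun v w => relOf_add a.1 (hlt v) (hlt a)
  have hadj : ∀ {v w : nodeFinset k}, (patternGraph k).Adj v w →
      (relOf a.1 v.1).adj (relOf a.1 w.1) = true := fun {v w} h =>
    List.any_eq_true.2 ⟨_, relOf_mem_nbrs_of_adj h, decide_eq_true (hadd v w)⟩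
  have haa : relOf a.1 a.1 = (a.1.1, 0, 0) := by
    simp [relOf]
  have hcompat : ∀ v w : nodeFinset k, LayerCompat v.1.1 w.1.1 (w.1.2.1 - v.1.2.1) := by
    intro v w
    have hv : Node.shift (v.1.1, v.1.2.1, v.1.2.2) 0 0 ∈ nodeFinset k := by
      simp [Node.shift, Nat.mod_eq_of_lt (hlt v)]
    have hw : Node.shift (w.1.1, w.1.2.1, w.1.2.2) 0 0 ∈ nodeFinset k := by
      simp [Node.shift, Nat.mod_eq_of_lt (hlt w)]
    simpa using layerCompat_of_mem hv hw
  simp only [List.nodup_cons, List.mem_cons, List.not_mem_nil, not_or, or_false] at hnd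
  have key := nbrs_check a.1.1 (fst_lt_of_mem a.2) _ (relOf_mem_nbrs_of_adj hab) _
    (relOf_mem_nbrs_of_adj hac) (hadj hbc) _ (relOf_mem_nbrs_of_adj hcd)
  rw [hadd c d, ← haa] at key
  refine key (hne (by tauto)) (hne (by tauto)) _ (relOf_mem_nbrs_of_adj hae) (hne (by tauto))
    (hne (by tauto)) (hadj hde) ⟨hcompat a d, ?_⟩
  have := hcompat c e
  simpa only [relOf, sub_sub_sub_cancel_right] using this

end Theta

theorem theta5_free_transfer {V W : Type*} {G : SimpleGraph V} {H : SimpleGraph W} (f : H ≃g G)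
    (h : ¬ ContainsCopy theta5 G) : ¬ ContainsCopy theta5 H := fun ⟨g, hg⟩ =>
  h ⟨f.toHom.comp g, f.injective.comp hg⟩

theorem hasPlanarEmbedding_of_iso {V W : Type*} {G : SimpleGraph V} {H : SimpleGraph W}
    (f : H ≃g G) : G.HasPlanarEmbedding → H.HasPlanarEmbedding := by
  rintro ⟨pos, arc, hpos, h1, h2⟩
  refine ⟨pos ∘ f, fun u v => arc (f u) (f v), hpos.comp f.injective, fun u v h => ?_,
    fun u v x y huv hxy hne => h2 _ _ _ _ (f.map_adj_iff.2 huv) (f.map_adj_iff.2 hxy) ?_⟩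
  · obtain ⟨c, i, p, q, r, s⟩ := h1 (f u) (f v) (f.map_adj_iff.2 h)
    exact ⟨c, i, p, q, r, fun w => s (f w)⟩
  · exact fun h => hne (Sym2.map.injective f.injective h)

/-- The upper bound of `ncard_edgeSet_le_of_theta5_free` is attained on `120 k + 50` vertices. -/
theorem exists_extremal_theta5_free (k n : ℕ) (hn : n = 120 * k + 50) :
    ∃ G : SimpleGraph (Fin n), G.HasPlanarEmbedding ∧ ¬ ContainsCopy theta5 G ∧
      2 * G.edgeSet.ncard = 5 * (n - 2) := by
  have hcard : Fintype.card (nodeFinset k) = n := by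
    rw [Fintype.card_coe, card_nodeFinset, hn]
  let e : Fin n ≃ nodeFinset k := (Fintype.equivFinOfCardEq hcard).symm
  let f : (patternGraph k).comap e ≃g patternGraph k := SimpleGraph.Iso.comap e _
  have hG := hasPlanarEmbedding_of_iso f (patternGraph_hasPlanarEmbedding k)
  have hfree := theta5_free_transfer f (not_containsCopy_theta5_patternGraph k)
  refine ⟨_, hG, hfree, le_antisymm ?_ ?_⟩
  · simpa using ncard_edgeSet_le_of_theta5_free _ (by rw [Fintype.card_fin]; omega) hG hfree
  · have hE : ((patternGraph k).comap e).edgeSet.ncard = (patternGraph k).edgeSet.ncard :=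
      Nat.card_congr f.mapEdgeSet
    have := le_ncard_edgeSet_patternGraph k
    omega

end PlanarTuran

/-- For every `k ≥ 0` and `n = 120k + 50` there is a planar, `Θ₅`-free simple graph on `n`
vertices with exactly `5(n-2)/2` edges; together with the upper bound this gives
`ex_P(n, Θ₅) = 5(n-2)/2` whenever `n ≡ 50 (mod 120)`. -/
theorem planar_turan_theta5_tight (k n : ℕ) (hn : n = 120 * k + 50) :
    (∃ G : SimpleGraph (Fin n), G.HasPlanarEmbedding ∧ ¬ ContainsCopy theta5 G ∧
      2 * G.edgeSet.ncard = 5 * (n - 2)) ∧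
    (∀ (V : Type) [Fintype V] (G : SimpleGraph V), Fintype.card V = n →
      G.HasPlanarEmbedding → ¬ ContainsCopy theta5 G →
      2 * G.edgeSet.ncard ≤ 5 * (n - 2)) := by
  refine ⟨PlanarTuran.exists_extremal_theta5_free k n hn, ?_⟩
  intro V _ G hV hG hfree
  exact hV ▸ PlanarTuran.ncard_edgeSet_le_of_theta5_free G (by omega) hG hfree
end

section
/- There exists a planar simple graph on 9 vertices with 18 edges that contains no member of Θ₆ as a subgraph (namely, two copies of K₅ minus an edge sharing one vertex). Consequently ex_P(9, Θ₆) = 18 = 18(9−2)/7, so the bound ex_P(n, Θ₆) ≤ 18(n−2)/7 is attained with equality at n = 9. -/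
open SimpleGraph

section LogChange

open Complex

/-- `w` is the total change along `[0, 1]` of a continuous logarithm of `f`. -/
def IsLogChange (f : ℝ → ℂ) (w : ℂ) : Prop :=
  ∃ l : ℝ → ℂ, Continuous l ∧ (∀ t, exp (l t) = f t) ∧ w = l 1 - l 0

theorem IsLogChange.unique {f : ℝ → ℂ} {w w' : ℂ} (h : IsLogChange f w)
    (h' : IsLogChange f w') : w = w' := by
  obtain ⟨l, hl, hlf, rfl⟩ := h
  obtain ⟨l', hl', hlf', rfl⟩ := h'
  have hf : f 0 ≠ 0 := hlf 0 ▸ exp_ne_zero _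
  have key := isCoveringMapOn_exp.existsUnique_continuousMap_lifts (a₀ := (0 : ℝ))
    (e₀ := l 0) ⟨f, (funext hlf : (fun t => exp (l t)) = f) ▸ by fun_prop⟩ (hlf 0)
    (fun a => by simp [← hlf a])
  have := key.unique (y₁ := ⟨l, hl⟩) (y₂ := ⟨fun t => l' t + (l 0 - l' 0), by fun_prop⟩)
    ⟨rfl, funext hlf⟩
    ⟨by simp, funext fun t => by
      simp only [Function.comp_apply, ContinuousMap.coe_mk, exp_add, exp_sub, hlf, hlf']
      field_simp⟩
  have h1 := DFunLike.congr_fun this 1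
  simp only [ContinuousMap.coe_mk] at h1
  rw [h1]
  ring

theorem IsLogChange.neg {f : ℝ → ℂ} {w : ℂ} (h : IsLogChange f w) :
    IsLogChange (fun t => -f t) w := by
  obtain ⟨l, hl, hlf, rfl⟩ := h
  exact ⟨fun t => l t + Real.pi * I, by fun_prop, fun t => by simp [exp_add, hlf], by simp⟩

theorem exists_continuous_log {A : Type*} [AddCommGroup A] [Module ℝ A] [TopologicalSpace A]
    [ContinuousAdd A] [ContinuousSMul ℝ A] [LocallyPathConnectedSpace A] {f : A → ℂ}
    (hf : Continuous f) (h0 : ∀ a, f a ≠ 0) :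
    ∃ l : A → ℂ, Continuous l ∧ ∀ a, exp (l a) = f a := by
  obtain ⟨l, ⟨-, hl⟩, -⟩ := isCoveringMapOn_exp.existsUnique_continuousMap_lifts
    (a₀ := (0 : A)) ⟨f, hf⟩ (exp_log (h0 0)) (by simp [h0])
  exact ⟨l, l.continuous, fun a => congrFun hl a⟩

theorem exists_isLogChange {f : ℝ → ℂ} (hf : Continuous f) (h0 : ∀ t, f t ≠ 0) :
    ∃ w, IsLogChange f w := by
  obtain ⟨l, hl, hlf⟩ := exists_continuous_log hf h0
  exact ⟨_, l, hl, hlf, rfl⟩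

/-- The logarithm of the difference of two disjoint paths has no monodromy around the
boundary of the parameter square. -/
theorem logChange_square {α β : ℝ → ℂ} (hα : Continuous α) (hβ : Continuous β)
    (hne : ∀ s t, α s ≠ β t) {w₀ w₁ z₀ z₁ : ℂ}
    (hw₀ : IsLogChange (fun t => β t - α 0) w₀) (hw₁ : IsLogChange (fun t => β t - α 1) w₁)
    (hz₀ : IsLogChange (fun s => α s - β 0) z₀) (hz₁ : IsLogChange (fun s => α s - β 1) z₁) :
    w₀ + z₁ = z₀ + w₁ := by
  obtain ⟨L, hL, hLf⟩ := exists_continuous_log (A := ℝ × ℝ) (f := fun q => β q.2 - α q.1)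
    (by fun_prop) (fun q => sub_ne_zero.2 (hne q.1 q.2).symm)
  rw [hw₀.unique ⟨fun t => L (0, t), by fun_prop, fun t => hLf _, rfl⟩,
    hw₁.unique ⟨fun t => L (1, t), by fun_prop, fun t => hLf _, rfl⟩,
    hz₀.neg.unique ⟨fun s => L (s, 0), by fun_prop, fun s => by simp [hLf], rfl⟩,
    hz₁.neg.unique ⟨fun s => L (s, 1), by fun_prop, fun s => by simp [hLf], rfl⟩]
  ring

/-- Among five points of the plane joined pairwise by paths, two disjoint pairs of points are
joined by paths that meet. -/
theorem exists_paths_meet (p : Fin 5 → ℂ) (γ : Fin 5 → Fin 5 → ℝ → ℂ)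
    (hγ : ∀ a b, a < b → Continuous (γ a b)) (h0 : ∀ a b, a < b → γ a b 0 = p a)
    (h1 : ∀ a b, a < b → γ a b 1 = p b) :
    ∃ a b c d, a < b ∧ c < d ∧ a ≠ c ∧ a ≠ d ∧ b ≠ c ∧ b ≠ d ∧
      ∃ s t, γ a b s = γ c d t := by
  by_contra! hne
  have hpγ : ∀ v c d, c < d → v ≠ c → v ≠ d → ∀ t, γ c d t ≠ p v := by
    intro v c d hcd hvc hvd t h
    obtain ⟨u, huv, huc, hud⟩ : ∃ u, u ≠ v ∧ u ≠ c ∧ u ≠ d :=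
      (by decide : ∀ v c d : Fin 5, ∃ u, u ≠ v ∧ u ≠ c ∧ u ≠ d) v c d
    rcases huv.lt_or_gt with huv' | huv'
    · exact hne u v c d huv' hcd huc hud hvc hvd 1 t (by rw [h1 _ _ huv', h])
    · exact hne v u c d huv' hcd hvc hvd huc hud 0 t (by rw [h0 _ _ huv', h])
  have hp : ∀ a b, a ≠ b → p a ≠ p b := by
    intro a b hab h
    obtain ⟨u, hua, hub⟩ : ∃ u, u ≠ a ∧ u ≠ b :=
      (by decide : ∀ a b : Fin 5, ∃ u, u ≠ a ∧ u ≠ b) a b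
    rcases hua.lt_or_gt with hu | hu
    · exact hpγ b u a hu hub.symm hab.symm 1 (by rw [h1 _ _ hu, h])
    · exact hpγ b a u hu hab.symm hub.symm 0 (by rw [h0 _ _ hu, h])
  obtain ⟨θ, hθ, hθπ⟩ : ∃ θ : Fin 5 → Fin 5 → ℂ, (∀ a b, a ≠ b → exp (θ a b) = p b - p a) ∧
      ∀ a b, a < b → θ b a = θ a b + Real.pi * I := by
    refine ⟨fun a b => if a < b then log (p b - p a) else log (p a - p b) + Real.pi * I,
      fun a b hab => ?_, fun a b hab => ?_⟩
    · have h1 := sub_ne_zero.2 (hp a b hab)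
      have h2 := sub_ne_zero.2 (hp b a hab.symm)
      dsimp only
      split_ifs
      · rw [exp_log h2]
      · simp [exp_add, exp_log h1]
    · simp [hab, hab.not_gt]
  have hn : ∀ v c d, ∃ n : ℤ, c < d → v ≠ c → v ≠ d →
      IsLogChange (fun t => γ c d t - p v) (θ v d - θ v c + n * (2 * Real.pi * I)) := by
    intro v c d
    by_cases hcd : c < d ∧ v ≠ c ∧ v ≠ d
    swap
    · exact ⟨0, fun h h' h'' => absurd ⟨h, h', h''⟩ hcd⟩
    obtain ⟨hcd, hvc, hvd⟩ := hcd
    obtain ⟨w, hw⟩ := exists_isLogChange (f := fun t => γ c d t - p v)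
      ((hγ c d hcd).sub continuous_const)
      (fun t => sub_ne_zero.2 (hpγ v c d hcd hvc hvd t))
    obtain ⟨n, hn⟩ : ∃ n : ℤ, w = θ v d - θ v c + n * (2 * Real.pi * I) := by
      rw [← exp_eq_exp_iff_exists_int]
      obtain ⟨l, hl, hlf, rfl⟩ := hw
      simp only [exp_sub, hlf, hθ _ _ hvd, hθ _ _ hvc, h0 _ _ hcd, h1 _ _ hcd]
    exact ⟨n, fun _ _ _ => hn ▸ hw⟩
  choose n hn using hn
  have key : ∀ a b c d, a < b → c < d → a ≠ c → a ≠ d → b ≠ c → b ≠ d →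
      n a c d + n d a b - n b c d - n c a b + (if d < a then 1 else 0)
        - (if c < a then 1 else 0) - (if d < b then 1 else 0) + (if c < b then 1 else 0)
        = 0 := by
    intro a b c d hab hcd hac had hbc hbd
    have hsq := logChange_square (hγ a b hab) (hγ c d hcd)
      (hne a b c d hab hcd hac had hbc hbd)
      (by simpa only [h0 a b hab] using hn a c d hcd hac had)
      (by simpa only [h1 a b hab] using hn b c d hcd hbc hbd)
      (by simpa only [h0 c d hcd] using hn c a b hab hac.symm hbc.symm)
      (by simpa only [h1 c d hcd] using hn d a b hab had.symm hbd.symm)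
    have hsym : ∀ x y, x ≠ y →
        θ x y - θ y x = (2 * (if y < x then 1 else 0 : ℤ) - 1) * (Real.pi * I) := by
      intro x y hxy
      rcases hxy.lt_or_gt with h | h
      · rw [hθπ x y h]; simp [h.not_gt]
      · rw [hθπ y x h]; simp [h]; ring
    have hπ : (2 * Real.pi * I : ℂ) ≠ 0 := by simp [Real.pi_ne_zero]
    have : ((n a c d + n d a b - n b c d - n c a b + (if d < a then 1 else 0)
        - (if c < a then 1 else 0) - (if d < b then 1 else 0) + (if c < b then 1 else 0) : ℤ) : ℂ)
        * (2 * Real.pi * I) = 0 := by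
      push_cast [-Int.cast_ite]
      linear_combination hsq - hsym a d had + hsym a c hac + hsym b d hbd - hsym b c hbc
    exact_mod_cast (mul_eq_zero.1 this).resolve_right hπ
  have k1 := key 0 1 2 3; have k2 := key 0 1 2 4; have k3 := key 0 1 3 4
  have k4 := key 0 2 1 3; have k5 := key 0 2 1 4; have k6 := key 0 2 3 4
  have k7 := key 0 3 1 2; have k8 := key 0 3 1 4; have k9 := key 0 3 2 4
  have k10 := key 0 4 1 2; have k11 := key 0 4 1 3; have k12 := key 0 4 2 3
  have k13 := key 1 2 3 4; have k14 := key 1 3 2 4; have k15 := key 1 4 2 3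
  simp at k1 k2 k3 k4 k5 k6 k7 k8 k9 k10 k11 k12 k13 k14 k15
  omega

end LogChange

theorem SimpleGraph.HasPlanarEmbedding.not_top_fin_five {V : Type*} {G : SimpleGraph V}
    (hG : G.HasPlanarEmbedding) (f : Fin 5 → V) (hf : Function.Injective f)
    (hadj : ∀ a b, a ≠ b → G.Adj (f a) (f b)) : False := by
  obtain ⟨pos, arc, hpos, harc, hcross⟩ := hG
  have hends : ∀ a b, a ≠ b → ∀ t ∈ Set.Icc (0 : ℝ) 1, t ∈ Set.Ioo (0 : ℝ) 1 ∨
      arc (f a) (f b) t = pos (f a) ∨ arc (f a) (f b) t = pos (f b) := by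
    intro a b hab t ht
    obtain ⟨-, -, h0, h1, -⟩ := harc _ _ (hadj a b hab)
    rcases ht.1.eq_or_lt with rfl | h
    · exact .inr (.inl h0)
    rcases ht.2.eq_or_lt with rfl | h'
    · exact .inr (.inr h1)
    exact .inl ⟨h, h'⟩
  obtain ⟨a, b, c, d, hab, hcd, hac, had, hbc, hbd, s, t, hst⟩ := exists_paths_meet
    (fun a => Complex.equivRealProdCLM.symm (pos (f a)))
    (fun a b t => Complex.equivRealProdCLM.symm
      (arc (f a) (f b) (Set.projIcc (0 : ℝ) 1 zero_le_one t)))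
    (fun a b hab => Complex.equivRealProdCLM.symm.continuous.comp <|
      (harc _ _ (hadj a b hab.ne)).1.comp_continuous (by fun_prop) fun t => Subtype.prop _)
    (fun a b hab => by simp [(harc _ _ (hadj a b hab.ne)).2.2.1])
    (fun a b hab => by simp [(harc _ _ (hadj a b hab.ne)).2.2.2.1])
  replace hst := Complex.equivRealProdCLM.symm.injective hst
  have hs := (Set.projIcc (0 : ℝ) 1 zero_le_one s).2
  have ht := (Set.projIcc (0 : ℝ) 1 zero_le_one t).2
  set s' : ℝ := (Set.projIcc (0 : ℝ) 1 zero_le_one s).1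
  set t' : ℝ := (Set.projIcc (0 : ℝ) 1 zero_le_one t).1
  have hs' := (harc _ _ (hadj a b hab.ne)).2.2.2.2.2
  have ht' := (harc _ _ (hadj c d hcd.ne)).2.2.2.2.2
  have hne : ∀ x y, x ≠ y → pos (f x) ≠ pos (f y) := fun x y h h' => h (hf (hpos h'))
  rcases hends a b hab.ne s' hs with h | h | h <;>
    rcases hends c d hcd.ne t' ht with h' | h' | h'
  · refine hcross _ _ _ _ (hadj a b hab.ne) (hadj c d hcd.ne) ?_ s' h t' h' hst
    simp [hf.eq_iff, hac, had, hbc, hbd]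
  · exact hs' _ s' h (hst.trans h')
  · exact hs' _ s' h (hst.trans h')
  · exact ht' _ t' h' (hst.symm.trans h)
  · exact hne a c hac (h.symm.trans (hst.trans h'))
  · exact hne a d had (h.symm.trans (hst.trans h'))
  · exact ht' _ t' h' (hst.symm.trans h)
  · exact hne b c hbc (h.symm.trans (hst.trans h'))
  · exact hne b d hbd (h.symm.trans (hst.trans h'))

section Search

/-- Entry `(i, j)` of the Boolean matrix stored in the binary digits of `Y`. -/
def entry (Y i j : ℕ) : Bool :=
  Nat.beq (Nat.land (Nat.shiftRight Y (Nat.add (Nat.mul i 16) j)) 1) 1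

def diff (i j : ℕ) : Bool := !(Nat.beq i j)

def anyOf (l : List ℕ) (p : ℕ → Bool) : Bool :=
  List.rec false (fun a _ ih => p a || ih) l

def setEntry (Y i j : ℕ) : ℕ := Y ||| (2 ^ (16 * i + j) ||| 2 ^ (16 * j + i))

/-- Application that makes the kernel evaluate the argument first. -/
def evalThen (x : ℕ) (f : ℕ → Bool) : Bool :=
  Nat.rec (f 0) (fun k _ => f k.succ) x

/-- Some 6-cycle of `Y` with a chord passes through the edge `uv`, as a side or as a chord. -/
def hasThetaAt (l : List ℕ) (Y u v : ℕ) : Bool :=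
  anyOf l fun a => entry Y u a && diff a v && anyOf l fun b => entry Y v b && diff b u &&
    diff b a && anyOf l fun c => entry Y b c && diff c u && diff c v && diff c a &&
    anyOf l fun d => diff d u && diff d v && diff d a && diff d b && diff d c &&
      (entry Y c a && entry Y u d && entry Y d v || entry Y u c && entry Y a d && entry Y d v ||
        entry Y c d && entry Y d a && (entry Y u b || entry Y u c || entry Y u d ||
          entry Y v a || entry Y v c || entry Y v d || entry Y a b || entry Y a c || entry Y b d))

/-- Some `K₅` of `Y` contains the edge `uv`. -/
def hasK5At (l : List ℕ) (Y u v : ℕ) : Bool :=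
  anyOf l fun a => entry Y u a && entry Y v a && anyOf l fun b => entry Y a b && entry Y u b &&
    entry Y v b && anyOf l fun c => entry Y a c && entry Y b c && entry Y u c && entry Y v c

def rowCount (l : List ℕ) (N i : ℕ) : ℕ := l.countP fun j => entry N i j

def totalCount (l : List ℕ) (N : ℕ) : ℕ := (l.map (rowCount l N)).sum

/-- The non-edges `N` violate the degree condition at `u` or `v`, or the edge count. -/
def overfull (l : List ℕ) (n e d N u v : ℕ) : Bool :=
  Nat.ble n (rowCount l N u + d) || Nat.ble n (rowCount l N v + d) ||
    Nat.ble (n * (n - 1) + 1) (totalCount l N + 2 * e)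

/-- Branch on whether each listed pair is an edge (`Y`) or a non-edge (`N`); the result is `true`
if every branch ends in a contradiction. -/
def refute (l : List ℕ) (n e d : ℕ) : List (ℕ × ℕ) → ℕ → ℕ → Bool
  | [], _, _ => false
  | (u, v) :: es, Y, N =>
    evalThen (setEntry Y u v) (fun Y' =>
      hasThetaAt l Y' u v || hasK5At l Y' u v || refute l n e d es Y' N) &&
    evalThen (setEntry N u v) (fun N' =>
      overfull l n e d N' u v || refute l n e d es Y N')

/-- Add to `Y` the edges from `0` to the listed vertices. -/
def starSet : ℕ → List ℕ → ℕ
  | Y, [] => Y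
  | Y, j :: l => starSet (setEntry Y 0 j) l

end Search

section Soundness

theorem evalThen_eq (x : ℕ) (f : ℕ → Bool) : evalThen x f = f x := by
  cases x <;> rfl

theorem anyOf_iff {l : List ℕ} {p : ℕ → Bool} : anyOf l p = true ↔ ∃ a ∈ l, p a = true := by
  induction l with
  | nil => simp [anyOf]
  | cons a l ih =>
    have : anyOf (a :: l) p = (p a || anyOf l p) := rfl
    simp [this, ih]

theorem diff_iff {i j : ℕ} : diff i j = true ↔ i ≠ j := by
  simp [diff, ← Bool.not_eq_true, Nat.beq_eq]

theorem entry_eq_testBit (Y i j : ℕ) : entry Y i j = Nat.testBit Y (16 * i + j) := by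
  rw [Nat.testBit_eq_decide_div_mod_eq, ← Nat.shiftRight_eq_div_pow, ← Nat.and_one_is_mod,
    mul_comm, Bool.eq_iff_iff, decide_eq_true_iff]
  exact Nat.beq_eq.to_iff

theorem entry_setEntry {Y u v i j : ℕ} (hu : u < 16) (hv : v < 16) (hj : j < 16) :
    entry (setEntry Y u v) i j = true ↔
      entry Y i j = true ∨ (i = u ∧ j = v) ∨ (i = v ∧ j = u) := by
  simp only [entry_eq_testBit, setEntry, Nat.testBit_or, Nat.testBit_two_pow, Bool.or_eq_true,
    decide_eq_true_eq]
  have h1 : 16 * u + v = 16 * i + j ↔ i = u ∧ j = v := by omega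
  have h2 : 16 * v + u = 16 * i + j ↔ i = v ∧ j = u := by omega
  rw [h1, h2]

/-- A relation without a 6-cycle that has a chord. -/
def ChordedHexagonFree {α : Type*} (A : α → α → Prop) : Prop :=
  ∀ x₀ x₁ x₂ x₃ x₄ x₅ : α, [x₀, x₁, x₂, x₃, x₄, x₅].Nodup →
    A x₀ x₁ → A x₁ x₂ → A x₂ x₃ → A x₃ x₄ → A x₄ x₅ → A x₅ x₀ →
    ¬ (A x₀ x₂ ∨ A x₀ x₃ ∨ A x₀ x₄ ∨ A x₁ x₃ ∨ A x₁ x₄ ∨ A x₁ x₅ ∨ A x₂ x₄ ∨ A x₂ x₅ ∨ A x₃ x₅)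

/-- A relation without five pairwise related points. -/
def PentadFree {α : Type*} (A : α → α → Prop) : Prop :=
  ∀ x₀ x₁ x₂ x₃ x₄ : α, ¬ (A x₀ x₁ ∧ A x₀ x₂ ∧ A x₀ x₃ ∧ A x₀ x₄ ∧ A x₁ x₂ ∧ A x₁ x₃ ∧
    A x₁ x₄ ∧ A x₂ x₃ ∧ A x₂ x₄ ∧ A x₃ x₄)

variable {A : ℕ → ℕ → Prop} {l : List ℕ} {n e d u v Y N : ℕ}

theorem hasThetaAt_eq_false (hA : ∀ i j, A i j → A j i) (hirr : ∀ i, ¬ A i i)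
    (hθ : ChordedHexagonFree A) (hu : u ∈ l) (hv : v ∈ l) (huv : A u v)
    (hY : ∀ i ∈ l, ∀ j ∈ l, entry Y i j = true → A i j) : hasThetaAt l Y u v = false := by
  rw [Bool.eq_false_iff]
  intro h
  simp only [hasThetaAt, anyOf_iff, Bool.and_eq_true, Bool.or_eq_true, diff_iff] at h
  obtain ⟨a, ha, ⟨hua, hav⟩, b, hb, ⟨⟨hvb, hbu⟩, hba⟩, c, hc, ⟨⟨⟨hbc, hcu⟩, hcv⟩, hca⟩,
    d, hd, ⟨⟨⟨⟨hdu, hdv⟩, hda⟩, hdb⟩, hdc⟩, h⟩ := h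
  have hne : ∀ {i j}, A i j → i ≠ j := fun h h' => hirr _ (h' ▸ h)
  have hua := hY _ hu _ ha hua
  have hvb := hY _ hv _ hb hvb
  have hbc := hY _ hb _ hc hbc
  have h1 := hne huv
  have h2 := hne hua
  have h3 := hne hvb
  have h4 := hne hbc
  rcases h with (⟨⟨hca, hud⟩, hdv⟩ | ⟨⟨huc, had⟩, hdv⟩) | ⟨⟨hcd, hda⟩, h⟩
  · refine hθ u a c b v d (by simp; grind) hua (hA _ _ (hY _ hc _ ha hca)) (hA _ _ hbc)
      (hA _ _ hvb) (hA _ _ (hY _ hd _ hv hdv)) (hA _ _ (hY _ hu _ hd hud)) (by tauto)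
  · refine hθ u c b v d a (by simp; grind) (hY _ hu _ hc huc) (hA _ _ hbc)
      (hA _ _ hvb) (hA _ _ (hY _ hd _ hv hdv)) (hA _ _ (hY _ ha _ hd had)) (hA _ _ hua) (by tauto)
  · refine hθ u v b c d a (by simp; grind) huv hvb hbc (hY _ hc _ hd hcd) (hY _ hd _ ha hda)
      (hA _ _ hua) ?_
    have hY' : ∀ i ∈ l, ∀ j ∈ l, entry Y i j = true → A i j ∧ A j i :=
      fun i hi j hj h => ⟨hY i hi j hj h, hA _ _ (hY i hi j hj h)⟩
    grind

theorem hasK5At_eq_false (hK : PentadFree A) (hu : u ∈ l) (hv : v ∈ l) (huv : A u v)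
    (hY : ∀ i ∈ l, ∀ j ∈ l, entry Y i j = true → A i j) : hasK5At l Y u v = false := by
  rw [Bool.eq_false_iff]
  intro h
  simp only [hasK5At, anyOf_iff, Bool.and_eq_true] at h
  obtain ⟨a, ha, ⟨hua, hva⟩, b, hb, ⟨⟨hab, hub⟩, hvb⟩, c, hc, ⟨⟨hac, hbc⟩, huc⟩, hvc⟩ := h
  exact hK u v a b c ⟨huv, hY _ hu _ ha hua, hY _ hu _ hb hub, hY _ hu _ hc huc,
    hY _ hv _ ha hva, hY _ hv _ hb hvb, hY _ hv _ hc hvc, hY _ ha _ hb hab, hY _ ha _ hc hac,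
    hY _ hb _ hc hbc⟩

open Classical in
theorem rowCount_le {i : ℕ} (hi : i ∈ l)
    (hN : ∀ i ∈ l, ∀ j ∈ l, entry N i j = true → i ≠ j ∧ ¬ A i j) :
    rowCount l N i ≤ l.countP fun j => i ≠ j ∧ ¬ A i j :=
  List.countP_mono_left fun j hj h => by simpa using hN i hi j hj h

open Classical in
theorem overfull_eq_false (hu : u ∈ l) (hv : v ∈ l)
    (hdeg : ∀ i ∈ l, (l.countP fun j => i ≠ j ∧ ¬ A i j) + d < n)
    (htot : (l.map fun i => l.countP fun j => i ≠ j ∧ ¬ A i j).sum + 2 * e ≤ n * (n - 1))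
    (hN : ∀ i ∈ l, ∀ j ∈ l, entry N i j = true → i ≠ j ∧ ¬ A i j) :
    overfull l n e d N u v = false := by
  have h1 := rowCount_le hu hN
  have h2 := rowCount_le hv hN
  have h3 := hdeg u hu
  have h4 := hdeg v hv
  have h5 : totalCount l N ≤ _ := List.sum_le_sum fun i hi => rowCount_le hi hN
  rw [Bool.eq_false_iff]
  simp only [overfull, ne_eq, Bool.or_eq_true, Nat.ble_eq]
  omega

open Classical in
theorem refute_eq_false (hA : ∀ i j, A i j → A j i) (hirr : ∀ i, ¬ A i i)
    (hθ : ChordedHexagonFree A) (hK : PentadFree A) (hl : ∀ i ∈ l, i < 16)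
    (hdeg : ∀ i ∈ l, (l.countP fun j => i ≠ j ∧ ¬ A i j) + d < n)
    (htot : (l.map fun i => l.countP fun j => i ≠ j ∧ ¬ A i j).sum + 2 * e ≤ n * (n - 1))
    (es : List (ℕ × ℕ)) (hes : ∀ p ∈ es, p.1 ∈ l ∧ p.2 ∈ l ∧ p.1 ≠ p.2)
    (hY : ∀ i ∈ l, ∀ j ∈ l, entry Y i j = true → A i j)
    (hN : ∀ i ∈ l, ∀ j ∈ l, entry N i j = true → i ≠ j ∧ ¬ A i j) :
    refute l n e d es Y N = false := by
  induction es generalizing Y N with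
  | nil => rfl
  | cons p es ih =>
    obtain ⟨u, v⟩ := p
    obtain ⟨⟨hu, hv, hne⟩, hes⟩ := List.forall_mem_cons.1 hes
    dsimp only at hu hv hne
    simp only [refute, evalThen_eq, Bool.and_eq_false_iff, Bool.or_eq_false_iff]
    by_cases huv : A u v
    · left
      have hY' : ∀ i ∈ l, ∀ j ∈ l, entry (setEntry Y u v) i j = true → A i j := by
        intro i hi j hj h
        rcases (entry_setEntry (hl u hu) (hl v hv) (hl j hj)).1 h with
          h | ⟨rfl, rfl⟩ | ⟨rfl, rfl⟩
        exacts [hY i hi j hj h, huv, hA _ _ huv]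
      exact ⟨⟨hasThetaAt_eq_false hA hirr hθ hu hv huv hY', hasK5At_eq_false hK hu hv huv hY'⟩,
        ih hes hY' hN⟩
    · right
      have hN' : ∀ i ∈ l, ∀ j ∈ l, entry (setEntry N u v) i j = true → i ≠ j ∧ ¬ A i j := by
        intro i hi j hj h
        rcases (entry_setEntry (hl u hu) (hl v hv) (hl j hj)).1 h with
          h | ⟨rfl, rfl⟩ | ⟨rfl, rfl⟩
        exacts [hN i hi j hj h, ⟨hne, huv⟩, ⟨hne.symm, fun h => huv (hA _ _ h)⟩]
      exact ⟨overfull_eq_false hu hv hdeg htot hN', ih hes hY hN'⟩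

end Soundness

section EdgeBound

theorem ChordedHexagonFree.comap {α β : Type*} {A : α → α → Prop} (h : ChordedHexagonFree A)
    {f : β → α} (hf : Function.Injective f) : ChordedHexagonFree fun x y => A (f x) (f y) :=
  fun x₀ x₁ x₂ x₃ x₄ x₅ hx => h (f x₀) (f x₁) (f x₂) (f x₃) (f x₄) (f x₅) (hx.map hf)

theorem ChordedHexagonFree.mono {α : Type*} {A B : α → α → Prop} (h : ChordedHexagonFree A)
    (hBA : ∀ x y, B x y → A x y) : ChordedHexagonFree B := by
  intro x₀ x₁ x₂ x₃ x₄ x₅ hx h₀ h₁ h₂ h₃ h₄ h₅ hc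
  refine h x₀ x₁ x₂ x₃ x₄ x₅ hx (hBA _ _ h₀) (hBA _ _ h₁) (hBA _ _ h₂) (hBA _ _ h₃)
    (hBA _ _ h₄) (hBA _ _ h₅) ?_
  revert hc
  gcongr <;> exact hBA _ _

theorem PentadFree.comap {α β : Type*} {A : α → α → Prop} (h : PentadFree A)
    (f : β → α) : PentadFree fun x y => A (f x) (f y) :=
  fun _ _ _ _ _ => h _ _ _ _ _

theorem PentadFree.mono {α : Type*} {A B : α → α → Prop} (h : PentadFree A)
    (hBA : ∀ x y, B x y → A x y) : PentadFree B := by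
  intro x₀ x₁ x₂ x₃ x₄ hx
  refine h x₀ x₁ x₂ x₃ x₄ ?_
  revert hx
  gcongr <;> exact hBA _ _

/-- Every graph on `n` vertices without chorded hexagon and without `K₅` has at most `m`
edges. -/
def EdgeBound (n m : ℕ) : Prop :=
  ∀ (V : Type) [Fintype V] (G : SimpleGraph V), Fintype.card V = n →
    ChordedHexagonFree G.Adj → PentadFree G.Adj → G.edgeSet.ncard ≤ m

theorem edgeBound_five : EdgeBound 5 9 := by
  classical
  intro V _ G hV _ hK
  have hG : G < ⊤ := by
    refine lt_top_iff_ne_top.2 ?_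
    rintro rfl
    let φ := Fintype.equivFinOfCardEq hV
    refine hK (φ.symm 0) (φ.symm 1) (φ.symm 2) (φ.symm 3) (φ.symm 4) ?_
    simp
  have := Finset.card_lt_card (edgeFinset_ssubset_edgeFinset.2 hG)
  rw [card_edgeFinset_top_eq_card_choose_two, hV, show Nat.choose 5 2 = 10 from rfl] at this
  rw [← coe_edgeFinset, Set.ncard_coe_finset]
  omega

theorem exists_equiv_fin_of_degree {V : Type*} [Fintype V] {n : ℕ}
    (hV : Fintype.card V = n + 1) (G : SimpleGraph V) [DecidableRel G.Adj] (v : V) :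
    ∃ φ : V ≃ Fin (n + 1), φ v = 0 ∧
      ∀ w, G.Adj v w ↔ 1 ≤ (φ w).1 ∧ (φ w).1 ≤ G.degree v := by
  classical
  have hd : G.degree v < n + 1 := hV ▸ G.degree_lt_card_verts v
  let e₀ := Fintype.equivFinOfCardEq hV
  let q : Fin (n + 1) → Prop := fun j => 1 ≤ j.1 ∧ j.1 ≤ G.degree v
  let e : {j // G.Adj v (e₀.symm j)} ≃ {j // q j} :=
    (e₀.symm.subtypeEquiv fun _ => Iff.rfl).trans <|
      (Fintype.equivFinOfCardEq (α := {w // G.Adj v w}) (n := G.degree v) (by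
        rw [← G.card_neighborSet_eq_degree]; rfl)).trans
      { toFun := fun i => ⟨⟨i + 1, by omega⟩, by dsimp only [q]; omega⟩
        invFun := fun j => ⟨j.1 - 1, by have := j.2; dsimp only [q] at this; omega⟩
        left_inv := fun i => by simp
        right_inv := fun j => by
          have := j.2.1
          ext
          simp only
          omega }
  have hq : ∀ w, G.Adj v w ↔ q (e.extendSubtype (e₀ w)) := fun w => by
    constructor
    · exact fun h => e.extendSubtype_mem _ (by simpa using h)
    · intro h
      by_contra hw
      exact e.extendSubtype_not_mem (e₀ w) (by simpa using hw) h
  let ψ : V ≃ Fin (n + 1) := e₀.trans e.extendSubtype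
  have hv : ¬ q (ψ v) := fun h => G.irrefl ((hq v).2 h)
  have h0 : ¬ q 0 := fun h => by simpa [q] using h.1
  refine ⟨ψ.trans (Equiv.swap (ψ v) 0), by simp, fun w => ?_⟩
  change _ ↔ q (Equiv.swap (ψ v) 0 (ψ w))
  rw [hq]
  change q (ψ w) ↔ _
  by_cases h1 : ψ w = ψ v
  · simp [h1, hv, h0]
  by_cases h2 : ψ w = 0
  · simp [h2, hv, h0]
  rw [Equiv.swap_apply_of_ne_of_ne h1 h2]

open Classical in
theorem countP_range_compl_degree {V : Type*} [Fintype V] {n : ℕ} (G : SimpleGraph V)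
    (φ : V ≃ Fin n) {A : ℕ → ℕ → Prop} (hA : ∀ v w, A (φ v) (φ w) ↔ G.Adj v w) (v : V) :
    ((List.range n).countP fun j => ((φ v).1 ≠ j ∧ ¬ A (φ v) j)) = Gᶜ.degree v := by
  rw [← card_neighborFinset_eq_degree,
    ← Finset.card_map (φ.toEmbedding.trans Fin.valEmbedding)]
  refine (Nat.count_eq_card_filter_range _ n).trans (congrArg _ ?_)
  ext j
  simp only [Finset.mem_filter, Finset.mem_range, Finset.mem_map, mem_neighborFinset, compl_adj,
    Function.Embedding.trans_apply, Equiv.coe_toEmbedding, Fin.valEmbedding_apply]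
  constructor
  · rintro ⟨hj, hne, hnA⟩
    obtain ⟨w, hw⟩ := φ.surjective ⟨j, hj⟩
    obtain rfl : (φ w).1 = j := by rw [hw]
    exact ⟨w, ⟨fun h => hne (h ▸ rfl), by rwa [← hA]⟩, rfl⟩
  · rintro ⟨w, ⟨hne, hnA⟩, rfl⟩
    exact ⟨(φ w).2, fun h => hne (φ.injective (Fin.ext h)), by rwa [hA]⟩

/-- A branching order `es` on which the search refutes all graphs with `n` vertices, `e` edges
and minimum degree `d`, the neighbours of vertex `0` being `1, …, d`. -/
def Refutes (n e d : ℕ) (es : List (ℕ × ℕ)) (Y N : ℕ) : Prop :=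
  (∀ p ∈ es, p.1 < n ∧ p.2 < n ∧ p.1 ≠ p.2) ∧
  (∀ i < n, ∀ j < n, entry Y i j = true → min i j = 0 ∧ 1 ≤ max i j ∧ max i j ≤ d) ∧
  (∀ i < n, ∀ j < n, entry N i j = true → i = 0 ∧ d < j ∨ j = 0 ∧ d < i) ∧
  refute (List.range n) n e d es Y N = true

theorem EdgeBound.succ {n m m' : ℕ} (hn : n < 16) (ih : EdgeBound n m')
    (href : ∀ d, m < m' + d → (n + 1) * d ≤ 2 * (m + 1) →
      ∃ es Y N, Refutes (n + 1) (m + 1) d es Y N) : EdgeBound (n + 1) m := by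
  classical
  intro V _ G' hV hθ' hK'
  by_contra! hcard
  obtain ⟨G, hG, hθ, hK⟩ : ∃ G : SimpleGraph V, G.edgeFinset.card = m + 1 ∧
      ChordedHexagonFree G.Adj ∧ PentadFree G.Adj := by
    rw [← coe_edgeFinset, Set.ncard_coe_finset] at hcard
    obtain ⟨s, hs, hs'⟩ := Finset.exists_subset_card_eq hcard
    change s.card = m + 1 at hs'
    have hdiag : ∀ x ∈ s, ¬ x.IsDiag := fun x hx =>
      G'.not_isDiag_of_mem_edgeSet (mem_edgeFinset.1 (hs hx))
    have hle : ∀ x y, (fromEdgeSet (s : Set (Sym2 V))).Adj x y → G'.Adj x y := fun x y h => by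
      simpa using hs ((fromEdgeSet_adj _).1 h).1
    refine ⟨fromEdgeSet s, ?_, hθ'.mono hle, hK'.mono hle⟩
    rw [← hs', ← Set.ncard_coe_finset, coe_edgeFinset, edgeSet_fromEdgeSet,
      ← Set.ncard_coe_finset]
    refine congrArg _ (Set.ext fun x => ?_)
    simpa using hdiag x
  have : Nonempty V := Fintype.card_pos_iff.1 (by omega)
  obtain ⟨v, hv⟩ := G.exists_minimal_degree_vertex
  have hmin : ∀ w, G.degree v ≤ G.degree w := fun w => hv ▸ G.minDegree_le_degree w
  have hsum := G.sum_degrees_eq_twice_card_edges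
  have hdel : m < m' + G.degree v := by
    have h1 := G.card_edgeFinset_induce_compl_singleton v
    rw [G.card_edgeFinset_deleteIncidenceSet] at h1
    have h2 := ih ({v}ᶜ : Set V) (G.induce {v}ᶜ)
      (by rw [Fintype.card_compl_set]; simp [hV])
      (hθ.comap Subtype.val_injective) (hK.comap _)
    rw [← coe_edgeFinset, Set.ncard_coe_finset] at h2
    omega
  have hdeg : (n + 1) * G.degree v ≤ 2 * (m + 1) := by
    rw [← hG, ← hsum, ← hV, ← smul_eq_mul, ← Finset.card_univ]
    exact Finset.card_nsmul_le_sum _ _ _ fun w _ => hmin w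
  obtain ⟨es, Y, N, hes, hY, hN, href⟩ := href _ hdel hdeg
  obtain ⟨φ, hφv, hφ⟩ := exists_equiv_fin_of_degree hV G v
  obtain ⟨A, hAdef⟩ : ∃ A : ℕ → ℕ → Prop, ∀ i j, A i j ↔ ∃ (hi : i < n + 1) (hj : j < n + 1),
    G.Adj (φ.symm ⟨i, hi⟩) (φ.symm ⟨j, hj⟩) := ⟨_, fun _ _ => Iff.rfl⟩
  have hA : ∀ x y, A (φ x) (φ y) ↔ G.Adj x y := fun x y => (hAdef _ _).trans
    ⟨fun ⟨_, _, h⟩ => by simpa using h, fun h => ⟨(φ x).2, (φ y).2, by simpa using h⟩⟩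
  have hlt : ∀ {i j}, A i j → i < n + 1 := fun h => ((hAdef _ _).1 h).1
  have hsurj : ∀ i < n + 1, ∃ w, (φ w).1 = i := fun i hi => ⟨φ.symm ⟨i, hi⟩, by simp⟩
  have hAv : ∀ j < n + 1, A 0 j ↔ 1 ≤ j ∧ j ≤ G.degree v := fun j hj => by
    obtain ⟨w, rfl⟩ := hsurj j hj
    rw [← hφ, ← hA, hφv]
    rfl
  have hsymm : ∀ i j, A i j → A j i := fun i j h =>
    let ⟨hi, hj, h⟩ := (hAdef i j).1 h
    (hAdef j i).2 ⟨hj, hi, h.symm⟩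
  have hcompl : ∀ w, Gᶜ.degree w + G.degree w = n := fun w => by
    have h1 := G.degree_compl w
    have h2 := G.degree_lt_card_verts w
    omega
  have hcount := countP_range_compl_degree G φ hA
  refine Bool.false_ne_true (.trans (.symm (refute_eq_false (A := A) hsymm
    (fun i h => let ⟨_, _, h⟩ := (hAdef i i).1 h; G.irrefl h) ?_ ?_ ?_ ?_ ?_ es ?_ ?_ ?_)) href)
  · intro x₀ x₁ x₂ x₃ x₄ x₅ hx h₀ h₁ h₂ h₃ h₄ h₅
    obtain ⟨y₀, rfl⟩ := hsurj x₀ (hlt h₀)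
    obtain ⟨y₁, rfl⟩ := hsurj x₁ (hlt h₁)
    obtain ⟨y₂, rfl⟩ := hsurj x₂ (hlt h₂)
    obtain ⟨y₃, rfl⟩ := hsurj x₃ (hlt h₃)
    obtain ⟨y₄, rfl⟩ := hsurj x₄ (hlt h₄)
    obtain ⟨y₅, rfl⟩ := hsurj x₅ (hlt h₅)
    simp only [hA] at *
    exact hθ y₀ y₁ y₂ y₃ y₄ y₅ (.of_map (fun y => (φ y).1) hx) h₀ h₁ h₂ h₃ h₄ h₅
  · rintro x₀ x₁ x₂ x₃ x₄ ⟨h₁, h₂, h₃, h₄, h⟩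
    obtain ⟨y₀, rfl⟩ := hsurj x₀ (hlt h₁)
    obtain ⟨y₁, rfl⟩ := hsurj x₁ (hlt (hsymm _ _ h₁))
    obtain ⟨y₂, rfl⟩ := hsurj x₂ (hlt (hsymm _ _ h₂))
    obtain ⟨y₃, rfl⟩ := hsurj x₃ (hlt (hsymm _ _ h₃))
    obtain ⟨y₄, rfl⟩ := hsurj x₄ (hlt (hsymm _ _ h₄))
    simp only [hA] at *
    exact hK y₀ y₁ y₂ y₃ y₄ ⟨h₁, h₂, h₃, h₄, h⟩
  · intro i hi
    have := List.mem_range.1 hi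
    omega
  · intro i hi
    obtain ⟨w, rfl⟩ := hsurj i (List.mem_range.1 hi)
    rw [hcount]
    have h1 := hcompl w
    have h2 := hmin w
    omega
  · have h1 : ((List.range (n + 1)).map fun i =>
        (List.range (n + 1)).countP fun j => i ≠ j ∧ ¬ A i j).sum = ∑ w, Gᶜ.degree w := by
      rw [← List.sum_toFinset _ List.nodup_range, List.toFinset_range, Finset.sum_range,
        ← φ.sum_comp]
      exact Finset.sum_congr rfl fun w _ => hcount w
    have h2 : ∑ w, Gᶜ.degree w + ∑ w, G.degree w = (n + 1) * n := by
      rw [← Finset.sum_add_distrib, Finset.sum_congr rfl fun w _ => hcompl w]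
      simp [hV]
    rw [h1, Nat.add_sub_cancel, ← h2, hsum, hG]
  · intro p hp
    simpa using hes p hp
  · intro i hi j hj h
    rw [List.mem_range] at hi hj
    obtain ⟨h₀, h₁, h₂⟩ := hY i hi j hj h
    obtain ⟨rfl, h'⟩ | ⟨rfl, h'⟩ : i = 0 ∧ 1 ≤ j ∧ j ≤ G.degree v ∨
        j = 0 ∧ 1 ≤ i ∧ i ≤ G.degree v := by omega
    exacts [(hAv _ hj).2 h', hsymm _ _ ((hAv _ hi).2 h')]
  · intro i hi j hj h
    rw [List.mem_range] at hi hj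
    rcases hN i hi j hj h with ⟨rfl, hd⟩ | ⟨rfl, hd⟩
    · exact ⟨by omega, fun h' => by have := (hAv _ hj).1 h'; omega⟩
    · exact ⟨by omega, fun h' => by have := (hAv _ hi).1 (hsymm _ _ h'); omega⟩

end EdgeBound

section NineVertices

theorem edgeBound_six : EdgeBound 6 10 :=
  edgeBound_five.succ (by decide) fun d h₁ h₂ => by
    obtain rfl | rfl : d = 2 ∨ d = 3 := by omega
    · exact ⟨[(3, 4), (4, 5), (1, 3), (2, 5), (3, 5), (1, 4), (2, 3), (2, 4), (1, 5), (1, 2)],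
        starSet 0 [1, 2], starSet 0 [3, 4, 5],
        by decide +kernel, by decide +kernel, by decide +kernel, by decide +kernel⟩
    · exact ⟨[(3, 4), (1, 5), (2, 5), (1, 4), (3, 5), (2, 4), (4, 5), (1, 3), (1, 2), (2, 3)],
        starSet 0 [1, 2, 3], starSet 0 [4, 5],
        by decide +kernel, by decide +kernel, by decide +kernel, by decide +kernel⟩

theorem edgeBound_seven : EdgeBound 7 12 :=
  edgeBound_six.succ (by decide) fun d h₁ h₂ => by
    obtain rfl : d = 3 := by omega
    exact ⟨[(1, 5), (4, 5), (2, 5), (3, 5), (1, 4), (2, 4), (3, 4), (4, 6), (5, 6), (1, 6), (3, 6),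
        (2, 6), (1, 2), (2, 3), (1, 3)],
      starSet 0 [1, 2, 3], starSet 0 [4, 5, 6],
      by decide +kernel, by decide +kernel, by decide +kernel, by decide +kernel⟩

theorem edgeBound_eight : EdgeBound 8 15 :=
  edgeBound_seven.succ (by decide) fun d h₁ h₂ => by
    obtain rfl : d = 4 := by omega
    exact ⟨[(4, 5), (3, 5), (2, 5), (1, 5), (3, 4), (1, 2), (1, 3), (2, 4), (2, 3), (1, 4), (3, 6),
        (2, 6), (1, 6), (5, 6), (5, 7), (4, 7), (1, 7), (4, 6), (3, 7), (2, 7), (6, 7)],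
      starSet 0 [1, 2, 3, 4], starSet 0 [5, 6, 7],
      by decide +kernel, by decide +kernel, by decide +kernel, by decide +kernel⟩

theorem edgeBound_nine : EdgeBound 9 18 :=
  edgeBound_eight.succ (by decide) fun d h₁ h₂ => by
    obtain rfl : d = 4 := by omega
    exact ⟨[(1, 6), (2, 6), (1, 5), (3, 5), (2, 5), (3, 6), (4, 5), (4, 6), (5, 6), (6, 7), (5, 7),
        (3, 7), (1, 7), (4, 7), (2, 7), (6, 8), (5, 8), (7, 8), (3, 8), (2, 8), (4, 8), (1, 8),
        (1, 3), (2, 3), (3, 4), (1, 2), (2, 4), (1, 4)],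
      starSet 0 [1, 2, 3, 4], starSet 0 [5, 6, 7, 8],
      by decide +kernel, by decide +kernel, by decide +kernel, by decide +kernel⟩

end NineVertices

section ForbiddenSubgraphs

variable {V : Type*} {G : SimpleGraph V}

theorem Theta6Free.chordedHexagonFree (hG : Theta6Free G) : ChordedHexagonFree G.Adj := by
  intro x₀ x₁ x₂ x₃ x₄ x₅ hx h₀ h₁ h₂ h₃ h₄ h₅ hc
  have hinj : Function.Injective ![x₀, x₁, x₂, x₃, x₄, x₅] := by
    rw [← List.nodup_ofFn]
    simpa using hx
  have hcyc : cycle6 ≤ G.comap ![x₀, x₁, x₂, x₃, x₄, x₅] := by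
    rw [cycle6, fromEdgeSet_le]
    rintro e ⟨he, -⟩
    simp only [Set.mem_insert_iff, Set.mem_singleton_iff] at he
    rcases he with rfl | rfl | rfl | rfl | rfl | rfl
    exacts [h₀, h₁, h₂, h₃, h₄, h₅.symm]
  have key : ∀ a b : Fin 6, a ≠ b → ¬ cycle6.Adj a b →
      ¬ G.Adj (![x₀, x₁, x₂, x₃, x₄, x₅] a) (![x₀, x₁, x₂, x₃, x₄, x₅] b) := by
    intro a b hab hab' h
    have hle : cycle6 ⊔ fromEdgeSet {s(a, b)} ≤ G.comap ![x₀, x₁, x₂, x₃, x₄, x₅] := by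
      refine sup_le hcyc ?_
      rw [fromEdgeSet_le]
      rintro e ⟨rfl, -⟩
      exact h
    exact hG a b hab hab' ⟨⟨_, @hle⟩, hinj⟩
  rcases hc with h | h | h | h | h | h | h | h | h
  exacts [key 0 2 (by decide) (by simp [cycle6]) h, key 0 3 (by decide) (by simp [cycle6]) h,
    key 0 4 (by decide) (by simp [cycle6]) h, key 1 3 (by decide) (by simp [cycle6]) h,
    key 1 4 (by decide) (by simp [cycle6]) h, key 1 5 (by decide) (by simp [cycle6]) h,
    key 2 4 (by decide) (by simp [cycle6]) h, key 2 5 (by decide) (by simp [cycle6]) h,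
    key 3 5 (by decide) (by simp [cycle6]) h]

theorem SimpleGraph.HasPlanarEmbedding.pentadFree (hG : G.HasPlanarEmbedding) :
    PentadFree G.Adj := by
  rintro x₀ x₁ x₂ x₃ x₄ ⟨h₀₁, h₀₂, h₀₃, h₀₄, h₁₂, h₁₃, h₁₄, h₂₃, h₂₄, h₃₄⟩
  have hadj : ∀ a b : Fin 5, a ≠ b →
      G.Adj (![x₀, x₁, x₂, x₃, x₄] a) (![x₀, x₁, x₂, x₃, x₄] b) := by
    intro a b hab
    fin_cases a <;> fin_cases b <;> first
      | exact absurd rfl hab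
      | assumption
      | exact SimpleGraph.Adj.symm (by assumption)
  refine hG.not_top_fin_five _ (fun a b hab => ?_) hadj
  by_contra hne
  exact (hadj a b hne).ne hab

end ForbiddenSubgraphs

section StraightLine

/-- Twice the signed area of the triangle `p q r`. -/
def orient {R : Type*} [CommRing R] (p q r : R × R) : R :=
  (q.1 - p.1) * (r.2 - p.2) - (q.2 - p.2) * (r.1 - p.1)

/-- The segment from `x` to `y` lies weakly to the left of the directed line from `u` to `v` and
is not contained in it. -/
def SegmentLeft (u v x y : ℤ × ℤ) : Prop :=
  0 ≤ orient u v x ∧ 0 ≤ orient u v y ∧ 0 < orient u v x + orient u v y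

instance (u v x y : ℤ × ℤ) : Decidable (SegmentLeft u v x y) :=
  inferInstanceAs (Decidable (_ ∧ _ ∧ _))

def toPlane (p : ℤ × ℤ) : ℝ × ℝ := (p.1, p.2)

theorem orient_toPlane (p q r : ℤ × ℤ) :
    orient (toPlane p) (toPlane q) (toPlane r) = (orient p q r : ℤ) := by
  simp [orient, toPlane]

theorem toPlane_injective : Function.Injective toPlane := fun p q h => by
  simpa [toPlane, Prod.ext_iff] using h

def segmentPoint (p q : ℝ × ℝ) (t : ℝ) : ℝ × ℝ := (1 - t) • p + t • q

theorem segmentPoint_one_sub (p q : ℝ × ℝ) (t : ℝ) :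
    segmentPoint p q (1 - t) = segmentPoint q p t := by
  simp [segmentPoint, add_comm]

theorem orient_segmentPoint (p q a b : ℝ × ℝ) (t : ℝ) :
    orient p q (segmentPoint a b t) = (1 - t) * orient p q a + t * orient p q b := by
  simp [orient, segmentPoint]
  ring

theorem orient_segmentPoint_self (p q : ℝ × ℝ) (t : ℝ) : orient p q (segmentPoint p q t) = 0 := by
  simp [orient, segmentPoint]
  ring

theorem segmentPoint_injective {p q : ℝ × ℝ} (h : p ≠ q) :
    Function.Injective (segmentPoint p q) := by
  intro s t hst
  have h0 : (s - t) • (q - p) = 0 := by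
    rw [← sub_eq_zero] at hst
    rw [← hst, segmentPoint, segmentPoint]
    module
  rcases smul_eq_zero.1 h0 with h0 | h0
  · exact sub_eq_zero.1 h0
  · exact absurd (sub_eq_zero.1 h0).symm h

theorem SegmentLeft.segmentPoint_ne {u v x y : ℤ × ℤ} (h : SegmentLeft u v x y) {s t : ℝ}
    (ht : t ∈ Set.Ioo (0 : ℝ) 1) :
    segmentPoint (toPlane u) (toPlane v) s ≠ segmentPoint (toPlane x) (toPlane y) t := by
  intro hst
  have h0 := orient_segmentPoint (toPlane u) (toPlane v) (toPlane x) (toPlane y) t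
  rw [← hst, orient_segmentPoint_self, orient_toPlane, orient_toPlane] at h0
  obtain ⟨h1, h2, h3⟩ := h
  obtain ⟨ht0, ht1⟩ := ht
  have h1' : (0 : ℝ) ≤ (orient u v x : ℤ) := by exact_mod_cast h1
  have h2' : (0 : ℝ) ≤ (orient u v y : ℤ) := by exact_mod_cast h2
  have h3' : (0 : ℝ) < (orient u v x : ℤ) + (orient u v y : ℤ) := by exact_mod_cast h3
  rcases h1'.eq_or_lt with h4 | h4
  · rw [← h4, zero_add] at h3'
    rw [← h4, mul_zero, zero_add] at h0
    exact (mul_pos ht0 h3').ne h0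
  · linarith [mul_pos (sub_pos.2 ht1) h4, mul_nonneg ht0.le h2']

theorem SimpleGraph.HasPlanarEmbedding.of_straightLine {V : Type*} {G : SimpleGraph V}
    {P : V → ℤ × ℤ} (hP : Function.Injective P)
    (hvert : ∀ u v w, G.Adj u v → w ≠ u → w ≠ v → orient (P u) (P v) (P w) ≠ 0)
    (hedge : ∀ u v x y, G.Adj u v → G.Adj x y → s(u, v) ≠ s(x, y) →
      SegmentLeft (P u) (P v) (P x) (P y) ∨ SegmentLeft (P v) (P u) (P x) (P y) ∨
      SegmentLeft (P x) (P y) (P u) (P v) ∨ SegmentLeft (P y) (P x) (P u) (P v)) :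
    G.HasPlanarEmbedding := by
  have hpos : Function.Injective (toPlane ∘ P) := toPlane_injective.comp hP
  refine ⟨toPlane ∘ P, fun u v => segmentPoint (toPlane (P u)) (toPlane (P v)), hpos, ?_, ?_⟩
  · intro u v huv
    have hinj := segmentPoint_injective (hpos.ne huv.ne)
    have h0 : segmentPoint (toPlane (P u)) (toPlane (P v)) 0 = toPlane (P u) := by
      simp [segmentPoint]
    have h1 : segmentPoint (toPlane (P u)) (toPlane (P v)) 1 = toPlane (P v) := by
      simp [segmentPoint]
    refine ⟨?_, hinj.injOn, h0, h1, fun t => (segmentPoint_one_sub _ _ _).symm, ?_⟩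
    · unfold segmentPoint
      fun_prop
    · rintro w t ⟨ht0, ht1⟩ h
      by_cases hwu : w = u
      · subst hwu
        exact ht0.ne' (hinj (h.trans h0.symm))
      by_cases hwv : w = v
      · subst hwv
        exact ht1.ne (hinj (h.trans h1.symm))
      have := orient_segmentPoint_self (toPlane (P u)) (toPlane (P v)) t
      rw [show segmentPoint _ _ t = _ from h, Function.comp_apply, orient_toPlane] at this
      exact hvert u v w huv hwu hwv (by exact_mod_cast this)
  · intro u v x y huv hxy hne s hs t ht h
    have hs' : 1 - s ∈ Set.Ioo (0 : ℝ) 1 := ⟨by linarith [hs.2], by linarith [hs.1]⟩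
    rcases hedge u v x y huv hxy hne with hl | hl | hl | hl
    · exact hl.segmentPoint_ne ht h
    · exact hl.segmentPoint_ne (s := 1 - s) ht ((segmentPoint_one_sub _ _ _).trans h)
    · exact hl.segmentPoint_ne hs h.symm
    · exact hl.segmentPoint_ne (s := 1 - t) hs ((segmentPoint_one_sub _ _ _).trans h.symm)

end StraightLine

section Butterfly

/-- Adjacency in two copies of `K₅⁻`, on `{0, 1, 2, 3, 4}` and `{0, 5, 6, 7, 8}`, missing the edges
`14` and `58` respectively. -/
def butterflyAdj (i j : Fin 9) : Bool :=
  i ≠ j ∧ ((i ≤ 4 ∧ j ≤ 4) ∨ ((i = 0 ∨ 5 ≤ i) ∧ (j = 0 ∨ 5 ≤ j))) ∧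
    ¬ (s(i, j) = s(1, 4) ∨ s(i, j) = s(5, 8))

/-- Two copies of `K₅⁻` sharing the vertex `0`. -/
def butterfly : SimpleGraph (Fin 9) where
  Adj i j := butterflyAdj i j = true
  symm := ⟨by decide +kernel⟩
  loopless := ⟨by decide +kernel⟩

instance : DecidableRel butterfly.Adj := fun i j =>
  inferInstanceAs (Decidable (butterflyAdj i j = true))

def butterflyPoint : Fin 9 → ℤ × ℤ :=
  ![(0, 0), (1, 4), (1, 1), (4, -1), (2, 0), (-1, 1), (-1, 4), (-3, 2), (-4, 2)]

theorem butterfly_hasPlanarEmbedding : butterfly.HasPlanarEmbedding :=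
  .of_straightLine (P := butterflyPoint) (by decide +kernel) (by decide +kernel) (by decide +kernel)

theorem butterfly_no_hexagon : ∀ x₀ x₁, butterfly.Adj x₀ x₁ → ∀ x₂, butterfly.Adj x₁ x₂ → x₂ ≠ x₀ →
    ∀ x₃, butterfly.Adj x₂ x₃ → x₃ ≠ x₀ → x₃ ≠ x₁ →
    ∀ x₄, butterfly.Adj x₃ x₄ → x₄ ≠ x₀ → x₄ ≠ x₁ → x₄ ≠ x₂ →
    ∀ x₅, butterfly.Adj x₄ x₅ → x₅ ≠ x₀ → x₅ ≠ x₁ → x₅ ≠ x₂ → x₅ ≠ x₃ →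
    ¬ butterfly.Adj x₅ x₀ := by
  decide +kernel

theorem butterfly_theta6Free : Theta6Free butterfly := by
  rintro a b - - ⟨f, hf⟩
  have hadj : ∀ i j : Fin 6, cycle6.Adj i j → butterfly.Adj (f i) (f j) :=
    fun i j h => f.map_adj (Or.inl h)
  exact butterfly_no_hexagon (f 0) (f 1) (hadj _ _ (by simp [cycle6]))
    (f 2) (hadj _ _ (by simp [cycle6])) (hf.ne (by decide))
    (f 3) (hadj _ _ (by simp [cycle6])) (hf.ne (by decide)) (hf.ne (by decide))
    (f 4) (hadj _ _ (by simp [cycle6])) (hf.ne (by decide)) (hf.ne (by decide)) (hf.ne (by decide))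
    (f 5) (hadj _ _ (by simp [cycle6])) (hf.ne (by decide)) (hf.ne (by decide)) (hf.ne (by decide))
    (hf.ne (by decide)) (hadj _ _ (by simp [cycle6]))

theorem ncard_edgeSet_butterfly : butterfly.edgeSet.ncard = 18 := by
  rw [← coe_edgeFinset, Set.ncard_coe_finset]
  decide +kernel

end Butterfly

/-- There is a planar, `Θ₆`-free simple graph on 9 vertices with 18 edges; together with
the upper bound at `n = 9` this gives `ex_P(9, Θ₆) = 18 = 18(9-2)/7`. -/
theorem planar_turan_theta6_nine :
    (∃ G : SimpleGraph (Fin 9), G.HasPlanarEmbedding ∧ Theta6Free G ∧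
      G.edgeSet.ncard = 18) ∧
    (∀ (V : Type) [Fintype V] (G : SimpleGraph V), Fintype.card V = 9 →
      G.HasPlanarEmbedding → Theta6Free G → G.edgeSet.ncard ≤ 18) :=
  ⟨⟨butterfly, butterfly_hasPlanarEmbedding, butterfly_theta6Free, ncard_edgeSet_butterfly⟩,
    fun V _ G hV hG hθ => edgeBound_nine V G hV hθ.chordedHexagonFree hG.pentadFree⟩
end
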